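/- Let P be a one-parameter FISI deformation of a polynomial f₀ of degree d ≥ 2 whose total space Y is nonsingular for |s| small (equivalently Σ₀ ∩ {φ_d = 0} = ∅). Let p ∈ Σ₀ and t₀ ∈ ℂ with (p, 0, t₀) ∈ Γ_P (equivalently λ_{p,t₀}(0) ≠ 0). Then there exist a neighborhood U of (p, t₀) in ℙⁿ × ℂ and ε > 0 such that for every s with 0 < |s| < ε one has the strict inequality λ_{p,t₀}(0) < Σ μ_a(f_s), where the sum is taken over the affine critical points a of f_s with ([a:1], f_s(a)) ∈ U, i.e. over the singular points of f_s which tend to (p, t₀) as s → 0. -/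

import Mathlib

open MvPolynomial Filter CategoryTheory Limits Topology

noncomputable section

abbrev XS (n : ℕ) := Fin n ⊕ Unit
abbrev HV (n : ℕ) := Fin n ⊕ Unit
abbrev TV (n : ℕ) := Fin n ⊕ Fin 3

/-- ℙ^{n-1}, the hyperplane at infinity of ℙⁿ. -/
abbrev PrjInf (n : ℕ) := Projectivization ℂ (Fin n → ℂ)
/-- ℙⁿ. -/
abbrev Prj (n : ℕ) := Projectivization ℂ (HV n → ℂ)

/-- weights for the degree in the `x`-variables only: `s` has weight `0`. -/
def wtx (n : ℕ) : XS n → ℕ := Sum.elim (fun _ => 1) (fun _ => 0)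

/-- `P_q`, the degree-`q` homogeneous part of `P` in the variables `x`. -/
def xpart {n : ℕ} (P : MvPolynomial (XS n) ℂ) (q : ℕ) : MvPolynomial (XS n) ℂ :=
  weightedHomogeneousComponent (wtx n) q P

/-- the evaluation point `(x, s)`. -/
def evA {n : ℕ} (x : Fin n → ℂ) (s : ℂ) : XS n → ℂ := Sum.elim x (fun _ => s)

/-- `deg_x P(·,s) = d` at the parameter value `s`. -/
def DegXAt {n : ℕ} (d : ℕ) (P : MvPolynomial (XS n) ℂ) (s : ℂ) : Prop :=
  (∀ q, d < q → ∀ x : Fin n → ℂ, eval (evA x s) (xpart P q) = 0) ∧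
  (∃ x : Fin n → ℂ, eval (evA x s) (xpart P d) ≠ 0)

/-- the substitution embedding the variables `(x,s)` into the variables `(x,x₀,s,t)`. -/
def embT {n : ℕ} : XS n → MvPolynomial (TV n) ℂ :=
  Sum.elim (fun i => X (Sum.inl i)) (fun _ => X (Sum.inr 1))

/-- The defining polynomial `F = P̃(x,x₀,s) - t·x₀^d` of the total space
`Y ⊂ ℙⁿ × ℂ_s × ℂ_t`, where `P̃ = Σ_{q ≤ d} x₀^{d-q} P_q(x,s)` is the homogenization
of `P` in `x` by the variable `x₀`. -/
def FY {n : ℕ} (d : ℕ) (P : MvPolynomial (XS n) ℂ) : MvPolynomial (TV n) ℂ :=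
  (∑ q ∈ Finset.range (d+1), (X (Sum.inr 0))^(d-q) * aeval embT (xpart P q))
    - X (Sum.inr 2) * (X (Sum.inr 0))^d

/-- the evaluation point `((x,x₀), s, t)` of the variables of `FY`. -/
def evT {n : ℕ} (u : HV n → ℂ) (s t : ℂ) : TV n → ℂ :=
  Sum.elim (fun i => u (Sum.inl i)) ![u (Sum.inr ()), s, t]

/-- `([u], s, t) ∈ Y`. -/
def OnY {n : ℕ} (d : ℕ) (P : MvPolynomial (XS n) ℂ) (u : HV n → ℂ) (s t : ℂ) : Prop :=
  eval (evT u s t) (FY d P) = 0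

/-- all partial derivatives of the defining equation of `Y` — with respect to the
homogeneous coordinates `(x, x₀)` and the affine coordinates `s, t` — vanish at
`([u], s, t)`; together with `OnY` this says `([u],s,t)` is a singular point of `Y`. -/
def AllDerivsVanish {n : ℕ} (d : ℕ) (P : MvPolynomial (XS n) ℂ) (u : HV n → ℂ)
    (s t : ℂ) : Prop :=
  ∀ v : TV n, eval (evT u s t) (pderiv v (FY d P)) = 0

/-- the partial derivatives with respect to the homogeneous coordinates `(x, x₀)`
vanish at `([u], s, t)`; together with `OnY` this says `[u]` is a singular point of the
projective fiber `Y_{s,t}`. -/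
def FiberDerivsVanish {n : ℕ} (d : ℕ) (P : MvPolynomial (XS n) ℂ) (u : HV n → ℂ)
    (s t : ℂ) : Prop :=
  (∀ i : Fin n, eval (evT u s t) (pderiv (Sum.inl i) (FY d P)) = 0) ∧
    eval (evT u s t) (pderiv (Sum.inr 0) (FY d P)) = 0

/-- the partial derivatives with respect to `(x, x₀)` and `t` (but not `s`) vanish;
together with `OnY` this identifies the singular points of `Y_{s,ℂ}`, resp. the critical
points of the projection `σ : Y → ℂ_s`. -/
def SliceDerivsVanish {n : ℕ} (d : ℕ) (P : MvPolynomial (XS n) ℂ) (u : HV n → ℂ)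
    (s t : ℂ) : Prop :=
  FiberDerivsVanish d P u s t ∧ eval (evT u s t) (pderiv (Sum.inr 2) (FY d P)) = 0

/-- `[x] ∈ W_s`: all `∂P_d/∂x_i` vanish at `(x,s)`. -/
def WCond {n : ℕ} (d : ℕ) (P : MvPolynomial (XS n) ℂ) (x : Fin n → ℂ) (s : ℂ) : Prop :=
  ∀ i : Fin n, eval (evA x s) (pderiv (Sum.inl i) (xpart P d)) = 0

/-- `[x] ∈ Σ_s`: moreover `P_{d-1}(x,s) = 0`. -/
def SCond {n : ℕ} (d : ℕ) (P : MvPolynomial (XS n) ℂ) (x : Fin n → ℂ) (s : ℂ) : Prop :=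
  WCond d P x s ∧ eval (evA x s) (xpart P (d-1)) = 0

/-- `φ_d(x) = ∂P_d/∂s (x, 0) = 0`. -/
def PhiCond {n : ℕ} (d : ℕ) (P : MvPolynomial (XS n) ℂ) (x : Fin n → ℂ) : Prop :=
  eval (evA x 0) (pderiv (Sum.inr ()) (xpart P d)) = 0

/-- `W_s ⊂ ℙ^{n-1}` as a set of projective points. -/
def Wset {n : ℕ} (d : ℕ) (P : MvPolynomial (XS n) ℂ) (s : ℂ) : Set (PrjInf n) :=
  {p | WCond d P p.rep s}

/-- `Σ_s ⊂ ℙ^{n-1}` as a set of projective points. -/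
def Sigset {n : ℕ} (d : ℕ) (P : MvPolynomial (XS n) ℂ) (s : ℂ) : Set (PrjInf n) :=
  {p | SCond d P p.rep s}

/-- `f_s = P(·,s)` as a polynomial in `x`. -/
def fS {n : ℕ} (P : MvPolynomial (XS n) ℂ) (s : ℂ) : MvPolynomial (Fin n) ℂ :=
  aeval (Sum.elim X (fun _ => C s)) P

/-- `x` is an affine critical point of `f_s`, i.e. `∂P/∂x_i(x,s) = 0` for all `i`. -/
def CritPt {n : ℕ} (P : MvPolynomial (XS n) ℂ) (x : Fin n → ℂ) (s : ℂ) : Prop :=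
  ∀ i : Fin n, eval (evA x s) (pderiv (Sum.inl i) P) = 0

/-- the set of singular points of the compactified fiber `Y_{s,t} ⊂ ℙⁿ`. -/
def SingYst {n : ℕ} (d : ℕ) (P : MvPolynomial (XS n) ℂ) (s t : ℂ) : Set (Prj n) :=
  {p | OnY d P p.rep s t ∧ FiberDerivsVanish d P p.rep s t}

/-- `f₀ = P(·,0)` is a FISI polynomial: it has finitely many critical points, the
projective closure of each of its fibers has only isolated (= finitely many) singular
points, and the singular locus `W₀` of the slice at infinity is finite. -/
def FISIat {n : ℕ} (d : ℕ) (P : MvPolynomial (XS n) ℂ) (s : ℂ) : Prop :=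
  {x : Fin n → ℂ | CritPt P x s}.Finite ∧ (∀ t : ℂ, (SingYst d P s t).Finite) ∧
    (Wset d P s).Finite

/-- `P` is a FISI deformation: `f₀` is FISI, `W₀` is finite and every `f_s`, for `s` in a
neighbourhood of `0`, has only finitely many critical points. -/
def FISIdef {n : ℕ} (d : ℕ) (P : MvPolynomial (XS n) ℂ) : Prop :=
  FISIat d P 0 ∧ ∃ ε > (0:ℝ), ∀ s : ℂ, ‖s‖ < ε → {x : Fin n → ℂ | CritPt P x s}.Finite

/-- The "Milnor-type" local dimension: given polynomial germs `gs` at a point `a ∈ ℂᵐ`,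
this is the `ℂ`-dimension of the formal power series ring at `a` (identified with
`ℂ[[X]]` via `X ↦ X - a`) modulo the ideal generated by the germs. -/
def germDim {m : ℕ} (gs : Set (MvPolynomial (Fin m) ℂ)) (a : Fin m → ℂ) : ℕ :=
  Module.finrank ℂ (MvPowerSeries (Fin m) ℂ ⧸ Ideal.span
    ((fun g => (MvPolynomial.coeToMvPowerSeries.ringHom
        (aeval (fun i => X i + C (a i)) g) : MvPowerSeries (Fin m) ℂ)) '' gs))

/-- the (choice of an) index `j` with `p.rep j ≠ 0`, used to normalize `v_j = 1`
and to work in the chart `x_j = 1` of `ℙⁿ`. -/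
def jp {n : ℕ} (p : PrjInf n) : Fin n :=
  (Function.ne_iff.mp p.rep_nonzero).choose

lemma jp_spec {n : ℕ} (p : PrjInf n) : p.rep (jp p) ≠ 0 :=
  (Function.ne_iff.mp p.rep_nonzero).choose_spec

/-- the chart coordinates of the point at infinity `p = [v:0]`, where `v` is normalized
by `v_{j(p)} = 1`, in the chart `x_{j(p)} = 1` of `ℙⁿ`; the slot `j(p)` of the chart
carries the coordinate `x₀`, which is `0` at `p`. -/
def chartPt {n : ℕ} (p : PrjInf n) : Fin n → ℂ :=
  fun i => if i = jp p then 0 else p.rep i / p.rep (jp p)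

/-- the chart equation of the compactified fiber `Y_{s,t}` in the chart `x_j = 1` of
`ℙⁿ`: substitute `x_j = 1` in the homogeneous defining equation `FY`, the chart slot `j`
carrying the coordinate `x₀`. -/
def chartEq {n : ℕ} (d : ℕ) (P : MvPolynomial (XS n) ℂ) (j : Fin n) (s t : ℂ) :
    MvPolynomial (Fin n) ℂ :=
  aeval (Sum.elim (fun i => if i = j then 1 else X i) ![X j, C s, C t]) (FY d P)

/-- the chart equation of the hypersurface `{P_d(·,s) = 0} ⊂ ℙ^{n-1}` in the chart
`x_j = 1` of `ℙ^{n-1}` (the chart variable `X j` is unused). -/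
def chartEqInf {n : ℕ} (d : ℕ) (P : MvPolynomial (XS n) ℂ) (j : Fin n) (s : ℂ) :
    MvPolynomial (Fin n) ℂ :=
  aeval (fun i => if i = j then 1 else X i) (aeval (Sum.elim X (fun _ => C s)) (xpart P d))

/-- `μ_p(t,s)`, the Milnor number of the isolated singularity of the compactified fiber
`Y_{s,t}` at the point `p` of the hyperplane at infinity. -/
def muP {n : ℕ} (d : ℕ) (P : MvPolynomial (XS n) ℂ) (p : PrjInf n) (s t : ℂ) : ℕ :=
  germDim (Set.range fun i => pderiv i (chartEq d P (jp p) s t)) (chartPt p)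

/-- `μ_{p,gen}(s) = min_{t ∈ ℂ} μ_p(t,s)`. -/
def muGen {n : ℕ} (d : ℕ) (P : MvPolynomial (XS n) ℂ) (p : PrjInf n) (s : ℂ) : ℕ :=
  sInf (Set.range (muP d P p s))

/-- the local Milnor–Lê number `λ_{p,t}(s) = μ_p(t,s) − μ_{p,gen}(s)`. -/
def lamP {n : ℕ} (d : ℕ) (P : MvPolynomial (XS n) ℂ) (p : PrjInf n) (t s : ℂ) : ℕ :=
  muP d P p s t - muGen d P p s

/-- `μ_p^∞(s)`, the Milnor number at `p` of the hypersurface `{P_d(·,s)=0} ⊂ ℙ^{n-1}`: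
computed in the chart `x_{j(p)} = 1`, adding the generator `X (j p)` to kill the unused
chart variable. -/
def muInf {n : ℕ} (d : ℕ) (P : MvPolynomial (XS n) ℂ) (p : PrjInf n) (s : ℂ) : ℕ :=
  germDim ({g | ∃ i, i ≠ jp p ∧ g = pderiv i (chartEqInf d P (jp p) s)} ∪ {X (jp p)})
    (chartPt p)

/-- the total Milnor number `μ(s)` of the affine singularities of `f_s`. -/
def muTot {n : ℕ} (P : MvPolynomial (XS n) ℂ) (s : ℂ) : ℕ :=
  Module.finrank ℂ (MvPolynomial (Fin n) ℂ ⧸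
    Ideal.span (Set.range fun i => pderiv i (fS P s)))

/-- the local Milnor number `μ_a(f_s)` of `f_s` at the point `a ∈ ℂⁿ`. -/
def muAt {n : ℕ} (P : MvPolynomial (XS n) ℂ) (s : ℂ) (a : Fin n → ℂ) : ℕ :=
  germDim (Set.range fun i => pderiv i (fS P s)) a

/-- the total Milnor–Lê number at infinity `λ(s) = Σ_{p ∈ Σ_s} Σ_{t ∈ ℂ} λ_{p,t}(s)`
(all but finitely many summands vanish). -/
def lamTot {n : ℕ} (d : ℕ) (P : MvPolynomial (XS n) ℂ) (s : ℂ) : ℕ :=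
  ∑ᶠ p ∈ Sigset d P s, ∑ᶠ t : ℂ, lamP d P p t s

/-- the chart coordinates of the affine point `[x : 1] ∈ ℙⁿ` in the chart `x_j = 1`,
the slot `j` carrying the coordinate `x₀` (i.e. `1/x_j`). -/
def chartCo {n : ℕ} (j : Fin n) (x : Fin n → ℂ) : Fin n → ℂ :=
  fun i => if i = j then 1 / x j else x i / x j

/-- the affine discriminant `Δ_P ⊂ ℂ_s × ℂ_t`: the closure of the set of pairs
`(s, f_s(x))` over the affine critical points `x` of `f_s`. -/
def DeltaP {n : ℕ} (P : MvPolynomial (XS n) ℂ) : Set (ℂ × ℂ) :=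
  closure {w : ℂ × ℂ | ∃ x : Fin n → ℂ, CritPt P x w.1 ∧ w.2 = eval (evA x w.1) P}

section ArcDVR
variable {V : Type*} [CommRing V] [IsDomain V] [IsDiscreteValuationRing V] [Algebra ℂ V]

/-- A discrete valuation ring over `ℂ` with residue field `ℂ` embeds in `ℂ⟦X⟧`. -/
theorem dvr_arc (hres : ∀ v : V, ∃ c : ℂ, v - algebraMap ℂ V c ∈ IsLocalRing.maximalIdeal V) :
    ∃ ψ : V →ₐ[ℂ] PowerSeries ℂ, Function.Injective ψ ∧
      ∀ v ∈ IsLocalRing.maximalIdeal V, PowerSeries.constantCoeff (ψ v) = 0 := by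
  classical
  obtain ⟨ϖ, hϖ⟩ := IsDiscreteValuationRing.exists_irreducible V
  have hm := hϖ.maximalIdeal_eq
  have hϖ0 : ϖ ≠ 0 := hϖ.ne_zero
  have h1 : ∀ v : V, ∃ c : ℂ, ∃ t : V, v = algebraMap ℂ V c + ϖ * t := by
    intro v
    obtain ⟨c, hc⟩ := hres v
    rw [hm, Ideal.mem_span_singleton] at hc
    obtain ⟨t, ht⟩ := hc
    exact ⟨c, t, by rw [← ht]; ring⟩
  choose c tl hct using h1
  have huniq : ∀ (a b : ℂ) (x y : V), algebraMap ℂ V a + ϖ * x = algebraMap ℂ V b + ϖ * y →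
      a = b ∧ x = y := by
    intro a b x y h
    have hab : a = b := by
      by_contra hne
      have : algebraMap ℂ V (a - b) ∈ IsLocalRing.maximalIdeal V := by
        rw [hm, Ideal.mem_span_singleton]
        exact ⟨y - x, by rw [map_sub]; linear_combination h⟩
      exact (IsLocalRing.mem_maximalIdeal _).1 this
        ((IsUnit.mk0 _ (sub_ne_zero.2 hne)).map (algebraMap ℂ V))
    refine ⟨hab, ?_⟩
    subst hab
    exact mul_left_cancel₀ hϖ0 (add_left_cancel h)
  let φ : V → PowerSeries ℂ := fun v => PowerSeries.mk fun k => c (tl^[k] v)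
  have hφ : ∀ v, φ v = PowerSeries.C (c v) + PowerSeries.X * φ (tl v) := by
    intro v
    ext k
    cases k with
    | zero => simp [φ]
    | succ k => simp [φ, PowerSeries.coeff_succ_X_mul, PowerSeries.coeff_C]
  have hcadd : ∀ u v, c (u + v) = c u + c v ∧ tl (u + v) = tl u + tl v := by
    intro u v
    apply huniq
    rw [← hct, map_add]
    conv_lhs => rw [hct u, hct v]
    ring
  have hcmul : ∀ u v, c (u * v) = c u * c v ∧
      tl (u * v) = algebraMap ℂ V (c u) * tl v + tl u * v := by
    intro u v
    apply huniq
    rw [← hct, map_mul]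
    conv_lhs => rw [hct u, hct v]
    conv_rhs => enter [2, 2, 2, 2]; rw [hct v]
    ring
  have hcalg : ∀ a : ℂ, c (algebraMap ℂ V a) = a ∧ tl (algebraMap ℂ V a) = 0 := by
    intro a
    apply huniq
    rw [← hct]; ring
  have hadd : ∀ u v, φ (u + v) = φ u + φ v := by
    intro u v
    have : ∀ k u v, c (tl^[k] (u + v)) = c (tl^[k] u) + c (tl^[k] v) := by
      intro k
      induction k with
      | zero => intro u v; exact (hcadd u v).1
      | succ k ih => intro u v; simp only [Function.iterate_succ_apply, (hcadd u v).2, ih]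
    ext k
    simp [φ, this]
  have hz : ∀ k, tl^[k] (0 : V) = 0 := by
    have h0 : tl (0 : V) = 0 := by simpa using (hcalg 0).2
    intro k
    induction k with
    | zero => rfl
    | succ k ih => rw [Function.iterate_succ_apply, h0, ih]
  have halg : ∀ a : ℂ, φ (algebraMap ℂ V a) = PowerSeries.C a := by
    intro a
    have h0 : φ 0 = 0 := by simpa using hadd 0 0
    rw [hφ, (hcalg a).1, (hcalg a).2, h0]; simp
  have hsm : ∀ (a : ℂ) v, φ (algebraMap ℂ V a * v) = PowerSeries.C a * φ v := by
    intro a v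
    have : ∀ k v, c (tl^[k] (algebraMap ℂ V a * v)) = a * c (tl^[k] v) := by
      intro k
      induction k with
      | zero => intro v; simp [(hcmul _ v).1, (hcalg a).1]
      | succ k ih =>
        intro v
        simp only [Function.iterate_succ_apply, (hcmul _ v).2, (hcalg a).1, (hcalg a).2,
          zero_mul, add_zero, ih]
    ext k
    simp [φ, this]
  have hmul : ∀ u v, φ (u * v) = φ u * φ v := by
    have key : ∀ k u v, (PowerSeries.X : PowerSeries ℂ)^k ∣ φ (u * v) - φ u * φ v := by
      intro k
      induction k with
      | zero => intro u v; simp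
      | succ k ih =>
        intro u v
        have e : φ (u * v) - φ u * φ v = PowerSeries.X * (φ (tl u * v) - φ (tl u) * φ v) := by
          rw [hφ (u * v), (hcmul u v).2, hadd, hsm, (hcmul u v).1, hφ u, map_mul]
          conv_lhs => enter [2, 2]; rw [hφ v]
          conv_rhs => rw [hφ v]
          ring
        rw [e, pow_succ']
        exact mul_dvd_mul_left _ (ih _ _)
    intro u v
    rw [← sub_eq_zero]
    ext k
    exact (PowerSeries.X_pow_dvd_iff.1 (key (k+1) u v)) k (Nat.lt_succ_self k)
  let ψ : V →ₐ[ℂ] PowerSeries ℂ :=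
    { toFun := φ
      map_one' := by simpa using halg 1
      map_mul' := hmul
      map_zero' := by simpa using halg 0
      map_add' := hadd
      commutes' := fun a => by rw [halg]; rfl }
  have hψ : ∀ v, ψ v = φ v := fun _ => rfl
  have hc0 : ∀ v ∈ IsLocalRing.maximalIdeal V, c v = 0 := by
    intro v hv
    rw [hm, Ideal.mem_span_singleton] at hv
    obtain ⟨t, ht⟩ := hv
    exact (huniq (c v) 0 (tl v) t (by rw [← hct, ht]; simp)).1
  have hcst : ∀ v, PowerSeries.constantCoeff (ψ v) = c v := by
    intro v; rw [hψ, hφ]; simp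
  refine ⟨ψ, ?_, fun v hv => by rw [hcst]; exact hc0 v hv⟩
  rw [injective_iff_map_eq_zero]
  intro v hv
  by_contra hne
  obtain ⟨k, u, hu⟩ := IsDiscreteValuationRing.eq_unit_mul_pow_irreducible hne hϖ
  have hX : ψ ϖ = PowerSeries.X := by
    have := huniq (c ϖ) 0 (tl ϖ) 1 (by rw [← hct]; simp)
    rw [hψ, hφ, this.1, this.2]
    have := halg 1
    simp only [map_one] at this
    rw [this]; simp
  rw [hu, map_mul, map_pow, hX] at hv
  have hu' : IsUnit (ψ (u : V)) := u.isUnit.map ψ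
  exact (pow_ne_zero k (PowerSeries.X_ne_zero)) ((hu'.mul_right_eq_zero).1 hv)

end ArcDVR

section ArcVal
open Polynomial in
theorem val_dvr {K : Type*} [Field K] [Algebra ℂ K] [Algebra ℂ[X] K] [IsScalarTower ℂ ℂ[X] K]
    [Algebra (FractionRing ℂ[X]) K] [IsScalarTower ℂ[X] (FractionRing ℂ[X]) K]
    [FiniteDimensional (FractionRing ℂ[X]) K]
    (V : ValuationSubring K) (hC : ∀ c : ℂ, algebraMap ℂ K c ∈ V)
    (hw : algebraMap ℂ[X] K Polynomial.X ∈ V.nonunits) :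
    ∃ ψ : V →+* PowerSeries ℂ, Function.Injective ψ ∧
      (∀ v ∈ IsLocalRing.maximalIdeal V, PowerSeries.constantCoeff (ψ v) = 0) ∧
      ∀ c : ℂ, ψ ⟨algebraMap ℂ K c, hC c⟩ = PowerSeries.C c := by
  classical
  set w : K := algebraMap ℂ[X] K Polynomial.X with hwdef
  have hwV : w ∈ V := V.nonunits_le hw
  have hpoly : ∀ q : ℂ[X], algebraMap ℂ[X] K q ∈ V := by
    intro q
    induction q using Polynomial.induction_on' with
    | add a b ha hb => rw [map_add]; exact V.add_mem _ _ ha hb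
    | monomial k a =>
      rw [← Polynomial.C_mul_X_pow_eq_monomial, map_mul, map_pow]
      refine V.mul_mem _ _ ?_ (pow_mem hwV k)
      have : algebraMap ℂ[X] K (Polynomial.C a) = algebraMap ℂ K a := by
        rw [IsScalarTower.algebraMap_apply ℂ ℂ[X] K]; rfl
      rw [this]; exact hC a
  let E := integralClosure ℂ[X] K
  have hinj : Function.Injective (algebraMap ℂ[X] K) := by
    rw [IsScalarTower.algebraMap_eq ℂ[X] (FractionRing ℂ[X]) K]
    exact (algebraMap (FractionRing ℂ[X]) K).injective.comp
      (IsFractionRing.injective ℂ[X] (FractionRing ℂ[X]))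
  haveI : IsDedekindDomain E := integralClosure.isDedekindDomain ℂ[X] (FractionRing ℂ[X]) K
  haveI : IsFractionRing E K :=
    integralClosure.isFractionRing_of_finite_extension (FractionRing ℂ[X]) K
  -- E inside V
  have hEV : ∀ e : E, (e : K) ∈ V := by
    intro e
    have h1 : IsIntegral ℂ[X] (e : K) := e.2
    let f : ℂ[X] →+* V := (algebraMap ℂ[X] K).codRestrict V.toSubring hpoly
    have h2 : IsIntegral V (e : K) := by
      obtain ⟨q, hq, hq0⟩ := h1
      refine ⟨q.map f, hq.map f, ?_⟩
      rw [Polynomial.eval₂_map]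
      exact hq0
    obtain ⟨y, hy⟩ := IsIntegrallyClosed.isIntegral_iff.1 h2
    rw [← hy]; exact y.2
  let i : E →+* V := (algebraMap E K).codRestrict V.toSubring hEV
  have hi : ∀ e, ((i e : V) : K) = (e : K) := fun _ => rfl
  letI algEV : Algebra E V := i.toAlgebra
  have halg : ∀ e : E, algebraMap E V e = i e := fun _ => rfl
  let q : Ideal E := (IsLocalRing.maximalIdeal V).comap i
  haveI hqp : q.IsPrime := Ideal.comap_isPrime _ _
  have hX : (algebraMap ℂ[X] E Polynomial.X) ∈ q := by
    change i _ ∈ IsLocalRing.maximalIdeal V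
    rw [← ValuationSubring.coe_mem_nonunits_iff]
    exact hw
  have hq0 : q ≠ ⊥ := by
    intro h
    rw [h, Ideal.mem_bot] at hX
    have : w = 0 := congrArg (Subtype.val) hX
    rw [hwdef, ← map_zero (algebraMap ℂ[X] K)] at this
    exact Polynomial.X_ne_zero (hinj this)
  have hunit : ∀ e : E, e ∉ q → IsUnit (i e) := by
    intro e he
    by_contra h
    exact he ((IsLocalRing.mem_maximalIdeal _).2 h)
  have hmemq : ∀ e : E, e ∈ q → i e ∈ IsLocalRing.maximalIdeal V := fun e he => he
  let L := Localization.AtPrime q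
  haveI : IsDiscreteValuationRing L :=
    IsLocalization.AtPrime.isDiscreteValuationRing_of_dedekind_domain E hq0 L
  -- fraction description of V
  have hsurj : ∀ y : V, ∃ a b : E, b ∉ q ∧ (y : K) * (b : K) = a := by
    intro y
    by_cases hy0 : y = 0
    · exact ⟨0, 1, fun h => hqp.ne_top ((Ideal.eq_top_iff_one _).2 h), by simp [hy0]⟩
    obtain ⟨a, b, hb, hab⟩ := IsFractionRing.div_surjective (A := E) (y : K)
    have hb0 : b ≠ 0 := nonZeroDivisors.ne_zero hb
    have hbK : algebraMap E K b ≠ 0 := by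
      intro h; exact hb0 (FaithfulSMul.algebraMap_injective E K (by rw [h, map_zero]))
    have hyab : (y : K) * b = a := by
      rw [← hab]; exact div_mul_cancel₀ _ hbK
    -- compare a and b in L
    have hin : ∀ u v : E, algebraMap E L u = algebraMap E L v → u = v := fun u v h =>
      IsLocalization.injective L q.primeCompl_le_nonZeroDivisors h
    have hVR : ValuationRing L := inferInstance
    have hPV : PreValuationRing L := hVR.toPreValuationRing
    rcases ValuationRing.dvd_total (algebraMap E L b) (algebraMap E L a) with ⟨c, hc⟩ | ⟨c, hc⟩
    · obtain ⟨⟨u, v⟩, huv⟩ := IsLocalization.surj q.primeCompl c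
      refine ⟨u, v, v.2, ?_⟩
      have : a * v = b * u := by
        apply hin
        rw [map_mul, map_mul, hc, mul_assoc, huv]
      have hK := congrArg (algebraMap E K) this
      simp only [map_mul] at hK
      apply mul_left_cancel₀ hbK
      change (b : K) * (y * v) = b * u
      change (a : K) * v = b * u at hK
      rw [← hK, ← hyab]; ring
    · obtain ⟨⟨u, v⟩, huv⟩ := IsLocalization.surj q.primeCompl c
      have : b * v = a * u := by
        apply hin
        rw [map_mul, map_mul, hc, mul_assoc, huv]
      have hK := congrArg (algebraMap E K) this
      simp only [map_mul] at hK
      have hK2 : (b : K) * v = a * u := hK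
      have h3 : (y : K) * u = v := by
        apply mul_left_cancel₀ hbK
        change (b : K) * (y * u) = b * v
        rw [hK2, ← hyab]; ring
      refine ⟨v, u, ?_, h3⟩
      intro hu
      have h4 : y * i u = i v := Subtype.ext h3
      have h5 : i v ∈ IsLocalRing.maximalIdeal V := by
        rw [← h4]; exact Ideal.mul_mem_left _ _ (hmemq u hu)
      exact (IsLocalRing.mem_maximalIdeal _).1 h5 (hunit v v.2)
  have hloc : IsLocalization.AtPrime V q := by
    refine ⟨⟨?_, ?_, ?_⟩⟩
    · rintro ⟨y, hy⟩; exact hunit y hy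
    · intro z
      obtain ⟨a, b, hb, hab⟩ := hsurj z
      exact ⟨⟨a, ⟨b, hb⟩⟩, Subtype.ext hab⟩
    · intro x y hxy
      refine ⟨1, ?_⟩
      have : (x : K) = y := congrArg (Subtype.val : V → K) hxy
      simp [Subtype.ext this]
  haveI : IsDiscreteValuationRing V :=
    IsLocalization.AtPrime.isDiscreteValuationRing_of_dedekind_domain E hq0 V
  letI algCV : Algebra ℂ V := ((algebraMap ℂ K).codRestrict V.toSubring hC).toAlgebra
  have hCV : ∀ c : ℂ, algebraMap ℂ V c = ⟨algebraMap ℂ K c, hC c⟩ := fun _ => rfl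
  -- residues
  have hE : ∀ e : E, ∃ c : ℂ, i e - algebraMap ℂ V c ∈ IsLocalRing.maximalIdeal V := by
    intro e
    obtain ⟨g, hg, hg0⟩ := e.2
    let f : ℂ[X] →+* V := (algebraMap ℂ[X] K).codRestrict V.toSubring hpoly
    let π := IsLocalRing.residue V
    have hπX : π (f Polynomial.X) = 0 := by
      rw [IsLocalRing.residue_eq_zero_iff]
      exact hX
    have hfac : π.comp f = (π.comp (algebraMap ℂ V)).comp Polynomial.constantCoeff := by
      apply Polynomial.ringHom_ext
      · intro a
        simp only [RingHom.comp_apply]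
        congr 1
        apply Subtype.ext
        change algebraMap ℂ[X] K (Polynomial.C a) = algebraMap ℂ K _
        rw [IsScalarTower.algebraMap_apply ℂ ℂ[X] K]
        simp
      · simp [hπX]
    let g0 : ℂ[X] := g.map Polynomial.constantCoeff
    have hg0m : g0.Monic := hg.map _
    have hroot : g0.eval₂ (π.comp (algebraMap ℂ V)) (π (i e)) = 0 := by
      rw [Polynomial.eval₂_map, ← hfac, ← Polynomial.hom_eval₂]
      have : Polynomial.eval₂ f (i e) g = 0 := by
        apply Subtype.ext
        change (V.subtype) (Polynomial.eval₂ f (i e) g) = 0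
        rw [Polynomial.hom_eval₂]
        exact hg0
      rw [this, map_zero]
    have hsp := IsAlgClosed.splits g0
    rw [hsp.eq_prod_roots_of_monic hg0m, Polynomial.eval₂_multiset_prod, Multiset.prod_eq_zero_iff] at hroot
    simp only [Multiset.map_map, Multiset.mem_map] at hroot
    obtain ⟨c, -, hc⟩ := hroot
    refine ⟨c, ?_⟩
    rw [← IsLocalRing.residue_eq_zero_iff, map_sub]
    simpa using hc
  have hres : ∀ v : V, ∃ c : ℂ, v - algebraMap ℂ V c ∈ IsLocalRing.maximalIdeal V := by
    intro v
    obtain ⟨a, b, hb, hab⟩ := hsurj v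
    obtain ⟨c1, h1⟩ := hE a
    obtain ⟨c2, h2⟩ := hE b
    have hab' : v * i b = i a := Subtype.ext hab
    have hc2 : c2 ≠ 0 := by
      rintro rfl
      rw [map_zero, sub_zero] at h2
      exact (IsLocalRing.mem_maximalIdeal _).1 h2 (hunit b hb)
    refine ⟨c1 / c2, ?_⟩
    have h3 : algebraMap ℂ V c2 * (v - algebraMap ℂ V (c1 / c2)) ∈ IsLocalRing.maximalIdeal V := by
      have e1 : algebraMap ℂ V c2 * algebraMap ℂ V (c1 / c2) = algebraMap ℂ V c1 := by
        rw [← map_mul, mul_div_cancel₀ _ hc2]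
      have : algebraMap ℂ V c2 * (v - algebraMap ℂ V (c1 / c2)) =
          (i a - algebraMap ℂ V c1) - v * (i b - algebraMap ℂ V c2) := by
        rw [mul_sub, e1, ← hab']; ring
      rw [this]
      exact Ideal.sub_mem _ h1 (Ideal.mul_mem_left _ _ h2)
    exact ((Ideal.IsPrime.mem_or_mem inferInstance h3).resolve_left fun h =>
      (IsLocalRing.mem_maximalIdeal _).1 h ((IsUnit.mk0 _ hc2).map (algebraMap ℂ V)))
  obtain ⟨ψ, h1, h2⟩ := dvr_arc hres
  exact ⟨ψ.toRingHom, h1, h2, fun c => ψ.commutes c⟩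

end ArcVal

section ArcExists

/-- a prime containing an ideal of finite codimension in a local `ℂ`-algebra is maximal -/
theorem prime_eq_max {O : Type*} [CommRing O] [IsLocalRing O] [Algebra ℂ O] (I Q : Ideal O)
    [Q.IsPrime] (hI : I ≤ Q) (hfin : Module.Finite ℂ (O ⧸ I)) :
    Q = IsLocalRing.maximalIdeal O := by
  have h1 : Module.Finite ℂ (O ⧸ Q) :=
    Module.Finite.of_surjective (Ideal.Quotient.factorₐ ℂ hI).toLinearMap
      (Ideal.Quotient.factor_surjective hI)
  have h2 : IsField (O ⧸ Q) := by
    have : Algebra.IsIntegral ℂ (O ⧸ Q) := inferInstance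
    exact isField_of_isIntegral_of_isField' (R := ℂ) (Field.toIsField ℂ)
  exact IsLocalRing.eq_maximalIdeal (Ideal.Quotient.maximal_of_isField _ h2)

/-- In a local Noetherian domain `D` with `D/w` of finite dimension all nonzero primes are
maximal. -/
theorem prime_bot_or_max {D : Type*} [CommRing D] [IsDomain D] [IsLocalRing D] [IsNoetherianRing D]
    [Algebra ℂ D] (w : D) (hfin : Module.Finite ℂ (D ⧸ Ideal.span {w}))
    (hw : w ∈ IsLocalRing.maximalIdeal D)
    (Q : Ideal D) [hQ : Q.IsPrime] (hQ0 : Q ≠ ⊥) : Q = IsLocalRing.maximalIdeal D := by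
  have hmin : IsLocalRing.maximalIdeal D ∈ (Ideal.span {w}).minimalPrimes := by
    refine ⟨⟨inferInstance, (Ideal.span_singleton_le_iff_mem _).2 hw⟩, ?_⟩
    rintro q ⟨hq, hwq⟩ -
    exact (prime_eq_max _ q hwq hfin).ge
  have hht := Ideal.height_le_one_of_isPrincipal_of_mem_minimalPrimes (Ideal.span {w}) _ hmin
  by_contra hne
  have hlt : Q < IsLocalRing.maximalIdeal D :=
    lt_of_le_of_ne (IsLocalRing.le_maximalIdeal hQ.ne_top) hne
  have hfh : Q.FiniteHeight := inferInstance
  have h0 : (0 : ℕ∞) < Q.height := by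
    rw [pos_iff_ne_zero]
    intro h
    exact hQ0 (Ideal.height_eq_zero_iff_eq_bot.1 h)
  have h1 := Ideal.height_strict_mono_of_isPrime hlt
  have h2 : (1 : ℕ∞) ≤ Q.height := Order.one_le_iff_pos.2 h0
  exact absurd (h2.trans_lt h1) (not_lt.2 hht)

open Polynomial in
theorem arc_exists {S D K : Type} [CommRing S] [IsDomain S] [Algebra ℂ S] [Algebra.FiniteType ℂ S]
    (p : Ideal S) [p.IsPrime] [CommRing D] [IsDomain D] [IsLocalRing D] [Algebra S D]
    [IsLocalization.AtPrime D p] [Algebra ℂ D] [IsScalarTower ℂ S D] (w : S) (hwp : w ∈ p)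
    (hw0 : w ≠ 0) (hfin : Module.Finite ℂ (D ⧸ Ideal.span {algebraMap S D w}))
    [Field K] [Algebra D K] [IsFractionRing D K] (r : K) (hr : ¬ IsIntegral D r) :
    ∃ ψ : D →ₐ[ℂ] PowerSeries ℂ, Function.Injective ψ ∧
      (∀ v ∈ IsLocalRing.maximalIdeal D, PowerSeries.constantCoeff (ψ v) = 0) ∧
      ∀ x y : D, y ≠ 0 → r * algebraMap D K y = algebraMap D K x →
        (ψ x).order < (ψ y).order := by
  classical
  have : IsNoetherianRing S := Algebra.FiniteType.isNoetherianRing ℂ S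
  have : IsNoetherianRing D := IsLocalization.isNoetherianRing p.primeCompl D inferInstance
  have hSD : Function.Injective (algebraMap S D) :=
    IsLocalization.injective D p.primeCompl_le_nonZeroDivisors
  set wD : D := algebraMap S D w with hwD
  have hwD0 : wD ≠ 0 := fun h => hw0 (hSD (by rw [← hwD, h, map_zero]))
  have hwm : wD ∈ IsLocalRing.maximalIdeal D :=
    (IsLocalization.AtPrime.to_map_mem_maximal_iff D p w).2 hwp
  let _ : Algebra ℂ[X] S := (Polynomial.aeval w).toAlgebra
  have : IsScalarTower ℂ ℂ[X] S := IsScalarTower.of_algebraMap_eq fun x => by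
    change _ = (Polynomial.aeval w) _
    simp
  let _ : Algebra ℂ[X] D := ((algebraMap S D).comp (algebraMap ℂ[X] S)).toAlgebra
  have : IsScalarTower ℂ[X] S D := IsScalarTower.of_algebraMap_eq fun x => rfl
  let _ : Algebra ℂ[X] K := ((algebraMap D K).comp (algebraMap ℂ[X] D)).toAlgebra
  have : IsScalarTower ℂ[X] D K := IsScalarTower.of_algebraMap_eq fun x => rfl
  let _ : Algebra ℂ K := ((algebraMap D K).comp (algebraMap ℂ D)).toAlgebra
  have : IsScalarTower ℂ D K := IsScalarTower.of_algebraMap_eq fun x => rfl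
  have : IsScalarTower ℂ ℂ[X] D := IsScalarTower.of_algebraMap_eq fun x => by
    rw [IsScalarTower.algebraMap_apply ℂ[X] S D, ← IsScalarTower.algebraMap_apply ℂ ℂ[X] S,
      ← IsScalarTower.algebraMap_apply ℂ S D]
  have : IsScalarTower ℂ ℂ[X] K := IsScalarTower.of_algebraMap_eq fun x => by
    rw [IsScalarTower.algebraMap_apply ℂ[X] D K, ← IsScalarTower.algebraMap_apply ℂ ℂ[X] D,
      ← IsScalarTower.algebraMap_apply ℂ D K]
  have hXS : algebraMap ℂ[X] S Polynomial.X = w := by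
    change Polynomial.aeval w Polynomial.X = w
    simp
  have hFT : Algebra.FiniteType ℂ[X] S := Algebra.FiniteType.of_restrictScalars_finiteType ℂ ℂ[X] S
  -- injectivity
  have hinjS : Function.Injective (algebraMap ℂ[X] S) := by
    rw [injective_iff_map_eq_zero]
    intro q hq
    by_contra hne
    have hq' : Polynomial.aeval w q = 0 := hq
    rw [Polynomial.aeval_def, (IsAlgClosed.splits q).eq_prod_roots, Polynomial.eval₂_mul,
      Polynomial.eval₂_C, mul_eq_zero] at hq'
    rcases hq' with hq' | hq'
    · exact Polynomial.leadingCoeff_ne_zero.2 hne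
        ((algebraMap ℂ S).injective (by rw [hq', map_zero]))
    · rw [Polynomial.eval₂_multiset_prod, Multiset.prod_eq_zero_iff] at hq'
      simp only [Multiset.map_map, Multiset.mem_map] at hq'
      obtain ⟨c, -, hc⟩ := hq'
      have hc' : w = algebraMap ℂ S c := by
        have : w - algebraMap ℂ S c = 0 := by simpa using hc
        exact sub_eq_zero.1 this
      by_cases hc0 : c = 0
      · rw [hc0, map_zero] at hc'; exact hw0 hc'
      · exact Ideal.IsPrime.ne_top inferInstance (p.eq_top_of_isUnit_mem hwp
          (hc' ▸ (IsUnit.mk0 c hc0).map (algebraMap ℂ S)))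
  have hinjK : Function.Injective (algebraMap ℂ[X] K) :=
    ((IsFractionRing.injective D K).comp hSD).comp hinjS
  have : FaithfulSMul ℂ[X] K := (faithfulSMul_iff_algebraMap_injective _ _).2 hinjK
  let _ : Algebra (FractionRing ℂ[X]) K := FractionRing.liftAlgebra ℂ[X] K
  have : IsScalarTower ℂ[X] (FractionRing ℂ[X]) K := inferInstance
  -- finiteness
  let e : Localization.AtPrime p ≃ₐ[S] D := IsLocalization.algEquiv p.primeCompl _ _
  have hwq : Algebra.WeaklyQuasiFiniteAt ℂ[X] p := by
    rw [Algebra.weaklyQuasiFiniteAt_iff]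
    set I := (p.under ℂ[X]).map (algebraMap ℂ[X] (Localization.AtPrime p))
    let g : D →+* (Localization.AtPrime p ⧸ I) := (Ideal.Quotient.mk I).comp e.symm.toRingHom
    have hg : ∀ a ∈ Ideal.span {wD}, g a = 0 := by
      intro a ha
      obtain ⟨b, rfl⟩ := Ideal.mem_span_singleton.1 ha
      rw [map_mul]
      have : g wD = 0 := by
        change Ideal.Quotient.mk I (e.symm (algebraMap S D w)) = 0
        rw [e.symm.commutes, Ideal.Quotient.eq_zero_iff_mem]
        have : algebraMap S (Localization.AtPrime p) w =
          algebraMap ℂ[X] (Localization.AtPrime p) Polynomial.X := by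
          rw [IsScalarTower.algebraMap_apply ℂ[X] S (Localization.AtPrime p), hXS]
        rw [this]
        refine Ideal.mem_map_of_mem _ ?_
        change algebraMap ℂ[X] S Polynomial.X ∈ p
        rw [hXS]; exact hwp
      rw [this, zero_mul]
    let g' : (D ⧸ Ideal.span {wD}) →+* (Localization.AtPrime p ⧸ I) := Ideal.Quotient.lift _ g hg
    have hgC : ∀ c : ℂ, g' (algebraMap ℂ _ c) = algebraMap ℂ _ c := by
      intro c
      have h1 : algebraMap ℂ (D ⧸ Ideal.span {wD}) c = Ideal.Quotient.mk _ (algebraMap ℂ D c) := rfl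
      have h2 : algebraMap ℂ (Localization.AtPrime p ⧸ I) c =
        Ideal.Quotient.mk I (algebraMap ℂ (Localization.AtPrime p) c) := rfl
      rw [h1, h2, Ideal.Quotient.lift_mk]
      change Ideal.Quotient.mk I (e.symm (algebraMap ℂ D c)) = _
      rw [IsScalarTower.algebraMap_apply ℂ S D, e.symm.commutes,
        ← IsScalarTower.algebraMap_apply ℂ S]
    let g'' : (D ⧸ Ideal.span {wD}) →ₐ[ℂ] (Localization.AtPrime p ⧸ I) :=
      { g' with commutes' := hgC }
    have hsurj : Function.Surjective g'' := by
      intro y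
      obtain ⟨y, rfl⟩ := Ideal.Quotient.mk_surjective y
      refine ⟨Ideal.Quotient.mk _ (e y), ?_⟩
      change Ideal.Quotient.mk I (e.symm (e y)) = _
      rw [e.symm_apply_apply]
    have h1 : Module.Finite ℂ (Localization.AtPrime p ⧸ I) :=
      Module.Finite.of_surjective g''.toLinearMap hsurj
    have : IsScalarTower ℂ ℂ[X] (Localization.AtPrime p ⧸ I) :=
      IsScalarTower.of_algebraMap_eq fun x => by
        have h1 : algebraMap ℂ[X] (Localization.AtPrime p ⧸ I) (algebraMap ℂ ℂ[X] x) =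
          Ideal.Quotient.mk I (algebraMap ℂ[X] (Localization.AtPrime p) (algebraMap ℂ ℂ[X] x)) := rfl
        have h2 : algebraMap ℂ (Localization.AtPrime p ⧸ I) x =
          Ideal.Quotient.mk I (algebraMap ℂ (Localization.AtPrime p) x) := rfl
        rw [h1, h2, IsScalarTower.algebraMap_apply ℂ[X] S, ← IsScalarTower.algebraMap_apply ℂ ℂ[X] S,
          ← IsScalarTower.algebraMap_apply ℂ S]
    have h2 : Module.Finite ℂ[X] (Localization.AtPrime p ⧸ I) :=
      Module.Finite.of_restrictScalars_finite ℂ ℂ[X] _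
    infer_instance
  have hqf : Algebra.QuasiFiniteAt ℂ[X] p := Algebra.QuasiFiniteAt.of_weaklyQuasiFiniteAt p
  have hqD : Algebra.QuasiFinite ℂ[X] D :=
    Algebra.QuasiFinite.of_surjective_algHom (e.toAlgHom.restrictScalars ℂ[X]) e.surjective
  have hqK : Algebra.QuasiFinite ℂ[X] K :=
    Algebra.QuasiFinite.of_isLocalization (nonZeroDivisors D)
  have hqK' : Algebra.QuasiFinite (FractionRing ℂ[X]) K :=
    Algebra.QuasiFinite.of_restrictScalars ℂ[X] (FractionRing ℂ[X]) K
  have hfd : FiniteDimensional (FractionRing ℂ[X]) K := Module.Finite.of_quasiFinite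
  -- the valuation ring
  let R : Subring K := (integralClosure D K).toSubring
  have hic : IsIntegrallyClosedIn R K :=
    inferInstanceAs (IsIntegrallyClosedIn (integralClosure D K) K)
  obtain ⟨V, hRV, hrV⟩ := Subring.exists_le_valuationSubring_of_isIntegrallyClosedIn
    (x := r) (R := R) hr
  have hDV : ∀ y : D, algebraMap D K y ∈ V := fun y => hRV (isIntegral_algebraMap (R := D) (x := y))
  have hCV : ∀ c : ℂ, algebraMap ℂ K c ∈ V := fun c => by
    rw [IsScalarTower.algebraMap_apply ℂ D K]; exact hDV _
  let j : D →+* V := (algebraMap D K).codRestrict V.toSubring hDV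
  have hj : ∀ y, ((j y : V) : K) = algebraMap D K y := fun _ => rfl
  -- center of V on D is the maximal ideal
  let Q : Ideal D := (IsLocalRing.maximalIdeal V).comap j
  have hQp : Q.IsPrime := Ideal.comap_isPrime _ _
  have hQ0 : Q ≠ ⊥ := by
    intro h
    apply hrV
    have hun : ∀ y : D, y ≠ 0 → (algebraMap D K y)⁻¹ ∈ V := by
      intro y hy
      have hyQ : y ∉ Q := by rw [h]; exact hy
      have : IsUnit (j y) := by
        by_contra hu
        exact hyQ ((IsLocalRing.mem_maximalIdeal _).2 hu)
      obtain ⟨b, hb⟩ := isUnit_iff_exists_inv.1 this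
      have hb' : algebraMap D K y * (b : K) = 1 := congrArg (Subtype.val : V → K) hb
      rw [inv_eq_of_mul_eq_one_right hb']
      exact b.2
    obtain ⟨a, b, hb, hab⟩ := IsFractionRing.div_surjective (A := D) r
    rw [← hab, div_eq_mul_inv]
    exact V.mul_mem _ _ (hDV a) (hun b (nonZeroDivisors.ne_zero hb))
  have hQm : Q = IsLocalRing.maximalIdeal D := prime_bot_or_max wD hfin hwm Q hQ0
  have hjm : ∀ y ∈ IsLocalRing.maximalIdeal D, j y ∈ IsLocalRing.maximalIdeal V := by
    intro y hy
    rw [← hQm] at hy; exact hy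
  have hXV : algebraMap ℂ[X] K Polynomial.X ∈ V.nonunits := by
    have : algebraMap ℂ[X] K Polynomial.X = ((j wD : V) : K) := by
      rw [hj, IsScalarTower.algebraMap_apply ℂ[X] D K, IsScalarTower.algebraMap_apply ℂ[X] S D, hXS]
    rw [this, ValuationSubring.coe_mem_nonunits_iff]
    exact hjm _ hwm
  obtain ⟨ψ, hψ1, hψ2, hψ3⟩ := val_dvr V hCV hXV
  have hcomm : ∀ c : ℂ, (ψ.comp j) (algebraMap ℂ D c) = algebraMap ℂ (PowerSeries ℂ) c := by
    intro c
    have h1 : j (algebraMap ℂ D c) = ⟨algebraMap ℂ K c, hCV c⟩ := Subtype.ext (by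
      rw [hj, ← IsScalarTower.algebraMap_apply ℂ D K])
    rw [RingHom.comp_apply, h1, hψ3]
    rfl
  let φ : D →ₐ[ℂ] PowerSeries ℂ := { ψ.comp j with commutes' := hcomm }
  have hφ : ∀ y, φ y = ψ (j y) := fun _ => rfl
  refine ⟨φ, ?_, ?_, ?_⟩
  · intro a b hab
    have := hψ1 hab
    exact IsFractionRing.injective D K (congrArg (Subtype.val : V → K) this)
  · intro v hv; exact hψ2 _ (hjm v hv)
  · intro x y hy hxy
    have hr0 : r ≠ 0 := by rintro rfl; exact hrV V.zero_mem
    have hinv : r⁻¹ ∈ V := (V.mem_or_inv_mem r).resolve_left hrV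
    have hyx : algebraMap D K y = algebraMap D K x * r⁻¹ := by
      rw [← hxy, mul_comm r, mul_assoc, mul_inv_cancel₀ hr0, mul_one]
    have hnu : (⟨r⁻¹, hinv⟩ : V) ∈ IsLocalRing.maximalIdeal V := by
      rw [IsLocalRing.mem_maximalIdeal]
      intro hu
      obtain ⟨b, hb⟩ := isUnit_iff_exists_inv.1 hu
      have hb' : r⁻¹ * (b : K) = 1 := congrArg (Subtype.val : V → K) hb
      apply hrV
      have : (b : K) = r := by
        have := congrArg (r * ·) hb'
        simpa [← mul_assoc, hr0] using this
      rw [← this]; exact b.2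
    have hjy : j y = j x * ⟨r⁻¹, hinv⟩ := Subtype.ext hyx
    have hx0 : φ x ≠ 0 := by
      intro h
      have h2 : φ y = 0 := by rw [hφ, hjy, map_mul, ← hφ, h, zero_mul]
      have h3 : j y = 0 := hψ1 (by rw [← hφ, h2, map_zero])
      exact hy (IsFractionRing.injective D K (by
        rw [map_zero, ← hj, h3]; rfl))
    have hord : (1 : ℕ∞) ≤ (ψ ⟨r⁻¹, hinv⟩).order := by
      apply PowerSeries.le_order
      intro i hi
      have : i = 0 := by
        have : (i : ℕ∞) < 1 := hi
        exact_mod_cast Nat.lt_one_iff.1 (by exact_mod_cast this)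
      subst this
      simpa using hψ2 _ hnu
    rw [hφ y, hjy, map_mul, PowerSeries.order_mul, ← hφ]
    have hfinx : (φ x).order ≠ ⊤ := by
      rwa [Ne, PowerSeries.order_eq_top]
    exact lt_of_lt_of_le ((ENat.lt_add_one_iff hfinx).2 le_rfl) (by gcongr)

end ArcExists

section IntThm

theorem span_pair_pow_succ_le {O : Type*} [CommRing O] (x w : O) (K : ℕ) :
    (Ideal.span {x, w}) ^ (K + 1) ≤
      Ideal.span {x ^ (K + 1)} ⊔ Ideal.span {w} * (Ideal.span {x, w}) ^ K := by
  have hxw : Ideal.span {x, w} = Ideal.span {x} ⊔ Ideal.span {w} := Ideal.span_insert x {w}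
  induction K with
  | zero => rw [zero_add, pow_one, pow_one, pow_zero, hxw, Ideal.one_eq_top, Ideal.mul_top]
  | succ K ih =>
    have hle : Ideal.span {x} ≤ Ideal.span {x, w} := by rw [hxw]; exact le_sup_left
    rw [pow_succ' _ (K + 1)]
    nth_rewrite 1 [hxw]
    rw [Ideal.sup_mul]
    refine sup_le ?_ le_sup_right
    refine (Ideal.mul_mono_right ih).trans ?_
    rw [Ideal.mul_sup]
    refine sup_le_sup ?_ ?_
    · rw [Ideal.span_singleton_mul_span_singleton, ← pow_succ']
    · rw [← mul_assoc, mul_comm (Ideal.span {x}), mul_assoc, pow_succ' _ K]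
      exact Ideal.mul_mono_right (Ideal.mul_mono_left hle)

/-- consequence of an equation of integral dependence -/
theorem pow_mem_of_dep {O : Type*} [CommRing O] (I : Ideal O) (x w : O) (K : ℕ)
    (h : x ^ (K + 1) ∈ Ideal.span {w} * (Ideal.span {x, w}) ^ K ⊔ I) (m : ℕ) :
    x ^ (K + m) ∈ Ideal.span {w ^ m} ⊔ I := by
  have key : ∀ m, (Ideal.span {x, w}) ^ (K + m) ≤
      Ideal.span {w ^ m} * (Ideal.span {x, w}) ^ K ⊔ I := by
    intro m
    induction m with
    | zero =>
      rw [add_zero, pow_zero, Ideal.span_singleton_one, Ideal.top_mul]; exact le_sup_left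
    | succ m ih =>
      rw [← add_assoc, pow_succ']
      refine (Ideal.mul_mono_right ih).trans ?_
      rw [Ideal.mul_sup]
      refine sup_le ?_ (Ideal.mul_le_right.trans le_sup_right)
      rw [← mul_assoc, mul_comm (Ideal.span {x, w}), mul_assoc, ← pow_succ']
      refine (Ideal.mul_mono_right (span_pair_pow_succ_le x w K)).trans ?_
      have h1 : Ideal.span {x ^ (K + 1)} ⊔ Ideal.span {w} * (Ideal.span {x, w}) ^ K ≤
          Ideal.span {w} * (Ideal.span {x, w}) ^ K ⊔ I :=
        sup_le ((Ideal.span_singleton_le_iff_mem _).2 h) le_sup_left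
      refine (Ideal.mul_mono_right h1).trans ?_
      rw [Ideal.mul_sup, ← mul_assoc, Ideal.span_singleton_mul_span_singleton, ← pow_succ]
      exact sup_le_sup le_rfl Ideal.mul_le_right
  have h1 : x ^ (K + m) ∈ (Ideal.span {x, w}) ^ (K + m) :=
    Ideal.pow_mem_pow (Ideal.subset_span (by simp)) _
  exact (sup_le_sup Ideal.mul_le_left le_rfl : _ ≤ Ideal.span {w ^ m} ⊔ I) (key m h1)

theorem dep_mul {O : Type*} [CommRing O] (I J : Ideal O) (x w : O) (K L : ℕ)
    (h : x ^ (K + 1) ∈ Ideal.span {w} * (Ideal.span {x, w}) ^ K ⊔ I)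
    (h' : x ^ (L + 1) ∈ Ideal.span {w} * (Ideal.span {x, w}) ^ L ⊔ J) :
    x ^ (K + L + 1 + 1) ∈ Ideal.span {w} * (Ideal.span {x, w}) ^ (K + L + 1) ⊔ I * J := by
  obtain ⟨a, ha, i, hi, hai⟩ := Submodule.mem_sup.1 h
  obtain ⟨b, hb, j, hj, hbj⟩ := Submodule.mem_sup.1 h'
  have hx : x ∈ Ideal.span {x, w} := Ideal.subset_span (by simp)
  have hw : Ideal.span {w} ≤ Ideal.span {x, w} := Ideal.span_mono (by simp)
  have e : x ^ (K + L + 1 + 1) = (a * x ^ (L + 1) + b * x ^ (K + 1) - a * b) + i * j := by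
    have : x ^ (K + L + 1 + 1) = x ^ (K + 1) * x ^ (L + 1) := by ring
    rw [this, ← hai, ← hbj]; ring
  rw [e]
  refine Ideal.add_mem _ (Ideal.mem_sup_left ?_) (Ideal.mem_sup_right (Ideal.mul_mem_mul hi hj))
  refine Ideal.sub_mem _ (Ideal.add_mem _ ?_ ?_) ?_
  · have := Ideal.mul_mem_mul ha (Ideal.pow_mem_pow hx (L + 1))
    rwa [mul_assoc, ← pow_add, ← add_assoc] at this
  · have := Ideal.mul_mem_mul hb (Ideal.pow_mem_pow hx (K + 1))
    rw [mul_assoc, ← pow_add] at this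
    convert this using 3; omega
  · have hb' : b ∈ (Ideal.span {x, w}) ^ (L + 1) := by
      rw [pow_succ']; exact Ideal.mul_mono_left hw hb
    have := Ideal.mul_mem_mul ha hb'
    rwa [mul_assoc, ← pow_add, ← add_assoc] at this

/-- An integral fraction gives an equation of integral dependence. -/
theorem dep_of_isIntegral {D K : Type*} [CommRing D] [IsDomain D] [Field K] [Algebra D K]
    [IsFractionRing D K] (x w : D) (hw : w ≠ 0)
    (h : IsIntegral D (algebraMap D K x / algebraMap D K w)) :
    ∃ k, x ^ (k + 1) ∈ Ideal.span {w} * (Ideal.span {x, w}) ^ k := by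
  obtain ⟨q, hq, hq0⟩ := h
  have hwK : algebraMap D K w ≠ 0 := by
    rwa [Ne, map_eq_zero_iff _ (IsFractionRing.injective D K)]
  have hdeg : q.natDegree ≠ 0 := by
    intro h0
    rw [Polynomial.eq_one_of_monic_natDegree_zero hq h0] at hq0
    simp at hq0
  obtain ⟨k, hk⟩ := Nat.exists_eq_succ_of_ne_zero hdeg
  refine ⟨k, ?_⟩
  have h1 : x ^ (k + 1) = - ∑ i ∈ Finset.range (k + 1), q.coeff i * x ^ i * w ^ (k + 1 - i) := by
    apply IsFractionRing.injective D K
    rw [Polynomial.eval₂_eq_sum_range, hk, Finset.sum_range_succ] at hq0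
    have hc : q.coeff k.succ = 1 := by rw [← hk]; exact hq
    rw [hc, map_one, one_mul] at hq0
    have h2 := congrArg (· * algebraMap D K w ^ (k + 1)) hq0
    simp only [add_mul, zero_mul, Finset.sum_mul, div_pow] at h2
    rw [div_mul_cancel₀ _ (pow_ne_zero _ hwK)] at h2
    rw [map_neg, map_sum, map_pow, eq_neg_iff_add_eq_zero, add_comm, ← h2]
    congr 1
    refine Finset.sum_congr rfl fun i hi => ?_
    have hi' : i < k + 1 := Finset.mem_range.1 hi
    rw [map_mul, map_mul, map_pow, map_pow, mul_assoc, mul_assoc]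
    congr 1
    have : algebraMap D K w ^ (k + 1) = algebraMap D K w ^ i * algebraMap D K w ^ (k + 1 - i) := by
      rw [← pow_add]; congr 1; omega
    rw [this, ← mul_assoc, div_mul_cancel₀ _ (pow_ne_zero _ hwK)]
  rw [h1]
  refine Ideal.neg_mem_iff _ |>.2 (Ideal.sum_mem _ fun i hi => ?_)
  have hi' : i < k + 1 := Finset.mem_range.1 hi
  have e : q.coeff i * x ^ i * w ^ (k + 1 - i) = w * (q.coeff i * (x ^ i * w ^ (k - i))) := by
    have : k + 1 - i = (k - i) + 1 := by omega
    rw [this]; ring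
  rw [e]
  refine Ideal.mul_mem_mul (Ideal.mem_span_singleton_self w) (Ideal.mul_mem_left _ _ ?_)
  have e2 : k = i + (k - i) := by omega
  rw [e2, pow_add, Nat.add_sub_cancel_left]
  exact Ideal.mul_mem_mul (Ideal.pow_mem_pow (Ideal.subset_span (by simp)) _)
    (Ideal.pow_mem_pow (Ideal.subset_span (by simp)) _)

variable {A : Type} [CommRing A] [Algebra ℂ A] [Algebra.FiniteType ℂ A] (m : Ideal A) [m.IsPrime]

/-- a (formal) arc: a local homomorphism to the power series ring -/
def IsArc {O : Type*} [CommRing O] [IsLocalRing O] [Algebra ℂ O] (ψ : O →ₐ[ℂ] PowerSeries ℂ) : Prop :=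
  ∀ v ∈ IsLocalRing.maximalIdeal O, PowerSeries.constantCoeff (ψ v) = 0

local notation "𝕆" => Localization.AtPrime m

theorem int_prime (Q : Ideal 𝕆) [hQ : Q.IsPrime] (w x : 𝕆)
    (hw : w ∈ IsLocalRing.maximalIdeal 𝕆) (hwQ : w ∉ Q)
    (hfin : Module.Finite ℂ (𝕆 ⧸ (Q ⊔ Ideal.span {w})))
    (harc : ∀ ψ : 𝕆 →ₐ[ℂ] PowerSeries ℂ, IsArc ψ → (∀ a, ψ a = 0 ↔ a ∈ Q) →
      (ψ w).order ≤ (ψ x).order) :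
    ∃ K, x ^ (K + 1) ∈ Ideal.span {w} * (Ideal.span {x, w}) ^ K ⊔ Q := by
  classical
  let D := 𝕆 ⧸ Q
  have : IsLocalRing D := IsLocalRing.of_surjective' (Ideal.Quotient.mk Q) Ideal.Quotient.mk_surjective
  let π : 𝕆 →ₐ[ℂ] D := Ideal.Quotient.mkₐ ℂ Q
  have hπs : Function.Surjective π := Ideal.Quotient.mk_surjective
  let f : A →ₐ[ℂ] D := π.comp (IsScalarTower.toAlgHom ℂ A 𝕆)
  have hf : ∀ a, f a = π (algebraMap A 𝕆 a) := fun _ => rfl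
  let S := f.range
  have hft : Algebra.FiniteType ℂ S :=
    Algebra.FiniteType.of_surjective f.rangeRestrict f.rangeRestrict_surjective
  have hloc : IsLocalHom π.toRingHom := IsLocalHom.of_surjective π.toRingHom hπs
  have hun : ∀ a : 𝕆, IsUnit (π a) ↔ IsUnit a := fun a => isUnit_map_iff π.toRingHom a
  let p : Ideal S := (IsLocalRing.maximalIdeal D).comap (algebraMap S D)
  have hp : p.IsPrime := Ideal.comap_isPrime _ _
  have hD : IsLocalization.AtPrime D p := by
    refine ⟨?_, ?_, ?_⟩
    · rintro ⟨y, hy⟩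
      by_contra hu
      exact hy ((IsLocalRing.mem_maximalIdeal _).2 hu)
    · intro z
      obtain ⟨z, rfl⟩ := hπs z
      obtain ⟨⟨a, u⟩, hau⟩ := IsLocalization.surj m.primeCompl z
      refine ⟨⟨f.rangeRestrict a, ⟨f.rangeRestrict u, ?_⟩⟩, ?_⟩
      · intro hu
        have h1 : ¬ IsUnit (f u) := (IsLocalRing.mem_maximalIdeal _).1 hu
        exact h1 ((hun _).2 (IsLocalization.map_units 𝕆 u))
      · change π z * f u = f a
        rw [hf, hf, ← map_mul, hau]
    · intro a b hab
      exact ⟨1, by rw [Subtype.ext hab]⟩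
  obtain ⟨⟨a, u⟩, hau⟩ := IsLocalization.surj m.primeCompl w
  have huu : IsUnit (algebraMap A 𝕆 u) := IsLocalization.map_units 𝕆 u
  let wS : S := f.rangeRestrict a
  have hwS : algebraMap S D wS = π w * π (algebraMap A 𝕆 u) := by
    change f a = _
    rw [hf, ← map_mul, hau]
  have hw0 : π w ≠ 0 := fun h => hwQ (Ideal.Quotient.eq_zero_iff_mem.1 h)
  have hwmD : π w ∈ IsLocalRing.maximalIdeal D :=
    (IsLocalRing.mem_maximalIdeal _).2 fun h => (IsLocalRing.mem_maximalIdeal _).1 hw ((hun _).1 h)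
  have hspan : Ideal.span {algebraMap S D wS} = Ideal.span {π w} := by
    rw [hwS]; exact Ideal.span_singleton_mul_right_unit ((hun _).2 huu) _
  let K := FractionRing D
  by_cases hinteg : IsIntegral D (algebraMap D K (π x) / algebraMap D K (π w))
  · obtain ⟨k, hk⟩ := dep_of_isIntegral (π x) (π w) hw0 hinteg
    refine ⟨k, ?_⟩
    have e : Ideal.span {π w} * (Ideal.span {π x, π w}) ^ k =
        (Ideal.span {w} * (Ideal.span {x, w}) ^ k).map (Ideal.Quotient.mk Q) := by
      rw [Ideal.map_mul, Ideal.map_pow, Ideal.map_span, Ideal.map_span, Set.image_singleton,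
        Set.image_pair]
      rfl
    rw [e] at hk
    have h2 : x ^ (k + 1) ∈ ((Ideal.span {w} * (Ideal.span {x, w}) ^ k).map
        (Ideal.Quotient.mk Q)).comap (Ideal.Quotient.mk Q) := by
      rw [Ideal.mem_comap, map_pow]; exact hk
    rwa [Ideal.comap_map_of_surjective _ Ideal.Quotient.mk_surjective, ← RingHom.ker_eq_comap_bot,
      Ideal.mk_ker] at h2
  · exfalso
    have hf2 : Module.Finite ℂ (D ⧸ Ideal.span {algebraMap S D wS}) := by
      rw [hspan]
      have hk : ∀ a ∈ Q ⊔ Ideal.span {w}, ((Ideal.Quotient.mkₐ ℂ (Ideal.span {π w})).comp π) a = 0 := by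
        intro a ha
        have hle : Q ⊔ Ideal.span {w} ≤
            RingHom.ker ((Ideal.Quotient.mkₐ ℂ (Ideal.span {π w})).comp π) := by
          refine sup_le (fun b hb => ?_) ((Ideal.span_singleton_le_iff_mem _).2 ?_)
          · rw [RingHom.mem_ker, AlgHom.comp_apply]
            have : π b = 0 := Ideal.Quotient.eq_zero_iff_mem.2 hb
            rw [this, map_zero]
          · rw [RingHom.mem_ker, AlgHom.comp_apply]
            exact Ideal.Quotient.eq_zero_iff_mem.2 (Ideal.mem_span_singleton_self _)
        exact hle ha
      exact Module.Finite.of_surjective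
        (Ideal.Quotient.liftₐ _ ((Ideal.Quotient.mkₐ ℂ (Ideal.span {π w})).comp π) hk).toLinearMap
        (Ideal.Quotient.lift_surjective_of_surjective _ hk
          (Ideal.Quotient.mk_surjective.comp hπs))
    have hwSp : wS ∈ p := by
      rw [Ideal.mem_comap, hwS]
      exact Ideal.mul_mem_right _ _ hwmD
    have hwS0 : wS ≠ 0 := by
      intro h
      rw [h, map_zero] at hwS
      rcases mul_eq_zero.1 hwS.symm with h | h
      · exact hw0 h
      · exact ((hun _).2 huu).ne_zero h
    obtain ⟨ψ, h1, h2, h3⟩ := arc_exists p wS hwSp hwS0 hf2 _ hinteg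
    have hwK : algebraMap D K (π w) ≠ 0 := by
      rwa [Ne, map_eq_zero_iff _ (IsFractionRing.injective D K)]
    have h4 := h3 (π x) (π w) hw0 (div_mul_cancel₀ _ hwK)
    refine absurd (harc (ψ.comp π) ?_ ?_) (not_le.2 h4)
    · intro v hv
      refine h2 _ ?_
      exact (IsLocalRing.mem_maximalIdeal _).2
        fun h => (IsLocalRing.mem_maximalIdeal _).1 hv ((hun _).1 h)
    · intro a
      rw [AlgHom.comp_apply, map_eq_zero_iff _ h1]
      exact Ideal.Quotient.eq_zero_iff_mem

/-- The integral dependence theorem (arc criterion). -/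
theorem int_thm (I : Ideal 𝕆) (w x : 𝕆)
    (hw : w ∈ IsLocalRing.maximalIdeal 𝕆) (hwQ : ∀ Q ∈ I.minimalPrimes, w ∉ Q)
    (hfin : Module.Finite ℂ (𝕆 ⧸ (I ⊔ Ideal.span {w})))
    (harc : ∀ ψ : 𝕆 →ₐ[ℂ] PowerSeries ℂ, IsArc ψ → (∀ a ∈ I, ψ a = 0) → ψ w ≠ 0 →
      (ψ w).order ≤ (ψ x).order) :
    ∃ K, x ^ (K + 1) ∈ Ideal.span {w} * (Ideal.span {x, w}) ^ K ⊔ I := by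
  classical
  have : IsNoetherianRing A := Algebra.FiniteType.isNoetherianRing ℂ A
  have : IsNoetherianRing 𝕆 := IsLocalization.isNoetherianRing m.primeCompl 𝕆 inferInstance
  have hmf : I.minimalPrimes.Finite := Ideal.finite_minimalPrimes_of_isNoetherianRing _ I
  have hprod : ∀ s : Finset (Ideal 𝕆), (↑s ⊆ I.minimalPrimes) →
      ∃ K, x ^ (K + 1) ∈ Ideal.span {w} * (Ideal.span {x, w}) ^ K ⊔ ∏ Q ∈ s, Q := by
    intro s
    induction s using Finset.induction_on with
    | empty => intro _; exact ⟨0, by simp [Ideal.one_eq_top]⟩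
    | insert Q s hQs ih =>
      intro hs
      have hQ : Q ∈ I.minimalPrimes := hs (by simp)
      obtain ⟨L, hL⟩ := ih fun q hq => hs (by
        rw [Finset.coe_insert]; exact Set.mem_insert_of_mem _ hq)
      have hQp : Q.IsPrime := hQ.1.1
      have hIQ : I ≤ Q := hQ.1.2
      have hf2 : Module.Finite ℂ (𝕆 ⧸ (Q ⊔ Ideal.span {w})) :=
        Module.Finite.of_surjective
          (Ideal.Quotient.factorₐ ℂ (sup_le_sup_right hIQ (Ideal.span {w}))).toLinearMap
          (Ideal.Quotient.factor_surjective (sup_le_sup_right hIQ (Ideal.span {w})))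
      obtain ⟨K, hK⟩ := int_prime m Q w x hw (hwQ Q hQ) hf2 (fun ψ h1 h2 =>
        harc ψ h1 (fun a ha => (h2 a).2 (hIQ ha)) (fun h => hwQ Q hQ ((h2 w).1 h)))
      rw [Finset.prod_insert hQs]
      exact ⟨_, dep_mul _ _ x w K L hK hL⟩
  obtain ⟨K, hK⟩ := hprod hmf.toFinset (by simp)
  have hle : ∏ Q ∈ hmf.toFinset, Q ≤ I.radical := by
    refine Ideal.prod_le_inf.trans ?_
    rw [Ideal.radical_eq_sInf, ]
    refine le_sInf ?_
    rintro q ⟨hq, hqp⟩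
    obtain ⟨q', hq', hle⟩ := Ideal.exists_minimalPrimes_le hq
    exact (Finset.inf_le (hmf.mem_toFinset.2 hq')).trans hle
  obtain ⟨N, hN⟩ := Ideal.exists_radical_pow_le_of_fg I I.radical.fg_of_isNoetherianRing
  set T := ∏ Q ∈ hmf.toFinset, Q
  have hpow : ∀ N, ∃ K, x ^ (K + 1) ∈ Ideal.span {w} * (Ideal.span {x, w}) ^ K ⊔ T ^ N := by
    intro N
    induction N with
    | zero => exact ⟨0, by simp [Ideal.one_eq_top]⟩
    | succ N ih =>
      obtain ⟨L, hL⟩ := ih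
      rw [pow_succ]
      exact ⟨_, dep_mul _ _ x w _ _ hL hK⟩
  obtain ⟨L, hL⟩ := hpow N
  exact ⟨L, sup_le_sup_left ((Ideal.pow_right_mono hle N).trans hN) _ hL⟩

/-- existence of arcs -/
theorem exists_arc (Q : Ideal 𝕆) [hQ : Q.IsPrime] (w : 𝕆)
    (hw : w ∈ IsLocalRing.maximalIdeal 𝕆) (hwQ : w ∉ Q)
    (hfin : Module.Finite ℂ (𝕆 ⧸ (Q ⊔ Ideal.span {w}))) :
    ∃ ψ : 𝕆 →ₐ[ℂ] PowerSeries ℂ, IsArc ψ ∧ (∀ a, ψ a = 0 ↔ a ∈ Q) := by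
  by_contra hcon
  push Not at hcon
  obtain ⟨K, hK⟩ := int_prime m Q w 1 hw hwQ hfin (fun ψ h1 h2 => by
    obtain ⟨a, ha⟩ := hcon ψ h1
    have := h2 a
    tauto)
  have : (1 : 𝕆) ∈ IsLocalRing.maximalIdeal 𝕆 := by
    rw [one_pow] at hK
    refine (sup_le ?_ (IsLocalRing.le_maximalIdeal hQ.ne_top) : _ ≤ _) hK
    exact Ideal.mul_le_left.trans ((Ideal.span_singleton_le_iff_mem _).2 hw)
  exact (IsLocalRing.maximalIdeal.isMaximal 𝕆).ne_top ((Ideal.eq_top_iff_one _).2 this)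

end IntThm

section Mult

variable {O : Type*} [CommRing O]

/-- the colon ideal `(J : x)` -/
def colE (J : Ideal O) (x : O) : Ideal O where
  carrier := {a | a * x ∈ J}
  add_mem' := fun {a b} ha hb => by
    change (a + b) * x ∈ J
    rw [add_mul]; exact J.add_mem ha hb
  zero_mem' := by change 0 * x ∈ J; simp
  smul_mem' := fun c a ha => by
    change c * a * x ∈ J
    rw [mul_assoc]; exact J.mul_mem_left _ ha

theorem mem_colE (J : Ideal O) (x a : O) : a ∈ colE J x ↔ a * x ∈ J := Iff.rfl

variable [Algebra ℂ O]

/-- multiplication by `x` from `O/(J:x)` to `O/J` -/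
def colMap (J : Ideal O) (x : O) : (O ⧸ colE J x) →ₗ[ℂ] (O ⧸ J) :=
  (Submodule.mapQ (colE J x) J (LinearMap.mulRight O x) (fun a ha => by
    exact ha)).restrictScalars ℂ

theorem colMap_mk (J : Ideal O) (x a : O) :
    colMap J x (Ideal.Quotient.mk _ a) = Ideal.Quotient.mk _ (a * x) := rfl

theorem colMap_inj (J : Ideal O) (x : O) : Function.Injective (colMap J x) := by
  rw [injective_iff_map_eq_zero]
  intro a ha
  obtain ⟨a, rfl⟩ := Ideal.Quotient.mk_surjective a
  rw [colMap_mk, Ideal.Quotient.eq_zero_iff_mem] at ha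
  exact Ideal.Quotient.eq_zero_iff_mem.2 ha

theorem colMap_range (J : Ideal O) (x : O) : LinearMap.range (colMap J x) =
    LinearMap.ker (Ideal.Quotient.factorₐ ℂ
      (le_sup_left : J ≤ J ⊔ Ideal.span {x})).toLinearMap := by
  ext a
  obtain ⟨a, rfl⟩ := Ideal.Quotient.mk_surjective a
  rw [LinearMap.mem_ker]
  change _ ↔ Ideal.Quotient.mk _ a = 0
  rw [Ideal.Quotient.eq_zero_iff_mem]
  constructor
  · rintro ⟨b, hb⟩
    obtain ⟨b, rfl⟩ := Ideal.Quotient.mk_surjective b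
    rw [colMap_mk, Ideal.Quotient.mk_eq_mk_iff_sub_mem] at hb
    have : a = -(b * x - a) + b * x := by ring
    rw [this]
    exact Ideal.add_mem _ (Ideal.mem_sup_left (J.neg_mem hb))
      (Ideal.mem_sup_right (Ideal.mul_mem_left _ _ (Ideal.mem_span_singleton_self x)))
  · intro ha
    obtain ⟨i, hi, y, hy, rfl⟩ := Submodule.mem_sup.1 ha
    obtain ⟨c, rfl⟩ := Ideal.mem_span_singleton'.1 hy
    refine ⟨Ideal.Quotient.mk _ c, ?_⟩
    rw [colMap_mk, Ideal.Quotient.mk_eq_mk_iff_sub_mem]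
    simpa using hi

theorem quot_finite_mono {I J : Ideal O} (h : I ≤ J) (hf : Module.Finite ℂ (O ⧸ I)) :
    Module.Finite ℂ (O ⧸ J) :=
  Module.Finite.of_surjective (Ideal.Quotient.factorₐ ℂ h).toLinearMap
    (Ideal.Quotient.factor_surjective h)

theorem quot_finrank_mono {I J : Ideal O} (h : I ≤ J) (hf : Module.Finite ℂ (O ⧸ I)) :
    Module.finrank ℂ (O ⧸ J) ≤ Module.finrank ℂ (O ⧸ I) :=
  LinearMap.finrank_le_finrank_of_surjective (f := (Ideal.Quotient.factorₐ ℂ h).toLinearMap)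
    (Ideal.Quotient.factor_surjective h)

theorem finite_of_colon (J : Ideal O) (x : O) (h1 : Module.Finite ℂ (O ⧸ colE J x))
    (h2 : Module.Finite ℂ (O ⧸ (J ⊔ Ideal.span {x}))) : Module.Finite ℂ (O ⧸ J) := by
  refine ⟨Submodule.fg_of_fg_map_of_fg_inf_ker (Ideal.Quotient.factorₐ ℂ
      (le_sup_left : J ≤ J ⊔ Ideal.span {x})).toLinearMap ?_ ?_⟩
  · exact IsNoetherian.noetherian _
  · rw [top_inf_eq, ← colMap_range, LinearMap.range_eq_map]
    exact Submodule.FG.map _ h1.1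

theorem finrank_colon (J : Ideal O) (x : O) (h : Module.Finite ℂ (O ⧸ J)) :
    Module.finrank ℂ (O ⧸ J) = Module.finrank ℂ (O ⧸ colE J x) +
      Module.finrank ℂ (O ⧸ (J ⊔ Ideal.span {x})) := by
  set g := (Ideal.Quotient.factorₐ ℂ (le_sup_left : J ≤ J ⊔ Ideal.span {x})).toLinearMap with hg
  have hgs : Function.Surjective g := Ideal.Quotient.factor_surjective le_sup_left
  rw [← LinearMap.finrank_range_add_finrank_ker g, LinearMap.range_eq_top.2 hgs, finrank_top,
    ← colMap_range, LinearMap.finrank_range_of_inj (colMap_inj J x), add_comm]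

theorem pow_sup_le_colE (I : Ideal O) (x : O) (m : ℕ) :
    I ⊔ Ideal.span {x ^ m} ≤ colE (I ⊔ Ideal.span {x ^ (m + 1)}) x := by
  refine sup_le (fun a ha => ?_) ((Ideal.span_singleton_le_iff_mem _).2 ?_)
  · exact Ideal.mem_sup_left (I.mul_mem_right _ ha)
  · rw [mem_colE, ← pow_succ]
    exact Ideal.mem_sup_right (Ideal.mem_span_singleton_self _)

theorem sup_pow_sup (I : Ideal O) (x : O) (m : ℕ) :
    I ⊔ Ideal.span {x ^ (m + 1)} ⊔ Ideal.span {x} = I ⊔ Ideal.span {x} := by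
  rw [sup_assoc]
  congr 1
  refine sup_eq_right.2 ((Ideal.span_singleton_le_iff_mem _).2 ?_)
  exact Ideal.mem_span_singleton.2 (dvd_pow_self _ (Nat.succ_ne_zero m))

theorem finite_pow (I : Ideal O) (x : O) (h : Module.Finite ℂ (O ⧸ (I ⊔ Ideal.span {x}))) (m : ℕ) :
    Module.Finite ℂ (O ⧸ (I ⊔ Ideal.span {x ^ m})) ∧
      Module.finrank ℂ (O ⧸ (I ⊔ Ideal.span {x ^ m})) ≤
        m * Module.finrank ℂ (O ⧸ (I ⊔ Ideal.span {x})) := by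
  induction m with
  | zero =>
    have : I ⊔ Ideal.span {x ^ 0} = ⊤ := by rw [pow_zero, Ideal.span_singleton_one, sup_top_eq]
    rw [this]
    have : Subsingleton (O ⧸ (⊤ : Ideal O)) := Ideal.Quotient.subsingleton_iff.2 rfl
    exact ⟨inferInstance, by rw [Module.finrank_zero_of_subsingleton]; omega⟩
  | succ m ih =>
    have hf : Module.Finite ℂ (O ⧸ (I ⊔ Ideal.span {x ^ (m + 1)})) := by
      refine finite_of_colon _ x (quot_finite_mono (pow_sup_le_colE I x m) ih.1) ?_
      rw [sup_pow_sup]; exact h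
    refine ⟨hf, ?_⟩
    rw [finrank_colon _ x hf, sup_pow_sup]
    have := quot_finrank_mono (pow_sup_le_colE I x m) ih.1
    have := ih.2
    rw [add_mul, one_mul]
    omega

theorem colE_pow_eq (I : Ideal O) (w : O) (hw : ∀ a, a * w ∈ I → a ∈ I) (m : ℕ) :
    colE (I ⊔ Ideal.span {w ^ (m + 1)}) w = I ⊔ Ideal.span {w ^ m} := by
  refine le_antisymm (fun a ha => ?_) (pow_sup_le_colE I w m)
  obtain ⟨i, hi, y, hy, he⟩ := Submodule.mem_sup.1 ha
  obtain ⟨c, rfl⟩ := Ideal.mem_span_singleton'.1 hy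
  have : a - c * w ^ m ∈ I := hw _ (by
    have : (a - c * w ^ m) * w = i := by
      rw [sub_mul, mul_assoc, ← pow_succ, ← he]; ring
    rwa [this])
  have e : a = (a - c * w ^ m) + c * w ^ m := by ring
  rw [e]
  exact Ideal.add_mem _ (Ideal.mem_sup_left this)
    (Ideal.mem_sup_right (Ideal.mul_mem_left _ _ (Ideal.mem_span_singleton_self _)))

theorem finrank_pow (I : Ideal O) (w : O) (hw : ∀ a, a * w ∈ I → a ∈ I)
    (h : Module.Finite ℂ (O ⧸ (I ⊔ Ideal.span {w}))) (m : ℕ) :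
      Module.finrank ℂ (O ⧸ (I ⊔ Ideal.span {w ^ m})) =
        m * Module.finrank ℂ (O ⧸ (I ⊔ Ideal.span {w})) := by
  induction m with
  | zero =>
    have : I ⊔ Ideal.span {w ^ 0} = ⊤ := by rw [pow_zero, Ideal.span_singleton_one, sup_top_eq]
    rw [this]
    have : Subsingleton (O ⧸ (⊤ : Ideal O)) := Ideal.Quotient.subsingleton_iff.2 rfl
    rw [Module.finrank_zero_of_subsingleton]; omega
  | succ m ih =>
    rw [finrank_colon _ w (finite_pow I w h _).1, sup_pow_sup, colE_pow_eq I w hw, ih]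
    ring

theorem mult_ineq (I : Ideal O) (w x : O) (hw : ∀ a, a * w ∈ I → a ∈ I)
    (h : Module.Finite ℂ (O ⧸ (I ⊔ Ideal.span {w})))
    (h' : Module.Finite ℂ (O ⧸ (I ⊔ Ideal.span {x}))) (K : ℕ)
    (hK : ∀ m, x ^ (K + m) ∈ Ideal.span {w ^ m} ⊔ I) :
    Module.finrank ℂ (O ⧸ (I ⊔ Ideal.span {w})) ≤ Module.finrank ℂ (O ⧸ (I ⊔ Ideal.span {x})) := by
  have key : ∀ m, m * Module.finrank ℂ (O ⧸ (I ⊔ Ideal.span {w})) ≤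
      (K + m) * Module.finrank ℂ (O ⧸ (I ⊔ Ideal.span {x})) := by
    intro m
    rw [← finrank_pow I w hw h]
    refine le_trans ?_ (finite_pow I x h' (K + m)).2
    refine quot_finrank_mono (sup_le le_sup_left ?_) (finite_pow I x h' (K + m)).1
    rw [Ideal.span_singleton_le_iff_mem, sup_comm]
    exact hK m
  set a := Module.finrank ℂ (O ⧸ (I ⊔ Ideal.span {w}))
  set b := Module.finrank ℂ (O ⧸ (I ⊔ Ideal.span {x}))
  by_contra hlt
  have hlt : b + 1 ≤ a := by omega
  have h1 := key (K * b + 1)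
  have h2 : (K * b + 1) * (b + 1) ≤ (K * b + 1) * a := Nat.mul_le_mul_left _ hlt
  nlinarith

end Mult

section CM

open RingTheory.Sequence Pointwise

/-- associated primes of a module with a regular sequence of length `r` have dimension `≥ r` -/
theorem dim_ass_ge {R : Type} [CommRing R] [IsLocalRing R] [IsNoetherianRing R] (r : ℕ) :
    ∀ (M : Type) [AddCommGroup M] [Module R M] [Module.Finite R M] (rs : List R)
      (_ : rs.length = r) (_ : ∀ x ∈ rs, x ∈ IsLocalRing.maximalIdeal R)
      (_ : IsWeaklyRegular M rs) (Q : Ideal R) (_ : IsAssociatedPrime Q M),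
      (r : WithBot ℕ∞) ≤ ringKrullDim (R ⧸ Q) := by
  induction r with
  | zero =>
    intro M _ _ _ rs _ _ _ Q hQ
    have : Q.IsPrime := (isAssociatedPrime_iff.1 hQ).1
    exact_mod_cast ringKrullDim_nonneg_of_nontrivial
  | succ r ih =>
    intro M _ _ _ rs hlen hmem hreg Q hQ
    obtain ⟨hQp, u0, hu0⟩ := isAssociatedPrime_iff.1 hQ
    match rs, hlen, hmem, hreg with
    | [], hlen, _, _ => simp at hlen
    | x :: rs', hlen, hmem, hreg =>
      rw [isWeaklyRegular_cons_iff] at hreg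
      have hxm : x ∈ IsLocalRing.maximalIdeal R := hmem x (by simp)
      let H : Submodule R M :=
        { carrier := {u | ∀ q ∈ Q, q • u = 0}
          add_mem' := fun {a b} ha hb q hq => by rw [smul_add, ha q hq, hb q hq, add_zero]
          zero_mem' := fun q _ => smul_zero q
          smul_mem' := fun c a ha q hq => by rw [smul_comm, ha q hq, smul_zero] }
      have hu0H : u0 ∈ H := by
        intro q hq
        rw [hu0, Submodule.mem_colon_singleton] at hq
        simpa using hq
      have hu00 : u0 ≠ 0 := by
        rintro rfl
        apply hQp.ne_top
        rw [hu0, Ideal.eq_top_iff_one, Submodule.mem_colon_singleton]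
        simp
      have hex : ∃ u ∈ H, u ∉ x • (⊤ : Submodule R M) := by
        by_contra hcon
        push Not at hcon
        have hle : H ≤ (IsLocalRing.maximalIdeal R) • H := by
          intro u hu
          obtain ⟨v, -, rfl⟩ := (Submodule.mem_smul_pointwise_iff_exists _ _ _).1 (hcon u hu)
          refine Submodule.smul_mem_smul hxm ?_
          intro q hq
          have h1 := hu q hq
          rw [smul_comm] at h1
          exact hreg.1 (by simpa using h1)
        have : H = ⊥ := Submodule.eq_bot_of_le_smul_of_le_jacobson_bot _ H
          (IsNoetherian.noetherian H) hle (IsLocalRing.maximalIdeal_le_jacobson _)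
        rw [this] at hu0H
        exact hu00 hu0H
      obtain ⟨u, huH, hux⟩ := hex
      let ub : QuotSMulTop x M := Submodule.Quotient.mk u
      have hub : ub ≠ 0 := by
        intro h; exact hux ((Submodule.Quotient.mk_eq_zero _).1 h)
      obtain ⟨Q', hQ', hle⟩ := exists_le_isAssociatedPrime_of_isNoetherianRing R ub hub
      have hQQ' : Q ≤ Q' := by
        intro q hq
        apply hle
        rw [Submodule.mem_colon_singleton]
        change q • ub = 0
        rw [← Submodule.Quotient.mk_smul, huH q hq, Submodule.Quotient.mk_zero]
      have hxQ' : x ∈ Q' := by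
        apply hle
        rw [Submodule.mem_colon_singleton]
        change x • ub = 0
        rw [← Submodule.Quotient.mk_smul, Submodule.Quotient.mk_eq_zero]
        exact Submodule.smul_mem_pointwise_smul _ _ _ trivial
      have hxQ : x ∉ Q := by
        intro hx
        rw [hu0, Submodule.mem_colon_singleton] at hx
        have hx : x • u0 = 0 := by simpa using hx
        exact hu00 (hreg.1 (by simpa using hx))
      have h1 := ih (QuotSMulTop x M) rs' (by simpa using hlen)
        (fun y hy => hmem y (by simp [hy])) hreg.2 Q' hQ'
      have hxd : Ideal.Quotient.mk Q x ∈ nonZeroDivisors (R ⧸ Q) := by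
        refine mem_nonZeroDivisors_of_ne_zero fun h => hxQ (Ideal.Quotient.eq_zero_iff_mem.1 h)
      have h2 := ringKrullDim_quotient_succ_le_of_nonZeroDivisor hxd
      have h3 : ringKrullDim (R ⧸ Q') ≤
          ringKrullDim ((R ⧸ Q) ⧸ Ideal.span {Ideal.Quotient.mk Q x}) := by
        refine ringKrullDim_le_of_surjective
          (Ideal.Quotient.lift _ (Ideal.Quotient.factor hQQ') ?_)
          (Ideal.Quotient.lift_surjective_of_surjective _ _ (Ideal.Quotient.factor_surjective hQQ'))
        intro a ha
        obtain ⟨b, rfl⟩ := Ideal.mem_span_singleton.1 ha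
        rw [map_mul, Ideal.Quotient.factor_mk, Ideal.Quotient.eq_zero_iff_mem.2 hxQ', zero_mul]
      push_cast
      exact (add_le_add_left (h1.trans h3) 1).trans h2

theorem cm_weaklyRegular {R : Type} [CommRing R] [IsLocalRing R] [IsNoetherianRing R] (r : ℕ) :
    ∀ (M : Type) [AddCommGroup M] [Module R M] [Module.Finite R M] [Nontrivial M] (rs fs : List R)
      (_ : rs.length = r) (_ : ∀ x ∈ rs, x ∈ IsLocalRing.maximalIdeal R)
      (_ : IsWeaklyRegular M rs) (_ : fs.length = r)
      (_ : ∀ x ∈ fs, x ∈ IsLocalRing.maximalIdeal R)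
      (_ : ∀ Q : Ideal R, Q.IsPrime → Module.annihilator R M ≤ Q → (∀ f ∈ fs, f ∈ Q) →
        Q = IsLocalRing.maximalIdeal R), IsWeaklyRegular M fs := by
  classical
  induction r with
  | zero =>
    intro M _ _ _ _ rs fs _ _ _ hlen _ _
    rw [List.length_eq_zero_iff.1 hlen]
    exact IsWeaklyRegular.nil R M
  | succ r ih =>
    intro M _ _ _ _ rs fs hlen hmem hreg hflen hfmem hprime
    match fs, hflen, hfmem, hprime with
    | [], hflen, _, _ => simp at hflen
    | f :: fs', hflen, hfmem, hprime =>
      have hfm : f ∈ IsLocalRing.maximalIdeal R := hfmem f (by simp)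
      have hf : IsSMulRegular M f := by
        by_contra hnr
        have hmemf : f ∈ ⋃ p ∈ associatedPrimes R M, (p : Set R) := by
          rw [biUnion_associatedPrimes_eq_zero_divisors]
          rw [isSMulRegular_iff_right_eq_zero_of_smul] at hnr
          push Not at hnr
          obtain ⟨u, hu, hu0⟩ := hnr
          exact ⟨u, hu0, hu⟩
        simp only [Set.mem_iUnion] at hmemf
        obtain ⟨Q, hQ, hfQ⟩ := hmemf
        have hQ : IsAssociatedPrime Q M := hQ
        have hQp : Q.IsPrime := (isAssociatedPrime_iff.1 hQ).1
        have hann : Module.annihilator R M ≤ Q := by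
          rw [← Submodule.annihilator_top]; exact hQ.annihilator_le
        have h1 := dim_ass_ge (r + 1) M rs hlen hmem hreg Q hQ
        have : IsLocalRing (R ⧸ Q) :=
          IsLocalRing.of_surjective' (Ideal.Quotient.mk Q) Ideal.Quotient.mk_surjective
        let S : Finset (R ⧸ Q) := fs'.toFinset.image (Ideal.Quotient.mk Q)
        have hS : (S : Set (R ⧸ Q)) ⊆ Ring.jacobson (R ⧸ Q) := by
          intro y hy
          rw [IsLocalRing.ringJacobson_eq_maximalIdeal]
          simp only [S, Finset.coe_image, Set.mem_image, Finset.mem_coe, List.mem_toFinset] at hy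
          obtain ⟨y, hy, rfl⟩ := hy
          have hym := hfmem y (by simp [hy])
          have hloc : IsLocalHom (Ideal.Quotient.mk Q) :=
            IsLocalHom.of_surjective _ Ideal.Quotient.mk_surjective
          exact (IsLocalRing.mem_maximalIdeal _).2 fun h =>
            (IsLocalRing.mem_maximalIdeal _).1 hym ((isUnit_map_iff (Ideal.Quotient.mk Q) y).1 h)
        have h2 := ringKrullDim_le_ringKrullDim_quotient_add_card S hS
        have hcard : S.card ≤ r := by
          refine Finset.card_image_le.trans ((List.toFinset_card_le _).trans ?_)
          simpa using hflen.le
        have h3 : ringKrullDim ((R ⧸ Q) ⧸ Ideal.span (S : Set (R ⧸ Q))) ≤ 0 := by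
          have : Ring.KrullDimLE 0 ((R ⧸ Q) ⧸ Ideal.span (S : Set (R ⧸ Q))) := by
            refine Ring.KrullDimLE.mk₀ fun I hI => ?_
            let φ : R →+* ((R ⧸ Q) ⧸ Ideal.span (S : Set (R ⧸ Q))) :=
              (Ideal.Quotient.mk _).comp (Ideal.Quotient.mk Q)
            have hφ : Function.Surjective φ :=
              Ideal.Quotient.mk_surjective.comp Ideal.Quotient.mk_surjective
            have hQφ : ∀ q ∈ Q, φ q = 0 := by
              intro q hq
              change Ideal.Quotient.mk _ (Ideal.Quotient.mk Q q) = 0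
              rw [Ideal.Quotient.eq_zero_iff_mem.2 hq, map_zero]
            have hc : I.comap φ = IsLocalRing.maximalIdeal R := by
              refine hprime _ (Ideal.comap_isPrime _ _) ?_ ?_
              · intro a ha
                rw [Ideal.mem_comap, hQφ a (hann ha)]; exact I.zero_mem
              · intro g hg
                rw [Ideal.mem_comap]
                rcases List.mem_cons.1 hg with rfl | hg
                · rw [hQφ _ hfQ]; exact I.zero_mem
                · have : φ g = 0 := by
                    change Ideal.Quotient.mk _ (Ideal.Quotient.mk Q g) = 0
                    refine Ideal.Quotient.eq_zero_iff_mem.2 (Ideal.subset_span ?_)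
                    simp only [S, Finset.coe_image]
                    exact ⟨g, by simpa using hg, rfl⟩
                  rw [this]; exact I.zero_mem
            have hmax : (I.comap φ).IsMaximal := by rw [hc]; infer_instance
            have := Ideal.map_eq_top_or_isMaximal_of_surjective φ hφ hmax
            rw [Ideal.map_comap_of_surjective φ hφ] at this
            exact this.resolve_left hI.ne_top
          exact (Order.krullDimLE_iff 0 _).1 this
        have h4 : ((r + 1 : ℕ) : WithBot ℕ∞) ≤ (r : WithBot ℕ∞) := by
          refine h1.trans (h2.trans ?_)
          calc _ ≤ (0 : WithBot ℕ∞) + (r : WithBot ℕ∞) := by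
                refine add_le_add h3 ?_
                exact_mod_cast hcard
            _ = _ := zero_add _
        have h5 : r + 1 ≤ r := by exact_mod_cast h4
        omega
      rw [isWeaklyRegular_cons_iff]
      refine ⟨hf, ?_⟩
      have : Nontrivial (QuotSMulTop f M) := nontrivial_quotSMulTop_of_mem_maximalIdeal M hfm
      -- the depth of the quotient
      have hsl : ∀ (N : Type) [AddCommGroup N] [Module R N] [Module.Finite R N] [Nontrivial N],
          (IsLocalRing.maximalIdeal R) • (⊤ : Submodule R N) < ⊤ := by
        intro N _ _ _ _
        refine lt_top_iff_ne_top.2 fun h => ?_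
        have := Submodule.eq_bot_of_le_smul_of_le_jacobson_bot (IsLocalRing.maximalIdeal R)
          (⊤ : Submodule R N) (Module.Finite.fg_top) h.ge (IsLocalRing.maximalIdeal_le_jacobson _)
        exact top_ne_bot this
      let k : ModuleCat.{0} R := ModuleCat.of R (R ⧸ IsLocalRing.maximalIdeal R)
      have hk : Module.Finite R k := inferInstanceAs (Module.Finite R (R ⧸ IsLocalRing.maximalIdeal R))
      have hksupp : Module.support R k = PrimeSpectrum.zeroLocus (IsLocalRing.maximalIdeal R) := by
        change Module.support R (R ⧸ IsLocalRing.maximalIdeal R) = _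
        rw [Module.support_eq_zeroLocus, Ideal.annihilator_quotient]
      have hregM : IsRegular M rs :=
        IsRegular.of_isWeaklyRegular_of_mem_maximalIdeal M hmem hreg
      have hext := ModuleCat.subsingleton_ext_of_exists_isRegular (IsLocalRing.maximalIdeal R) k
        hksupp.subset (ModuleCat.of R M) (hsl M) rs hmem hregM
      have hext' : ∀ i < r, Subsingleton
          (Abelian.Ext k (ModuleCat.of R (QuotSMulTop f M)) i) := by
        intro i hi
        have zero1 := AddCommGrpCat.isZero_of_iff_subsingleton.mpr (hext i (by omega))
        have zero2 := AddCommGrpCat.isZero_of_iff_subsingleton.mpr (hext (i + 1) (by omega))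
        exact AddCommGrpCat.subsingleton_of_isZero <| ShortComplex.Exact.isZero_of_both_zeros
          ((Abelian.Ext.covariant_sequence_exact₃' k
            (IsSMulRegular.smulShortComplex_shortExact (M := ModuleCat.of R M) hf)) i (i + 1) rfl)
          (zero1.eq_zero_of_src _) (zero2.eq_zero_of_tgt _)
      obtain ⟨rs', hl', hm', hr'⟩ := ModuleCat.exists_isRegular_of_exists_subsingleton_ext
        (IsLocalRing.maximalIdeal R) r (ModuleCat.of R (QuotSMulTop f M)) (hsl (QuotSMulTop f M))
        k hksupp hext'
      refine ih (QuotSMulTop f M) rs' fs' hl' hm' hr'.toIsWeaklyRegular (by simpa using hflen)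
        (fun x hx => hfmem x (by simp [hx])) ?_
      intro Q hQ hann hfs
      refine hprime Q hQ ?_ ?_
      · refine le_trans (fun a ha => ?_) hann
        rw [Module.mem_annihilator] at ha ⊢
        intro v
        obtain ⟨v, rfl⟩ := Submodule.Quotient.mk_surjective _ v
        rw [← Submodule.Quotient.mk_smul, ha, Submodule.Quotient.mk_zero]
      · intro g hg
        rcases List.mem_cons.1 hg with rfl | hg
        · apply hann
          rw [Module.mem_annihilator]
          intro v
          obtain ⟨v, rfl⟩ := Submodule.Quotient.mk_surjective _ v
          rw [← Submodule.Quotient.mk_smul, Submodule.Quotient.mk_eq_zero]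
          exact Submodule.smul_mem_pointwise_smul _ _ _ trivial
        · exact hfs g hg

/-- concrete form: the last element of a system of parameters in a local ring with a regular
sequence of the same length is a non-zero-divisor modulo the others -/
theorem cm_nzd {R : Type} [CommRing R] [IsLocalRing R] [IsNoetherianRing R] [Algebra ℂ R]
    (rs : List R) (hm : ∀ x ∈ rs, x ∈ IsLocalRing.maximalIdeal R) (hr : IsWeaklyRegular R rs)
    (gs : List R) (w : R) (hlen : gs.length + 1 = rs.length)
    (hgs : ∀ x ∈ gs, x ∈ IsLocalRing.maximalIdeal R) (hw : w ∈ IsLocalRing.maximalIdeal R)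
    (hfin : Module.Finite ℂ (R ⧸ (Ideal.ofList gs ⊔ Ideal.span {w}))) (a : R)
    (ha : a * w ∈ Ideal.ofList gs) : a ∈ Ideal.ofList gs := by
  have h1 : IsWeaklyRegular R (gs ++ [w]) := by
    refine cm_weaklyRegular rs.length R rs (gs ++ [w]) rfl hm hr (by simpa using hlen) ?_ ?_
    · intro x hx
      rcases List.mem_append.1 hx with hx | hx
      · exact hgs x hx
      · rw [List.mem_singleton.1 hx]; exact hw
    · intro Q hQ _ hQf
      refine prime_eq_max _ Q ?_ hfin
      rw [sup_le_iff]
      refine ⟨Ideal.span_le.2 fun g hg => hQf g (List.mem_append_left _ hg), ?_⟩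
      exact (Ideal.span_singleton_le_iff_mem _).2 (hQf w (by simp))
  rw [isWeaklyRegular_append_iff, isWeaklyRegular_singleton_iff] at h1
  have h2 := h1.2
  rw [isSMulRegular_iff_right_eq_zero_of_smul] at h2
  have h3 := h2 (Submodule.Quotient.mk a) (by
    rw [← Submodule.Quotient.mk_smul, Submodule.Quotient.mk_eq_zero, smul_eq_mul]
    rw [mul_comm] at ha
    simpa using ha)
  rw [Submodule.Quotient.mk_eq_zero] at h3
  simpa using h3

end CM

section RegSeq
variable {σ : Type} [DecidableEq σ]

/-- Substitute the values `a i` for the variables in the list `l`. -/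
def subsL (a : σ → ℂ) (l : List σ) : MvPolynomial σ ℂ →ₐ[ℂ] MvPolynomial σ ℂ :=
  aeval (fun i => if i ∈ l then C (a i) else X i)

lemma subsL_congr (a : σ → ℂ) (l : List σ) (f : MvPolynomial σ ℂ) :
    f - subsL a l f ∈ Ideal.ofList (l.map fun i => X i - C (a i)) := by
  rw [← Ideal.Quotient.eq]
  set I := Ideal.ofList (l.map fun i => (X i - C (a i) : MvPolynomial σ ℂ))
  have h : (Ideal.Quotient.mkₐ ℂ I) = (Ideal.Quotient.mkₐ ℂ I).comp (subsL a l) := by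
    apply MvPolynomial.algHom_ext
    intro i
    simp only [AlgHom.comp_apply, subsL, aeval_X]
    split_ifs with hi
    · simp only [Ideal.Quotient.mkₐ_eq_mk]
      rw [Ideal.Quotient.eq]
      apply Ideal.subset_span
      simp only [Set.mem_setOf_eq, List.mem_map]
      exact ⟨i, hi, rfl⟩
    · rfl
  exact DFunLike.congr_fun h f

lemma mem_ofList_iff_subsL (a : σ → ℂ) (l : List σ) (f : MvPolynomial σ ℂ) :
    f ∈ Ideal.ofList (l.map fun i => X i - C (a i)) ↔ subsL a l f = 0 := by
  constructor
  · intro hf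
    have : Ideal.ofList (l.map fun i => (X i - C (a i) : MvPolynomial σ ℂ)) ≤
        RingHom.ker (subsL a l) := by
      rw [Ideal.ofList, Ideal.span_le]
      intro g hg
      simp only [Set.mem_setOf_eq, List.mem_map] at hg
      obtain ⟨i, hi, rfl⟩ := hg
      simp [RingHom.mem_ker, subsL, hi, MvPolynomial.algebraMap_eq]
    exact this hf
  · intro h
    have := subsL_congr a l f
    rwa [h, sub_zero] at this

lemma X_sub_C_ne (k : σ) (c : ℂ) : (X k - C c : MvPolynomial σ ℂ) ≠ 0 := by
  intro h
  have := congrArg (eval (fun _ => c + 1)) h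
  simp at this

lemma regseq_poly (a : σ → ℂ) (l : List σ) (hl : l.Nodup) :
    RingTheory.Sequence.IsWeaklyRegular (MvPolynomial σ ℂ)
      (l.map fun i => (X i - C (a i) : MvPolynomial σ ℂ)) := by
  constructor
  intro i hi
  have hi' : i < l.length := by simpa using hi
  rw [isSMulRegular_iff_right_eq_zero_of_smul]
  intro x hx
  obtain ⟨f, rfl⟩ := Submodule.mkQ_surjective _ x
  rw [← map_smul, Submodule.mkQ_apply, Submodule.Quotient.mk_eq_zero] at hx
  rw [Submodule.mkQ_apply, Submodule.Quotient.mk_eq_zero]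
  rw [← List.map_take, Ideal.smul_eq_mul, Ideal.mul_top, mem_ofList_iff_subsL] at hx ⊢
  rw [smul_eq_mul, map_mul] at hx
  rcases mul_eq_zero.1 hx with h | h
  · exfalso
    have hk : l[i] ∉ l.take i := by
      intro hmem
      rw [List.mem_take_iff_getElem] at hmem
      obtain ⟨j, hj, hji⟩ := hmem
      have := (List.Nodup.getElem_inj_iff hl).1 hji
      omega
    simp only [List.getElem_map, subsL, map_sub, aeval_X, hk, if_false,
      MvPolynomial.algebraMap_eq, aeval_C] at h
    exact X_sub_C_ne _ _ h
  · exact h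

end RegSeq

lemma regseq_loc {σ : Type} [Fintype σ] (m : Ideal (MvPolynomial σ ℂ)) [m.IsPrime]
    (a : σ → ℂ) (hm : ∀ i, (X i - C (a i) : MvPolynomial σ ℂ) ∈ m) :
    ∃ rs : List (Localization.AtPrime m), rs.length = Fintype.card σ ∧
      (∀ x ∈ rs, x ∈ IsLocalRing.maximalIdeal (Localization.AtPrime m)) ∧
      RingTheory.Sequence.IsWeaklyRegular (Localization.AtPrime m) rs := by
  classical
  refine ⟨((Finset.univ : Finset σ).toList.map
    fun i => (X i - C (a i) : MvPolynomial σ ℂ)).map (algebraMap _ _), ?_, ?_, ?_⟩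
  · simp
  · intro x hx
    simp only [List.map_map, List.mem_map] at hx
    obtain ⟨i, -, rfl⟩ := hx
    exact (IsLocalization.AtPrime.to_map_mem_maximal_iff _ m _).2 (hm i)
  · exact RingTheory.Sequence.IsWeaklyRegular.of_isLocalization _ m.primeCompl
      (regseq_poly a _ (Finset.nodup_toList _))

section FinArc
variable {A : Type} [CommRing A] [Algebra ℂ A] (m : Ideal A) [m.IsPrime]

/-- the point `m` is a `ℂ`-rational point -/
def RatPt (m : Ideal A) : Prop := ∀ a : A, ∃ c : ℂ, a - algebraMap ℂ A c ∈ m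

lemma loc_residue (hm : RatPt m) (x : Localization.AtPrime m) :
    ∃ c : ℂ, x - algebraMap ℂ _ c ∈ IsLocalRing.maximalIdeal (Localization.AtPrime m) := by
  obtain ⟨⟨a, f⟩, hx⟩ := IsLocalization.surj m.primeCompl x
  simp only at hx
  obtain ⟨ca, ha⟩ := hm a
  obtain ⟨cf, hf⟩ := hm f
  have hcf : cf ≠ 0 := by
    rintro rfl
    simp only [map_zero, sub_zero] at hf
    exact f.2 hf
  refine ⟨ca / cf, ?_⟩
  have hu : IsUnit (algebraMap A (Localization.AtPrime m) f) :=
    IsLocalization.map_units _ f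
  rw [← Ideal.mul_unit_mem_iff_mem _ hu, sub_mul, hx,
    IsScalarTower.algebraMap_apply ℂ A (Localization.AtPrime m), ← map_mul, ← map_sub,
    IsLocalization.AtPrime.to_map_mem_maximal_iff _ m]
  have : a - algebraMap ℂ A (ca / cf) * f = (a - algebraMap ℂ A ca)
      - algebraMap ℂ A (ca / cf) * (f - algebraMap ℂ A cf) := by
    rw [mul_sub, ← map_mul, div_mul_cancel₀ _ hcf]; ring
  rw [this]
  exact m.sub_mem ha (m.mul_mem_left _ hf)

lemma max_eq_map : IsLocalRing.maximalIdeal (Localization.AtPrime m) =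
    m.map (algebraMap A (Localization.AtPrime m)) :=
  (Localization.AtPrime.map_eq_maximalIdeal).symm

lemma loc_surj_pow (hm : RatPt m) (k : ℕ) (x : Localization.AtPrime m) :
    ∃ a : A, x - algebraMap A _ a ∈ IsLocalRing.maximalIdeal (Localization.AtPrime m) ^ k := by
  induction k generalizing x with
  | zero => exact ⟨0, by simp [Ideal.one_eq_top]⟩
  | succ k ih =>
    obtain ⟨a, ha⟩ := ih x
    have key : ∀ y ∈ IsLocalRing.maximalIdeal (Localization.AtPrime m) ^ k,
        ∃ a : A, y - algebraMap A _ a ∈ IsLocalRing.maximalIdeal (Localization.AtPrime m) ^ (k+1) := by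
      intro y hy
      rw [max_eq_map, ← Ideal.map_pow, Ideal.map] at hy
      refine Submodule.span_induction ?_ ?_ ?_ ?_ hy
      · rintro _ ⟨b, hb, rfl⟩
        exact ⟨b, by simp⟩
      · exact ⟨0, by simp⟩
      · rintro u v - - ⟨a, ha⟩ ⟨b, hb⟩
        refine ⟨a + b, ?_⟩
        have := Ideal.add_mem _ ha hb
        rw [map_add]; convert this using 1; ring
      · rintro r u hu ⟨b, hb⟩
        obtain ⟨c, hc⟩ := loc_residue m hm r
        refine ⟨algebraMap ℂ A c * b, ?_⟩
        have hu' : u ∈ IsLocalRing.maximalIdeal (Localization.AtPrime m) ^ k := by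
          rw [max_eq_map, ← Ideal.map_pow, Ideal.map]; exact hu
        have h1 := Ideal.mul_mem_mul hu' hc
        rw [← pow_succ] at h1
        have h2 := Ideal.mul_mem_left _ (algebraMap ℂ _ c) hb
        have := Ideal.add_mem _ h1 h2
        rw [map_mul, ← IsScalarTower.algebraMap_apply, smul_eq_mul]
        convert this using 1; ring
    obtain ⟨b, hb⟩ := key _ ha
    refine ⟨a + b, ?_⟩
    rw [map_add]; convert hb using 1; ring

variable [Algebra.FiniteType ℂ A]

lemma finite_quot_pow (hm : RatPt m) (k : ℕ) : Module.Finite ℂ (A ⧸ m ^ k) := by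
  have : Algebra.IsIntegral ℂ (A ⧸ m ^ k) := by
    constructor
    intro x
    obtain ⟨a, rfl⟩ := Ideal.Quotient.mk_surjective x
    obtain ⟨c, hc⟩ := hm a
    have h : IsIntegral ℂ (Ideal.Quotient.mk (m ^ k) (a - algebraMap ℂ A c)) := by
      refine ⟨Polynomial.X ^ k, Polynomial.monic_X_pow k, ?_⟩
      simp only [Polynomial.eval₂_X_pow, ← map_pow]
      exact Ideal.Quotient.eq_zero_iff_mem.2 (Ideal.pow_mem_pow hc k)
    have h2 : IsIntegral ℂ (algebraMap ℂ (A ⧸ m ^ k) c) := isIntegral_algebraMap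
    have := h.add h2
    rw [map_sub, IsScalarTower.algebraMap_apply ℂ A (A ⧸ m ^ k), Ideal.Quotient.algebraMap_eq,
      sub_add_cancel] at this
    exact this
  have : Algebra.FiniteType ℂ (A ⧸ m ^ k) :=
    Algebra.FiniteType.of_surjective (Ideal.Quotient.mkₐ ℂ (m ^ k)) Ideal.Quotient.mk_surjective
  exact Algebra.IsIntegral.finite

lemma finite_of_pow_le (hm : RatPt m) (I : Ideal (Localization.AtPrime m)) (k : ℕ)
    (h : IsLocalRing.maximalIdeal (Localization.AtPrime m) ^ k ≤ I) :
    Module.Finite ℂ (Localization.AtPrime m ⧸ I) := by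
  have := finite_quot_pow m hm k
  let φ : A →ₐ[ℂ] (Localization.AtPrime m ⧸ I) :=
    (Ideal.Quotient.mkₐ ℂ I).comp (IsScalarTower.toAlgHom ℂ A _)
  have hφ : ∀ a ∈ m ^ k, φ a = 0 := by
    intro a ha
    refine Ideal.Quotient.eq_zero_iff_mem.2 (h ?_)
    rw [max_eq_map, ← Ideal.map_pow]
    exact Ideal.mem_map_of_mem _ ha
  refine Module.Finite.of_surjective (Ideal.Quotient.liftₐ (m ^ k) φ hφ).toLinearMap ?_
  intro x
  obtain ⟨x, rfl⟩ := Ideal.Quotient.mk_surjective x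
  obtain ⟨a, ha⟩ := loc_surj_pow m hm k x
  refine ⟨Ideal.Quotient.mk _ a, ?_⟩
  symm
  exact Ideal.Quotient.eq.2 (h ha)

/-- A quotient of the local ring is finite dimensional if all arcs in it are trivial. -/
lemma pow_le_of_arcs (hm : RatPt m) (I : Ideal (Localization.AtPrime m))
    (h : ∀ ψ : Localization.AtPrime m →ₐ[ℂ] PowerSeries ℂ, IsArc ψ → (∀ a ∈ I, ψ a = 0) →
      ∀ v ∈ IsLocalRing.maximalIdeal (Localization.AtPrime m), ψ v = 0) :
    ∃ k, IsLocalRing.maximalIdeal (Localization.AtPrime m) ^ k ≤ I := by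
  have : IsNoetherianRing A := Algebra.FiniteType.isNoetherianRing ℂ A
  have : IsNoetherianRing (Localization.AtPrime m) :=
    IsLocalization.isNoetherianRing m.primeCompl _ inferInstance
  apply Ideal.exists_pow_le_of_le_radical_of_fg _ (Ideal.fg_of_isNoetherianRing _)
  rw [Ideal.radical_eq_sInf]
  apply le_sInf
  rintro Q ⟨hIQ, hQ⟩
  by_contra hne
  let S : Set (Ideal (Localization.AtPrime m)) := {Q' | Q ≤ Q' ∧ Q'.IsPrime ∧
    Q' ≠ IsLocalRing.maximalIdeal (Localization.AtPrime m)}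
  have hS : S.Nonempty := ⟨Q, le_rfl, hQ, fun h => hne h.ge⟩
  obtain ⟨Q', ⟨hQQ', hQ', hQ'm⟩, hmax⟩ := set_has_maximal_iff_noetherian.2 this S hS
  have hlt : Q' ≤ IsLocalRing.maximalIdeal (Localization.AtPrime m) :=
    IsLocalRing.le_maximalIdeal hQ'.ne_top
  obtain ⟨w, hw, hwQ⟩ := SetLike.exists_of_lt (lt_of_le_of_ne hlt hQ'm)
  have hrad : IsLocalRing.maximalIdeal (Localization.AtPrime m) ≤
      Ideal.radical (Q' ⊔ Ideal.span {w}) := by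
    rw [Ideal.radical_eq_sInf]
    apply le_sInf
    rintro R ⟨hR, hRp⟩
    by_contra hc
    refine hmax R ⟨hQQ'.trans (le_sup_left.trans hR), hRp, fun h => hc h.ge⟩ ?_
    refine lt_of_le_of_ne (le_sup_left.trans hR) ?_
    rintro rfl
    exact hwQ (hR (Ideal.mem_sup_right (Ideal.mem_span_singleton_self w)))
  obtain ⟨k, hk⟩ := Ideal.exists_pow_le_of_le_radical_of_fg hrad (Ideal.fg_of_isNoetherianRing _)
  obtain ⟨ψ, hψ, hker⟩ := exists_arc m Q' w hw hwQ (finite_of_pow_le m hm _ k hk)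
  exact hwQ ((hker w).1 (h ψ hψ (fun a ha => (hker a).2 (hQQ' (hIQ ha))) w hw))

lemma finite_of_arcs (hm : RatPt m) (I : Ideal (Localization.AtPrime m))
    (h : ∀ ψ : Localization.AtPrime m →ₐ[ℂ] PowerSeries ℂ, IsArc ψ → (∀ a ∈ I, ψ a = 0) →
      ∀ v ∈ IsLocalRing.maximalIdeal (Localization.AtPrime m), ψ v = 0) :
    Module.Finite ℂ (Localization.AtPrime m ⧸ I) := by
  obtain ⟨k, hk⟩ := pow_le_of_arcs m hm I h
  exact finite_of_pow_le m hm I k hk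

/-- for a finite dimensional quotient, a power of the maximal ideal is contained in the ideal. -/
lemma pow_le_of_finite (I : Ideal (Localization.AtPrime m))
    (hf : Module.Finite ℂ (Localization.AtPrime m ⧸ I)) :
    ∃ k, IsLocalRing.maximalIdeal (Localization.AtPrime m) ^ k ≤ I := by
  have : IsNoetherianRing A := Algebra.FiniteType.isNoetherianRing ℂ A
  have : IsNoetherianRing (Localization.AtPrime m) :=
    IsLocalization.isNoetherianRing m.primeCompl _ inferInstance
  apply Ideal.exists_pow_le_of_le_radical_of_fg _ (Ideal.fg_of_isNoetherianRing _)
  rw [Ideal.radical_eq_sInf]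
  apply le_sInf
  rintro Q ⟨hIQ, hQ⟩
  exact (prime_eq_max I Q hIQ hf).ge

/-- for a finite dimensional quotient, `A` surjects. -/
lemma loc_surj_of_finite (hm : RatPt m) (I : Ideal (Localization.AtPrime m))
    (hf : Module.Finite ℂ (Localization.AtPrime m ⧸ I)) (x : Localization.AtPrime m) :
    ∃ a : A, x - algebraMap A _ a ∈ I := by
  obtain ⟨k, hk⟩ := pow_le_of_finite m I hf
  obtain ⟨a, ha⟩ := loc_surj_pow m hm k x
  exact ⟨a, hk ha⟩

end FinArc

lemma tf_of_linear {W : Type*} [AddCommGroup W] [Module (Polynomial ℂ) W]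
    (h : ∀ (c : ℂ) (w : W), (Polynomial.X - Polynomial.C c) • w = 0 → w = 0) :
    Module.IsTorsionFree (Polynomial ℂ) W := by
  apply Module.IsTorsionFree.of_smul_eq_zero
  intro f w hfw
  by_cases hf : f = 0
  · exact Or.inl hf
  right
  have hs := (IsAlgClosed.splits f).eq_prod_roots
  rw [hs, mul_smul] at hfw
  have hC : ∀ (a : ℂ) (v : W), a ≠ 0 → Polynomial.C a • v = 0 → v = 0 := by
    intro a v ha hv
    have := congrArg (fun u => Polynomial.C a⁻¹ • u) hv
    simpa [← mul_smul, ← Polynomial.C_mul, inv_mul_cancel₀ ha] using this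
  have h1 := hC _ _ (Polynomial.leadingCoeff_ne_zero.2 hf) hfw
  revert h1
  generalize f.roots = R
  induction R using Multiset.induction_on with
  | empty => simp
  | cons a s ih =>
    intro h1
    rw [Multiset.map_cons, Multiset.prod_cons, mul_smul] at h1
    exact ih (h a _ h1)

/-- The dimension of the fibres of a finite torsion free `ℂ[t]`-module is constant. -/
lemma fibre_dim_const {W : Type*} [AddCommGroup W] [Module ℂ W] [Module (Polynomial ℂ) W]
    [IsScalarTower ℂ (Polynomial ℂ) W] [Module.Finite (Polynomial ℂ) W]
    (h : ∀ (c : ℂ) (w : W), (Polynomial.X - Polynomial.C c) • w = 0 → w = 0) :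
    ∃ r : ℕ, ∀ (c : ℂ) (V : Type) [AddCommGroup V] [Module ℂ V] (φ : W →ₗ[ℂ] V),
      Function.Surjective φ →
      (∀ w, φ w = 0 ↔ ∃ w' : W, w = (Polynomial.X - Polynomial.C c) • w') →
      Module.Finite ℂ V ∧ Module.finrank ℂ V = r := by
  have := tf_of_linear h
  have hfree : Module.Free (Polynomial ℂ) W := inferInstance
  obtain ⟨r, b⟩ := Module.Free.exists_basis (R := Polynomial ℂ) (M := W)
  have : Finite r := Module.Finite.finite_basis b
  have : Fintype r := Fintype.ofFinite r
  refine ⟨Fintype.card r, ?_⟩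
  intro c V _ _ φ hφ hker
  let e : W →ₗ[ℂ] (r → ℂ) :=
    { toFun := fun w i => (b.repr w i).eval c
      map_add' := fun u v => by ext i; simp
      map_smul' := fun a v => by
        ext i
        rw [← algebraMap_smul (Polynomial ℂ) a v]
        simp }
  have he : Function.Surjective e := by
    intro v
    refine ⟨b.repr.symm (Finsupp.equivFunOnFinite.symm fun i => Polynomial.C (v i)), ?_⟩
    ext i
    simp [e]
  have hk : LinearMap.ker φ = LinearMap.ker e := by
    ext w
    rw [LinearMap.mem_ker, LinearMap.mem_ker, hker]
    constructor
    · rintro ⟨w', rfl⟩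
      ext i
      simp [e]
    · intro hw
      have hdvd : ∀ i, ∃ q, b.repr w i = (Polynomial.X - Polynomial.C c) * q := by
        intro i
        exact Polynomial.dvd_iff_isRoot.2 (congrFun hw i)
      choose q hq using hdvd
      refine ⟨b.repr.symm (Finsupp.equivFunOnFinite.symm q), ?_⟩
      apply b.repr.injective
      ext1 i
      simp [hq]
  let eqv : V ≃ₗ[ℂ] (r → ℂ) :=
    (φ.quotKerEquivOfSurjective hφ).symm.trans
      ((Submodule.quotEquivOfEq _ _ hk).trans (e.quotKerEquivOfSurjective he))
  refine ⟨Module.Finite.equiv eqv.symm, ?_⟩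
  rw [eqv.finrank_eq]
  simp

section LamAlg

lemma finite_over_poly {B : Type*} [CommRing B] [Algebra ℂ B] [Algebra.FiniteType ℂ B]
    [Algebra (Polynomial ℂ) B] [IsScalarTower ℂ (Polynomial ℂ) B] (P0 : Ideal B)
    (hP : ∀ b : B, ∃ f : Polynomial ℂ, b - algebraMap _ B f ∈ P0) (k : ℕ) :
    Module.Finite (Polynomial ℂ) (B ⧸ P0 ^ k) := by
  have : Algebra.FiniteType (Polynomial ℂ) B :=
    Algebra.FiniteType.of_restrictScalars_finiteType ℂ (Polynomial ℂ) B
  have : Algebra.FiniteType (Polynomial ℂ) (B ⧸ P0 ^ k) :=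
    Algebra.FiniteType.of_surjective (Ideal.Quotient.mkₐ (Polynomial ℂ) (P0 ^ k))
      Ideal.Quotient.mk_surjective
  have : Algebra.IsIntegral (Polynomial ℂ) (B ⧸ P0 ^ k) := by
    constructor
    intro x
    obtain ⟨a, rfl⟩ := Ideal.Quotient.mk_surjective x
    obtain ⟨c, hc⟩ := hP a
    have h : IsIntegral (Polynomial ℂ) (Ideal.Quotient.mk (P0 ^ k) (a - algebraMap _ B c)) := by
      refine ⟨Polynomial.X ^ k, Polynomial.monic_X_pow k, ?_⟩
      simp only [Polynomial.eval₂_X_pow, ← map_pow]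
      exact Ideal.Quotient.eq_zero_iff_mem.2 (Ideal.pow_mem_pow hc k)
    have h2 : IsIntegral (Polynomial ℂ) (algebraMap (Polynomial ℂ) (B ⧸ P0 ^ k) c) :=
      isIntegral_algebraMap
    have := h.add h2
    rw [map_sub, IsScalarTower.algebraMap_apply (Polynomial ℂ) B (B ⧸ P0 ^ k),
      Ideal.Quotient.algebraMap_eq, sub_add_cancel] at this
    exact this
  exact Algebra.IsIntegral.finite

lemma W_finite {B : Type*} [CommRing B] [Algebra ℂ B] [Algebra.FiniteType ℂ B]
    [Algebra (Polynomial ℂ) B] [IsScalarTower ℂ (Polynomial ℂ) B] (P0 : Ideal B)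
    (hP : ∀ b : B, ∃ f : Polynomial ℂ, b - algebraMap _ B f ∈ P0) (W : Ideal B) (k : ℕ)
    (hW : ∀ b ∈ W, ∀ x ∈ P0 ^ k, x * b = 0) : Module.Finite (Polynomial ℂ) W := by
  have := finite_over_poly P0 hP k
  have hN : IsNoetherianRing B := Algebra.FiniteType.isNoetherianRing ℂ B
  have hT : Module.IsTorsionBySet B W (P0 ^ k : Ideal B) := by
    rintro ⟨b, hb⟩ ⟨x, hx⟩
    exact Subtype.ext (hW b hb x hx)
  letI := hT.module
  haveI : IsScalarTower B (B ⧸ P0 ^ k) W := hT.isScalarTower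
  haveI : IsScalarTower (Polynomial ℂ) (B ⧸ P0 ^ k) W := hT.isScalarTower
  have : Module.Finite B W := inferInstance
  have : Module.Finite (B ⧸ P0 ^ k) W := Module.Finite.of_restrictScalars_finite B _ W
  exact Module.Finite.trans (B ⧸ P0 ^ k) W

variable {A : Type} [CommRing A] [Algebra ℂ A]

lemma RatPt.isMaximal {m : Ideal A} [hp : m.IsPrime] (hm : RatPt m) : m.IsMaximal := by
  rw [Ideal.isMaximal_iff]
  refine ⟨fun h => hp.ne_top ((Ideal.eq_top_iff_one _).2 h), ?_⟩
  intro J x hJ hx hxJ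
  obtain ⟨c, hc⟩ := hm x
  have hcJ : algebraMap ℂ A c ∈ J := by
    have := J.sub_mem hxJ (hJ hc)
    simpa using this
  have hc0 : c ≠ 0 := by
    rintro rfl
    simp at hc
    exact hx hc
  have := J.mul_mem_left (algebraMap ℂ A c⁻¹) hcJ
  rwa [← map_mul, inv_mul_cancel₀ hc0, map_one] at this

/-- Saturation of `I` with respect to `P0`. -/
def satI (I P0 : Ideal A) : Ideal A where
  carrier := {a | ∃ k, ∀ x ∈ P0 ^ k, x * a ∈ I}
  zero_mem' := ⟨0, fun x _ => by simp⟩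
  add_mem' := by
    rintro a b ⟨k, hk⟩ ⟨l, hl⟩
    refine ⟨max k l, fun x hx => ?_⟩
    rw [mul_add]
    exact I.add_mem (hk x (Ideal.pow_le_pow_right (le_max_left _ _) hx))
      (hl x (Ideal.pow_le_pow_right (le_max_right _ _) hx))
  smul_mem' := by
    rintro c a ⟨k, hk⟩
    refine ⟨k, fun x hx => ?_⟩
    have := I.mul_mem_left c (hk x hx)
    rw [smul_eq_mul]
    convert this using 1; ring

lemma mem_satI {I P0 : Ideal A} {a : A} :
    a ∈ satI I P0 ↔ ∃ k, ∀ x ∈ P0 ^ k, x * a ∈ I := Iff.rfl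

lemma le_satI (I P0 : Ideal A) : I ≤ satI I P0 := fun a ha =>
  ⟨0, fun x _ => I.mul_mem_left _ ha⟩

lemma satI_uniform [IsNoetherianRing A] (I P0 : Ideal A) :
    ∃ k, ∀ a ∈ satI I P0, ∀ x ∈ P0 ^ k, x * a ∈ I := by
  obtain ⟨S, hS⟩ := (satI I P0).fg_of_isNoetherianRing
  have h : ∀ a : A, ∃ k, a ∈ S → ∀ x ∈ P0 ^ k, x * a ∈ I := by
    intro a
    by_cases ha : a ∈ S
    · obtain ⟨k, hk⟩ := mem_satI.1 (hS ▸ Ideal.subset_span ha : a ∈ satI I P0)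
      exact ⟨k, fun _ => hk⟩
    · exact ⟨0, fun h => absurd h ha⟩
  choose k hk using h
  refine ⟨S.sup k, fun a ha x hx => ?_⟩
  rw [← hS] at ha
  refine Submodule.span_induction ?_ ?_ ?_ ?_ ha
  · intro b hb
    exact hk b hb x (Ideal.pow_le_pow_right (Finset.le_sup hb) hx)
  · simp
  · intro u v _ _ h1 h2
    rw [mul_add]; exact I.add_mem h1 h2
  · intro r u _ h1
    have := I.mul_mem_left r h1
    rw [smul_eq_mul]; convert this using 1; ring

lemma mem_of_colon {m P0 : Ideal A} {τ : A} (hmax : m.IsMaximal)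
    (hm : m = P0 ⊔ Ideal.span {τ}) (N : Ideal A) (a h : A) (hh : h ∉ m) (ha : h * a ∈ N)
    (k : ℕ) (hk : ∀ x ∈ P0 ^ k, x * a ∈ N) (hτ : τ * a ∈ N) : a ∈ N := by
  by_contra hcon
  have hne : colE N a ≠ ⊤ := by
    intro h
    apply hcon
    have := (Ideal.eq_top_iff_one _).1 h
    rw [mem_colE] at this
    simpa using this
  obtain ⟨n, hn, hle⟩ := Ideal.exists_le_maximal _ hne
  have h1 : P0 ≤ n := by
    have : P0 ^ k ≤ n := fun x hx => hle ((mem_colE _ _ _).2 (hk x hx))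
    exact hn.isPrime.le_of_pow_le this
  have h2 : τ ∈ n := hle ((mem_colE _ _ _).2 hτ)
  have h3 : m ≤ n := by
    rw [hm]
    exact sup_le h1 ((Ideal.span_singleton_le_iff_mem _).2 h2)
  rw [hmax.eq_of_le hn.ne_top h3] at hh
  exact hh (hle ((mem_colE _ _ _).2 ha))

lemma satI_loc [IsNoetherianRing A] (m : Ideal A) [m.IsPrime] (I P0 : Ideal A) (k : ℕ)
    (y : Localization.AtPrime m)
    (hy : ∀ x ∈ P0 ^ k, algebraMap A _ x * y ∈ I.map (algebraMap A (Localization.AtPrime m))) :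
    y ∈ (satI I P0).map (algebraMap A (Localization.AtPrime m)) := by
  obtain ⟨⟨a, f⟩, hx⟩ := IsLocalization.surj m.primeCompl y
  simp only at hx
  have hu : IsUnit (algebraMap A (Localization.AtPrime m) f) :=
    IsLocalization.map_units _ f
  rw [← Ideal.mul_unit_mem_iff_mem _ hu, hx,
    IsLocalization.algebraMap_mem_map_algebraMap_iff m.primeCompl]
  obtain ⟨S, hS⟩ := (P0 ^ k).fg_of_isNoetherianRing
  have hx' : ∀ x : A, ∃ g ∈ m.primeCompl, x ∈ S → g * (x * a) ∈ I := by
    intro x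
    by_cases hxS : x ∈ S
    · have h1 := hy x (hS ▸ Ideal.subset_span hxS)
      have h2 := Ideal.mul_mem_right (algebraMap A _ f) _ h1
      rw [mul_assoc, hx, ← map_mul,
        IsLocalization.algebraMap_mem_map_algebraMap_iff m.primeCompl] at h2
      obtain ⟨g, hg, h⟩ := h2
      exact ⟨g, hg, fun _ => h⟩
    · exact ⟨1, m.primeCompl.one_mem, fun h => absurd h hxS⟩
  choose g hg hgI using hx'
  refine ⟨∏ x ∈ S, g x, m.primeCompl.prod_mem fun x _ => hg x, k, fun x hx => ?_⟩
  rw [← hS] at hx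
  refine Submodule.span_induction ?_ ?_ ?_ ?_ hx
  · intro b hb
    obtain ⟨c, hc⟩ := Finset.dvd_prod_of_mem g hb
    have := I.mul_mem_left c (hgI b hb)
    rw [hc]; convert this using 1; ring
  · simp
  · intro u v _ _ h1 h2
    rw [add_mul]; exact I.add_mem h1 h2
  · intro r u _ h1
    have := I.mul_mem_left r h1
    rw [smul_eq_mul]; convert this using 1; ring

lemma satI_nzd [IsNoetherianRing A] (m : Ideal A) [m.IsPrime] (I P0 : Ideal A)
    (τ : Localization.AtPrime m)
    (hnz : ∀ a, a * τ ∈ I.map (algebraMap A (Localization.AtPrime m)) →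
      a ∈ I.map (algebraMap A (Localization.AtPrime m)))
    (y : Localization.AtPrime m)
    (hy : y * τ ∈ (satI I P0).map (algebraMap A (Localization.AtPrime m))) :
    y ∈ (satI I P0).map (algebraMap A (Localization.AtPrime m)) := by
  obtain ⟨k, hk⟩ := satI_uniform I P0
  apply satI_loc m I P0 k
  intro x hx
  apply hnz
  rw [mul_assoc]
  revert hy
  generalize y * τ = z
  intro hz
  refine Submodule.span_induction ?_ ?_ ?_ ?_ hz
  · rintro _ ⟨b, hb, rfl⟩
    rw [← map_mul]
    exact Ideal.mem_map_of_mem _ (hk b hb x hx)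
  · simp
  · intro u v _ _ h1 h2
    rw [mul_add]; exact Ideal.add_mem _ h1 h2
  · intro r u _ h1
    have := Ideal.mul_mem_left _ r h1
    rw [smul_eq_mul]; convert this using 1; ring

end LamAlg

lemma mem_span_mul_aux {R : Type*} [CommRing R] (x o : R) (K : Ideal R) (h : o ∈ K) :
    o * x ∈ Ideal.span {x} * K := by
  rw [mul_comm o x]
  exact Ideal.mul_mem_mul (Ideal.mem_span_singleton_self _) h

lemma lam_ker {A : Type} [CommRing A] [Algebra ℂ A] [IsNoetherianRing A] (m : Ideal A) [m.IsPrime]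
    (hmax : m.IsMaximal) (I P0 : Ideal A) (τ : A) (hm : m = P0 ⊔ Ideal.span {τ})
    (k : ℕ) (hk : ∀ a ∈ satI I P0, ∀ x ∈ P0 ^ k, x * a ∈ I)
    (hnz : ∀ a : Localization.AtPrime m,
      a * algebraMap A _ τ ∈ I.map (algebraMap A (Localization.AtPrime m)) →
      a ∈ I.map (algebraMap A (Localization.AtPrime m)))
    (a : A) (ha : a ∈ satI I P0)
    (h : algebraMap A (Localization.AtPrime m) a ∈ I.map (algebraMap A (Localization.AtPrime m)) ⊔
      Ideal.span {algebraMap A (Localization.AtPrime m) τ}) :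
    ∃ b ∈ satI I P0, a - τ * b ∈ I := by
  obtain ⟨i, hi, o, ho, hio⟩ := Submodule.mem_sup.1 h
  obtain ⟨o, rfl⟩ := Ideal.mem_span_singleton'.1 ho
  have ho2 : o * algebraMap A (Localization.AtPrime m) τ ∈
      (satI I P0).map (algebraMap A (Localization.AtPrime m)) := by
    have : o * algebraMap A (Localization.AtPrime m) τ = algebraMap A _ a - i := by
      rw [← hio]; ring
    rw [this]
    exact Ideal.sub_mem _ (Ideal.mem_map_of_mem _ ha) (Ideal.map_mono (le_satI I P0) hi)
  have ho3 := satI_nzd m I P0 (algebraMap A _ τ) hnz o ho2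
  have hmem : algebraMap A (Localization.AtPrime m) a ∈
      (I ⊔ Ideal.span {τ} * satI I P0).map (algebraMap A (Localization.AtPrime m)) := by
    rw [Ideal.map_sup, Ideal.map_mul, Ideal.map_span, Set.image_singleton, ← hio]
    have h3 : o * algebraMap A (Localization.AtPrime m) τ ∈
        Ideal.span {algebraMap A (Localization.AtPrime m) τ} *
        (satI I P0).map (algebraMap A (Localization.AtPrime m)) := by
      exact mem_span_mul_aux _ _ _ ho3
    exact Submodule.add_mem_sup hi h3
  rw [IsLocalization.algebraMap_mem_map_algebraMap_iff m.primeCompl] at hmem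
  obtain ⟨g, hg, hga⟩ := hmem
  have := mem_of_colon hmax hm _ a g hg hga k
    (fun x hx => Ideal.mem_sup_left (hk a ha x hx))
    (Ideal.mem_sup_right (Ideal.mul_mem_mul (Ideal.mem_span_singleton_self _) ha))
  obtain ⟨i, hi, j, hj, hij⟩ := Submodule.mem_sup.1 this
  obtain ⟨b, hb, rfl⟩ := Ideal.mem_span_singleton_mul.1 hj
  refine ⟨b, hb, ?_⟩
  rw [← hij]
  simpa using hi

set_option maxHeartbeats 1600000 in
/-- Constancy of the "vertical" contribution. -/
theorem lam_alg {A : Type} [CommRing A] [Algebra ℂ A] [Algebra.FiniteType ℂ A]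
    (I P0 : Ideal A) (t : A) (m : ℂ → Ideal A) [∀ c, (m c).IsPrime]
    (hrat : ∀ c, RatPt (m c)) (hm : ∀ c, m c = P0 ⊔ Ideal.span {t - algebraMap ℂ A c})
    (hP : ∀ a : A, ∃ f : Polynomial ℂ, a - Polynomial.aeval t f ∈ P0)
    (hnz : ∀ c, ∀ a : Localization.AtPrime (m c),
      a * algebraMap A _ (t - algebraMap ℂ A c) ∈ I.map (algebraMap A (Localization.AtPrime (m c))) →
      a ∈ I.map (algebraMap A (Localization.AtPrime (m c))))
    (hfin : ∀ c, Module.Finite ℂ (Localization.AtPrime (m c) ⧸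
      (I.map (algebraMap A (Localization.AtPrime (m c))) ⊔
        Ideal.span {algebraMap A (Localization.AtPrime (m c)) (t - algebraMap ℂ A c)}))) :
    ∃ r : ℕ, ∀ c, Module.finrank ℂ (Localization.AtPrime (m c) ⧸
      (I.map (algebraMap A (Localization.AtPrime (m c))) ⊔
        Ideal.span {algebraMap A (Localization.AtPrime (m c)) (t - algebraMap ℂ A c)})) =
      r + Module.finrank ℂ (Localization.AtPrime (m c) ⧸
      ((satI I P0).map (algebraMap A (Localization.AtPrime (m c))) ⊔
        Ideal.span {algebraMap A (Localization.AtPrime (m c)) (t - algebraMap ℂ A c)})) := by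
  have hN : IsNoetherianRing A := Algebra.FiniteType.isNoetherianRing ℂ A
  obtain ⟨k, hk⟩ := satI_uniform I P0
  letI alg : Algebra (Polynomial ℂ) (A ⧸ I) :=
    (Polynomial.aeval (R := ℂ) (Ideal.Quotient.mk I t)).toRingHom.toAlgebra
  have halg : ∀ f : Polynomial ℂ, algebraMap (Polynomial ℂ) (A ⧸ I) f =
      Ideal.Quotient.mk I (Polynomial.aeval t f) := by
    intro f
    change Polynomial.aeval (Ideal.Quotient.mkₐ ℂ I t) f = Ideal.Quotient.mkₐ ℂ I _
    rw [Polynomial.aeval_algHom_apply]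
  haveI : IsScalarTower ℂ (Polynomial ℂ) (A ⧸ I) := by
    apply IsScalarTower.of_algebraMap_eq
    intro c
    rw [halg, Polynomial.algebraMap_apply, Algebra.algebraMap_self, RingHom.id_apply,
      Polynomial.aeval_C]
    rfl
  have : Algebra.FiniteType ℂ (A ⧸ I) :=
    Algebra.FiniteType.of_surjective (Ideal.Quotient.mkₐ ℂ I) Ideal.Quotient.mk_surjective
  let W : Ideal (A ⧸ I) := (satI I P0).map (Ideal.Quotient.mk I)
  have hWmem : ∀ w ∈ W, ∃ a ∈ satI I P0, Ideal.Quotient.mk I a = w := fun w hw =>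
    (Ideal.mem_map_iff_of_surjective _ Ideal.Quotient.mk_surjective).1 hw
  have hWfin : Module.Finite (Polynomial ℂ) W := by
    refine W_finite (P0.map (Ideal.Quotient.mk I)) ?_ W k ?_
    · intro b
      obtain ⟨a, rfl⟩ := Ideal.Quotient.mk_surjective b
      obtain ⟨f, hf⟩ := hP a
      refine ⟨f, ?_⟩
      rw [halg, ← map_sub]
      exact Ideal.mem_map_of_mem _ hf
    · intro b hb x hx
      obtain ⟨a, ha, rfl⟩ := hWmem b hb
      rw [← Ideal.map_pow] at hx
      obtain ⟨x', hx', rfl⟩ := (Ideal.mem_map_iff_of_surjective _ Ideal.Quotient.mk_surjective).1 hx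
      rw [← map_mul]
      exact Ideal.Quotient.eq_zero_iff_mem.2 (hk a ha x' hx')
  have hsm : ∀ (c : ℂ) (a : A), (Polynomial.X - Polynomial.C c) • (Ideal.Quotient.mk I a) =
      Ideal.Quotient.mk I ((t - algebraMap ℂ A c) * a) := by
    intro c a
    rw [Algebra.smul_def, halg, ← map_mul]
    simp
  have htf : ∀ (c : ℂ) (w : W), (Polynomial.X - Polynomial.C c) • w = 0 → w = 0 := by
    rintro c ⟨w, hw⟩ h
    obtain ⟨a, ha, rfl⟩ := hWmem w hw
    have h' : (Polynomial.X - Polynomial.C c) • (Ideal.Quotient.mk I a) = 0 :=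
      congrArg Subtype.val h
    rw [hsm, Ideal.Quotient.eq_zero_iff_mem] at h'
    apply Subtype.ext
    change Ideal.Quotient.mk I a = 0
    rw [Ideal.Quotient.eq_zero_iff_mem]
    have h1 := hnz c (algebraMap A _ a) (by
      rw [← map_mul, mul_comm]; exact Ideal.mem_map_of_mem _ h')
    rw [IsLocalization.algebraMap_mem_map_algebraMap_iff (m c).primeCompl] at h1
    obtain ⟨g, hg, hga⟩ := h1
    exact mem_of_colon (hrat c).isMaximal (hm c) I a g hg hga k (hk a ha) h'
  obtain ⟨r, hr⟩ := fibre_dim_const htf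
  refine ⟨r, fun c => ?_⟩
  set O := Localization.AtPrime (m c)
  set τ : A := t - algebraMap ℂ A c with hτ
  set I1 := I.map (algebraMap A O) with hI1
  set I2 := (satI I P0).map (algebraMap A O) with hI2
  set T : Ideal O := Ideal.span {algebraMap A O τ} with hT
  have h12 : I1 ⊔ T ≤ I2 ⊔ T := sup_le_sup_right (Ideal.map_mono (le_satI I P0)) T
  let F : (O ⧸ (I1 ⊔ T)) →ₐ[ℂ] (O ⧸ (I2 ⊔ T)) := Ideal.Quotient.factorₐ ℂ h12
  have hF : Function.Surjective F := Ideal.Quotient.factor_surjective h12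
  let V := LinearMap.ker F.toLinearMap
  have hVmem : ∀ v, v ∈ V ↔ F v = 0 := fun v => LinearMap.mem_ker
  let Φ : (A ⧸ I) →ₐ[ℂ] (O ⧸ (I1 ⊔ T)) := Ideal.Quotient.liftₐ I
    ((Ideal.Quotient.mkₐ ℂ (I1 ⊔ T)).comp (IsScalarTower.toAlgHom ℂ A O)) (by
      intro a ha
      exact Ideal.Quotient.eq_zero_iff_mem.2 (Ideal.mem_sup_left (Ideal.mem_map_of_mem _ ha)))
  have hΦ : ∀ a : A, Φ (Ideal.Quotient.mk I a) = Ideal.Quotient.mk (I1 ⊔ T) (algebraMap A O a) :=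
    fun a => rfl
  have hFm : ∀ x : O, F (Ideal.Quotient.mk (I1 ⊔ T) x) = Ideal.Quotient.mk (I2 ⊔ T) x :=
    fun a => rfl
  have hΦV : ∀ w ∈ W, Φ w ∈ V := by
    intro w hw
    obtain ⟨a, ha, rfl⟩ := hWmem w hw
    rw [hVmem, hΦ, hFm, Ideal.Quotient.eq_zero_iff_mem]
    exact Ideal.mem_sup_left (Ideal.mem_map_of_mem _ ha)
  let φ : W →ₗ[ℂ] V :=
    { toFun := fun w => ⟨Φ w.1, hΦV w.1 w.2⟩
      map_add' := fun u v => Subtype.ext (by simp)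
      map_smul' := fun a v => Subtype.ext (by
        change Φ (a • v.1) = a • Φ v.1
        exact map_smul Φ a v.1) }
  have hφs : Function.Surjective φ := by
    rintro ⟨v, hv⟩
    obtain ⟨x, rfl⟩ := Ideal.Quotient.mk_surjective v
    have hx : x ∈ I2 ⊔ T := by
      rwa [hVmem, hFm, Ideal.Quotient.eq_zero_iff_mem] at hv
    obtain ⟨i, hi, o, ho, rfl⟩ := Submodule.mem_sup.1 hx
    rw [hI2, IsLocalization.mem_map_algebraMap_iff (m c).primeCompl] at hi
    obtain ⟨⟨⟨a, ha⟩, f⟩, hif⟩ := hi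
    simp only at hif
    have hu : IsUnit (algebraMap A O f) := IsLocalization.map_units _ f
    obtain ⟨u, hu⟩ := hu
    obtain ⟨g, hg⟩ := loc_surj_of_finite (m c) (hrat c) (I1 ⊔ T) (hfin c) ((u⁻¹ : Oˣ) : O)
    refine ⟨⟨Ideal.Quotient.mk I (a * g), Ideal.mem_map_of_mem _ (Ideal.mul_mem_right _ _ ha)⟩, ?_⟩
    apply Subtype.ext
    change Φ _ = _
    rw [hΦ, eq_comm, Ideal.Quotient.eq, map_mul]
    have h1 : i = algebraMap A O a * ((u⁻¹ : Oˣ) : O) := by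
      rw [← hif, ← hu, mul_assoc, Units.mul_inv, mul_one]
    have : i + o - algebraMap A O a * algebraMap A O g =
        algebraMap A O a * (((u⁻¹ : Oˣ) : O) - algebraMap A O g) + o := by
      rw [h1]; ring
    rw [this]
    exact Ideal.add_mem _ (Ideal.mul_mem_left _ _ hg) (Ideal.mem_sup_right ho)
  have hφk : ∀ w, φ w = 0 ↔ ∃ w' : W, w = (Polynomial.X - Polynomial.C c) • w' := by
    rintro ⟨w, hw⟩
    obtain ⟨a, ha, rfl⟩ := hWmem w hw
    have e1 : φ ⟨Ideal.Quotient.mk I a, hw⟩ = 0 ↔ algebraMap A O a ∈ I1 ⊔ T := by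
      rw [← Ideal.Quotient.eq_zero_iff_mem, ← hΦ]
      exact Subtype.ext_iff
    rw [e1]
    constructor
    · intro h
      obtain ⟨b, hb, hab⟩ := lam_ker (m c) (hrat c).isMaximal I P0 τ (hm c) k hk (hnz c) a ha h
      refine ⟨⟨Ideal.Quotient.mk I b, Ideal.mem_map_of_mem _ hb⟩, Subtype.ext ?_⟩
      change Ideal.Quotient.mk I a = (Polynomial.X - Polynomial.C c) • (Ideal.Quotient.mk I b)
      rw [hsm, Ideal.Quotient.eq]
      exact hab
    · rintro ⟨⟨w', hw'⟩, h⟩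
      obtain ⟨b, hb, rfl⟩ := hWmem w' hw'
      have h' : Ideal.Quotient.mk I a =
        (Polynomial.X - Polynomial.C c) • (Ideal.Quotient.mk I b) := congrArg Subtype.val h
      rw [hsm, Ideal.Quotient.eq] at h'
      have : algebraMap A O a = algebraMap A O (a - τ * b) +
          algebraMap A O τ * algebraMap A O b := by
        rw [map_sub, map_mul]; ring
      rw [this]
      exact Ideal.add_mem _ (Ideal.mem_sup_left (Ideal.mem_map_of_mem _ h'))
        (Ideal.mem_sup_right (Ideal.mul_mem_right _ _ (Ideal.mem_span_singleton_self _)))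
  obtain ⟨-, hVr⟩ := hr c V φ hφs hφk
  have := hfin c
  have hrn := LinearMap.finrank_range_add_finrank_ker F.toLinearMap
  rw [LinearMap.range_eq_top.2 hF, finrank_top] at hrn
  rw [← hrn, add_comm]
  congr 1

section ArcBasics

abbrev PS := PowerSeries ℂ

lemma order_deriv (f : PS) (h : PowerSeries.constantCoeff f = 0) :
    f.order = (PowerSeries.derivative ℂ f).order + 1 := by
  rcases eq_or_ne f 0 with rfl | hf
  · simp
  obtain ⟨k, hk⟩ := ENat.ne_top_iff_exists.1 (fun h => hf (PowerSeries.order_eq_top.1 h))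
  have hk' := hk.symm
  rw [PowerSeries.order_eq_nat] at hk'
  obtain ⟨h1, h2⟩ := hk'
  rcases k with _ | k
  · exfalso
    apply h1
    rw [PowerSeries.coeff_zero_eq_constantCoeff]; exact h
  have : (PowerSeries.derivative ℂ f).order = (k : ℕ∞) := by
    rw [PowerSeries.order_eq_nat]
    constructor
    · rw [PowerSeries.coeff_derivative]
      exact mul_ne_zero h1 (by exact_mod_cast Nat.succ_ne_zero k)
    · intro i hi
      rw [PowerSeries.coeff_derivative, h2 (i+1) (by omega), zero_mul]
  rw [this, ← hk]
  push_cast; rfl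

lemma order_of_deriv (f g a : PS) (hf : PowerSeries.constantCoeff f = 0)
    (hg : PowerSeries.constantCoeff g = 0)
    (h : PowerSeries.derivative ℂ f = a * PowerSeries.derivative ℂ g) :
    f.order = a.order + g.order := by
  rw [order_deriv f hf, h, PowerSeries.order_mul, order_deriv g hg, add_assoc]

lemma eq_zero_of_deriv (f : PS) (hf : PowerSeries.constantCoeff f = 0)
    (h : PowerSeries.derivative ℂ f = 0) : f = 0 := by
  apply PowerSeries.derivative.ext
  · rw [h]; simp
  · rw [hf]; simp

lemma order_unit (a : PS) (h : PowerSeries.constantCoeff a ≠ 0) : a.order = 0 := by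
  have : a.order = ((0 : ℕ) : ℕ∞) := by
    rw [PowerSeries.order_eq_nat]
    exact ⟨by rwa [PowerSeries.coeff_zero_eq_constantCoeff], by simp⟩
  simpa using this

lemma chain_rule {σ : Type} [Fintype σ] (γ : σ → PS) (f : MvPolynomial σ ℂ) :
    PowerSeries.derivative ℂ (aeval γ f) =
      ∑ v, aeval γ (pderiv v f) * PowerSeries.derivative ℂ (γ v) := by
  classical
  induction f using MvPolynomial.induction_on with
  | C a =>
    simp only [pderiv_C, map_zero, zero_mul, Finset.sum_const_zero, aeval_C]
    exact Derivation.map_algebraMap _ a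
  | add p q hp hq => simp only [map_add, hp, hq, add_mul, Finset.sum_add_distrib]
  | mul_X p i hp =>
    simp only [map_mul, Derivation.leibniz, hp, aeval_X, pderiv_X, smul_eq_mul, map_add, add_mul,
      Finset.sum_add_distrib, Finset.mul_sum]
    congr 1
    · rw [Finset.sum_eq_single i]
      · simp
      · intro b _ hb
        simp [Pi.single_apply, hb.symm]
      · simp
    · exact Finset.sum_congr rfl fun v _ => by ring

/-- If the zeros of `gs` have finitely many `k`-th coordinates, then arcs in the zero set have
constant `k`-th coordinate. -/
lemma const_of_finite {σ : Type} [Finite σ] (I : Ideal (MvPolynomial σ ℂ)) (k : σ) (S : Set ℂ)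
    (hS : S.Finite) (h : ∀ a : σ → ℂ, (∀ g ∈ I, eval a g = 0) → a k ∈ S) (γ : σ → PS)
    (hγ : ∀ g ∈ I, aeval γ g = 0) :
    γ k = PowerSeries.C (PowerSeries.constantCoeff (γ k)) := by
  let q : MvPolynomial σ ℂ := ∏ c ∈ hS.toFinset, (X k - C c)
  have hq : q ∈ vanishingIdeal ℂ (zeroLocus ℂ I) := by
    rw [mem_vanishingIdeal_iff]
    intro a ha
    have hak := h a (fun g hg => by
      have := (mem_zeroLocus_iff.1 ha) g hg
      simpa [MvPolynomial.coe_aeval_eq_eval] using this)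
    rw [map_prod]
    exact Finset.prod_eq_zero (hS.mem_toFinset.2 hak) (by simp)
  rw [vanishingIdeal_zeroLocus_eq_radical] at hq
  obtain ⟨N, hN⟩ := hq
  have h1 := hγ _ hN
  rw [map_pow] at h1
  have h2 := eq_zero_of_pow_eq_zero h1
  rw [map_prod, Finset.prod_eq_zero_iff] at h2
  obtain ⟨c, _, hc⟩ := h2
  have h3 : γ k = PowerSeries.C c := by
    rw [map_sub, aeval_X, aeval_C, sub_eq_zero] at hc
    exact hc
  rw [h3]; simp

/-- an algebraic power series is constant. -/
lemma const_of_alg (f : PS) (v : Polynomial ℂ) (hv : v ≠ 0) (h : Polynomial.aeval f v = 0) :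
    f = PowerSeries.C (PowerSeries.constantCoeff f) := by
  rw [(IsAlgClosed.splits v).eq_prod_roots, map_mul] at h
  rcases mul_eq_zero.1 h with h | h
  · exfalso
    rw [Polynomial.aeval_C] at h
    have : (PowerSeries.C v.leadingCoeff : PS) = 0 := h
    rw [map_eq_zero_iff _ PowerSeries.C_injective] at this
    exact hv (Polynomial.leadingCoeff_eq_zero.1 this)
  · rw [map_multiset_prod, Multiset.prod_eq_zero_iff] at h
    simp only [Multiset.map_map, Multiset.mem_map] at h
    obtain ⟨c, _, hc⟩ := h
    have h3 : f = PowerSeries.C c := by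
      simp only [Function.comp, map_sub, Polynomial.aeval_X, Polynomial.aeval_C, sub_eq_zero] at hc
      exact hc
    rw [h3]; simp

/-- the maximal ideal of the point `a`. -/
def mPt {σ : Type} (a : σ → ℂ) : Ideal (MvPolynomial σ ℂ) := RingHom.ker (eval a)

instance {σ : Type} (a : σ → ℂ) : (mPt a).IsPrime := RingHom.ker_isPrime _

lemma mem_mPt {σ : Type} (a : σ → ℂ) (f : MvPolynomial σ ℂ) : f ∈ mPt a ↔ eval a f = 0 := Iff.rfl

lemma ratPt_mPt {σ : Type} (a : σ → ℂ) : RatPt (mPt a) := by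
  intro f
  exact ⟨eval a f, by simp [mem_mPt, MvPolynomial.algebraMap_eq]⟩

/-- the local ring at the point `a` -/
abbrev OPt {σ : Type} (a : σ → ℂ) := Localization.AtPrime (mPt a)

variable {σ : Type} (a : σ → ℂ) (ψ : OPt a →ₐ[ℂ] PS)

/-- coordinates of an arc -/
def arcCo (v : σ) : PS := ψ (algebraMap (MvPolynomial σ ℂ) (OPt a) (X v))

lemma arc_alg (f : MvPolynomial σ ℂ) :
    ψ (algebraMap (MvPolynomial σ ℂ) (OPt a) f) = aeval (arcCo a ψ) f := by
  have : (ψ.comp (IsScalarTower.toAlgHom ℂ (MvPolynomial σ ℂ) (OPt a))) =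
      aeval (arcCo a ψ) := by
    apply MvPolynomial.algHom_ext
    intro i
    simp [arcCo]
  exact DFunLike.congr_fun this f

lemma mem_max_OPt (f : MvPolynomial σ ℂ) :
    algebraMap (MvPolynomial σ ℂ) (OPt a) f ∈ IsLocalRing.maximalIdeal (OPt a) ↔
      eval a f = 0 := by
  rw [IsLocalization.AtPrime.to_map_mem_maximal_iff _ (mPt a), mem_mPt]

lemma arc_const (hψ : IsArc ψ) (f : MvPolynomial σ ℂ) :
    PowerSeries.constantCoeff (ψ (algebraMap (MvPolynomial σ ℂ) (OPt a) f)) = eval a f := by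
  have h := hψ (algebraMap _ _ (f - C (eval a f))) ((mem_max_OPt a _).2 (by simp))
  rw [map_sub, map_sub, map_sub, sub_eq_zero] at h
  rw [h, arc_alg, aeval_C]
  exact PowerSeries.constantCoeff_C _

lemma arc_trivial (h : ∀ v, arcCo a ψ v = PowerSeries.C (a v)) :
    ∀ x ∈ IsLocalRing.maximalIdeal (OPt a), ψ x = 0 := by
  intro x hx
  rw [max_eq_map] at hx
  have : (mPt a).map (algebraMap (MvPolynomial σ ℂ) (OPt a)) ≤ RingHom.ker ψ := by
    rw [Ideal.map_le_iff_le_comap]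
    intro f hf
    rw [Ideal.mem_comap, RingHom.mem_ker]
    change ψ (algebraMap _ _ f) = 0
    rw [arc_alg]
    have e : arcCo a ψ = fun v => algebraMap ℂ PS (a v) := funext h
    have key : ∀ f : MvPolynomial σ ℂ, aeval (fun v => algebraMap ℂ PS (a v)) f =
        algebraMap ℂ PS (eval a f) := by
      intro f
      induction f using MvPolynomial.induction_on with
      | C c => simp
      | add p q hp hq => rw [map_add, map_add, map_add, hp, hq]
      | mul_X p i hp => rw [map_mul, map_mul, map_mul, hp, aeval_X, eval_X]
    rw [e, key, (mem_mPt a f).1 hf, map_zero]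
  exact this hx

end ArcBasics

section ArcsG

abbrev VV (n : ℕ) := Fin n ⊕ Fin 2

/-- the point `(y, s, t)` -/
def pt {n : ℕ} (y : Fin n → ℂ) (s t : ℂ) : VV n → ℂ := Sum.elim y ![s, t]

@[simp] lemma pt_inl {n : ℕ} (y : Fin n → ℂ) (s t : ℂ) (i : Fin n) :
    pt y s t (Sum.inl i) = y i := rfl
@[simp] lemma pt_s {n : ℕ} (y : Fin n → ℂ) (s t : ℂ) : pt y s t (Sum.inr 0) = s := rfl
@[simp] lemma pt_t {n : ℕ} (y : Fin n → ℂ) (s t : ℂ) : pt y s t (Sum.inr 1) = t := rfl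

lemma eq_pt {n : ℕ} (a : VV n → ℂ) :
    a = pt (fun i => a (Sum.inl i)) (a (Sum.inr 0)) (a (Sum.inr 1)) := by
  funext v
  rcases v with i | i
  · rfl
  · fin_cases i <;> rfl

/-- the abstract local hypotheses on the chart equation `G` at the point `p`. -/
structure Hyp {n : ℕ} (G : MvPolynomial (VV n) ℂ) (j : Fin n) (d : ℕ) (p : Fin n → ℂ) : Prop where
  pj : p j = 0
  d1 : 1 ≤ d
  dt : pderiv (Sum.inr 1) G = - (X (Sum.inl j)) ^ d
  G0 : ∀ t, eval (pt p 0 t) G = 0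
  dG0 : ∀ t i, eval (pt p 0 t) (pderiv (Sum.inl i) G) = 0
  ds : ∀ t, eval (pt p 0 t) (pderiv (Sum.inr 0) G) ≠ 0
  fin1 : ∀ t, {y : Fin n → ℂ | eval (pt y 0 t) G = 0 ∧
    ∀ i, eval (pt y 0 t) (pderiv (Sum.inl i) G) = 0}.Finite
  fin2 : ∃ F : Set (Fin n → ℂ), F.Finite ∧ ∀ y t, y j = 0 → eval (pt y 0 t) G = 0 →
    (∀ i, eval (pt y 0 t) (pderiv (Sum.inl i) G) = 0) → y ∈ F

variable {n : ℕ} {G : MvPolynomial (VV n) ℂ} {j : Fin n} {d : ℕ} {p : Fin n → ℂ}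

lemma aeval_const {σ : Type} (a : σ → ℂ) (γ : σ → PS)
    (h : ∀ v, PowerSeries.constantCoeff (γ v) = a v) (f : MvPolynomial σ ℂ) :
    PowerSeries.constantCoeff (aeval γ f) = eval a f := by
  induction f using MvPolynomial.induction_on with
  | C c => rw [aeval_C, eval_C]; exact PowerSeries.constantCoeff_C _
  | add p q hp hq => rw [map_add, map_add, map_add, hp, hq]
  | mul_X p i hp => rw [map_mul, map_mul, map_mul, hp, aeval_X, eval_X, h]

section
variable (H : Hyp G j d p) (c : ℂ) (γ : VV n → PS)
  (hγ : ∀ v, PowerSeries.constantCoeff (γ v) = pt p 0 c v)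
  (hJ : ∀ i, aeval γ (pderiv (Sum.inl i) G) = 0)
include H hγ hJ

lemma arc_G_deriv : PowerSeries.derivative ℂ (aeval γ G) =
    aeval γ (pderiv (Sum.inr 0) G) * PowerSeries.derivative ℂ (γ (Sum.inr 0)) -
      (γ (Sum.inl j)) ^ d * PowerSeries.derivative ℂ (γ (Sum.inr 1)) := by
  rw [chain_rule, Fintype.sum_sum_type, Fin.sum_univ_two]
  simp only [hJ, zero_mul, Finset.sum_const_zero, zero_add, H.dt, map_neg, map_pow, aeval_X]
  ring

lemma deriv_t : PowerSeries.derivative ℂ (γ (Sum.inr 1)) =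
    PowerSeries.derivative ℂ (γ (Sum.inr 1) - PowerSeries.C c) := by
  rw [map_sub, PowerSeries.derivative_C, sub_zero]

lemma ord_dsG : (aeval γ (pderiv (Sum.inr 0) G)).order = 0 := by
  apply order_unit
  rw [aeval_const _ _ hγ]
  exact H.ds c

lemma dsG_ne : aeval γ (pderiv (Sum.inr 0) G) ≠ 0 := by
  intro h
  have := ord_dsG H c γ hγ hJ
  rw [h] at this; simp at this

lemma const_s : PowerSeries.constantCoeff (γ (Sum.inr 0)) = 0 := by rw [hγ]; simp
lemma const_t : PowerSeries.constantCoeff (γ (Sum.inr 1) - PowerSeries.C c) = 0 := by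
  rw [map_sub, hγ]; simp
lemma const_G : PowerSeries.constantCoeff (aeval γ G) = 0 := by
  rw [aeval_const _ _ hγ]; exact H.G0 c

lemma arc_triv_of (h1 : ∀ i, γ (Sum.inl i) = PowerSeries.C (p i)) (h2 : γ (Sum.inr 0) = 0)
    (h3 : γ (Sum.inr 1) = PowerSeries.C c) (v : VV n) : γ v = PowerSeries.C (pt p 0 c v) := by
  rcases v with i | i
  · rw [h1]; simp
  · fin_cases i
    · simp [h2]
    · simp [h3]

lemma T1 (hs : γ (Sum.inr 0) = 0) (ht : γ (Sum.inr 1) = PowerSeries.C c) (v : VV n) :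
    γ v = PowerSeries.C (pt p 0 c v) := by
  have hG : aeval γ G = 0 := by
    apply eq_zero_of_deriv _ (const_G H c γ hγ hJ)
    rw [arc_G_deriv H c γ hγ hJ, hs, ht, PowerSeries.derivative_C]; simp
  refine arc_triv_of H c γ hγ hJ (fun i => ?_) hs ht v
  have hci : PowerSeries.constantCoeff (γ (Sum.inl i)) = p i := by rw [hγ]; simp
  rw [← hci]
  refine const_of_finite (Ideal.span ({G, X (Sum.inr 0), X (Sum.inr 1) - C c} ∪
    Set.range (fun i => pderiv (Sum.inl i) G))) _ ((fun y => y i) '' {y : Fin n → ℂ | eval (pt y 0 c) G = 0 ∧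
    ∀ i, eval (pt y 0 c) (pderiv (Sum.inl i) G) = 0}) ((H.fin1 c).image _) ?_ γ ?_
  · intro a ha
    have e0 : a (Sum.inr 0) = 0 := by
      have := ha (X (Sum.inr 0)) (Ideal.subset_span (by simp))
      simpa using this
    have e1 : a (Sum.inr 1) = c := by
      have := ha (X (Sum.inr 1) - C c) (Ideal.subset_span (by simp))
      simpa [sub_eq_zero] using this
    have ea : a = pt (fun i => a (Sum.inl i)) 0 c := by
      conv_lhs => rw [eq_pt a, e0, e1]
    refine ⟨fun i => a (Sum.inl i), ⟨?_, fun i => ?_⟩, rfl⟩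
    · rw [← ea]; exact ha _ (Ideal.subset_span (by simp))
    · rw [← ea]; exact ha _ (Ideal.subset_span (by simp))
  · have : Ideal.span ({G, X (Sum.inr 0), X (Sum.inr 1) - C c} ∪
      Set.range (fun i => pderiv (Sum.inl i) G)) ≤ RingHom.ker (aeval γ : _ →ₐ[ℂ] PS) := by
      rw [Ideal.span_le]
      rintro f (hf | ⟨i, rfl⟩)
      · simp only [Set.mem_insert_iff, Set.mem_singleton_iff] at hf
        rcases hf with rfl | rfl | rfl
        · exact hG
        · simp [hs]
        · simp [ht, sub_eq_zero]
      · exact hJ i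
    exact fun g hg => this hg

lemma T2 (hG : aeval γ G = 0) (ht : γ (Sum.inr 1) = PowerSeries.C c) (v : VV n) :
    γ v = PowerSeries.C (pt p 0 c v) := by
  have h := arc_G_deriv H c γ hγ hJ
  rw [hG, ht, PowerSeries.derivative_C, map_zero, mul_zero, sub_zero] at h
  have hs : γ (Sum.inr 0) = 0 := by
    apply eq_zero_of_deriv _ (const_s H c γ hγ hJ)
    rcases mul_eq_zero.1 h.symm with h | h
    · exact absurd h (dsG_ne H c γ hγ hJ)
    · exact h
  exact T1 H c γ hγ hJ hs ht v

lemma T3 (ht : γ (Sum.inr 1) = PowerSeries.C c) :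
    (aeval γ G).order = (γ (Sum.inr 0)).order := by
  have h := arc_G_deriv H c γ hγ hJ
  rw [ht, PowerSeries.derivative_C, mul_zero, sub_zero] at h
  rw [order_of_deriv _ _ _ (const_G H c γ hγ hJ) (const_s H c γ hγ hJ) h, ord_dsG H c γ hγ hJ,
    zero_add]

lemma T4 (hG : aeval γ G = 0) :
    (γ (Sum.inr 0)).order = d • (γ (Sum.inl j)).order + (γ (Sum.inr 1) - PowerSeries.C c).order := by
  have h := arc_G_deriv H c γ hγ hJ
  rw [hG, map_zero, eq_comm, sub_eq_zero, deriv_t H c γ hγ hJ] at h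
  have h2 := congrArg PowerSeries.order h
  rw [PowerSeries.order_mul, ord_dsG H c γ hγ hJ, zero_add, PowerSeries.order_mul,
    PowerSeries.order_pow] at h2
  rw [order_deriv _ (const_s H c γ hγ hJ), h2, order_deriv _ (const_t H c γ hγ hJ), add_assoc]

lemma U1 (hG : aeval γ G = 0) (hs : γ (Sum.inr 0) = 0) :
    γ (Sum.inl j) = 0 ∨ γ (Sum.inr 1) = PowerSeries.C c := by
  have h := T4 H c γ hγ hJ hG
  rw [hs, PowerSeries.order_zero, ← PowerSeries.order_pow, ← PowerSeries.order_mul, eq_comm,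
    PowerSeries.order_eq_top, mul_eq_zero] at h
  rcases h with h | h
  · exact Or.inl (eq_zero_of_pow_eq_zero h)
  · exact Or.inr (sub_eq_zero.1 h)

lemma U2 (hG : aeval γ G = 0) (hz : γ (Sum.inl j) = 0) : γ (Sum.inr 0) = 0 := by
  have h := T4 H c γ hγ hJ hG
  rw [← PowerSeries.order_pow, ← PowerSeries.order_mul, hz,
    zero_pow (by have := H.d1; omega), zero_mul, PowerSeries.order_zero] at h
  exact PowerSeries.order_eq_top.1 h

lemma U3 (hG : aeval γ G = 0) (hs : γ (Sum.inr 0) = 0) (hz : γ (Sum.inl j) = 0) (i : Fin n) :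
    γ (Sum.inl i) = PowerSeries.C (p i) := by
  have hci : PowerSeries.constantCoeff (γ (Sum.inl i)) = p i := by rw [hγ]; simp
  rw [← hci]
  obtain ⟨F, hF, hF2⟩ := H.fin2
  refine const_of_finite (Ideal.span ({G, X (Sum.inr 0), X (Sum.inl j)} ∪
    Set.range (fun i => pderiv (Sum.inl i) G))) _ ((fun y => y i) '' F) (hF.image _) ?_ γ ?_
  · intro a ha
    have e0 : a (Sum.inr 0) = 0 := by
      have := ha (X (Sum.inr 0)) (Ideal.subset_span (by simp))
      simpa using this
    have e1 : a (Sum.inl j) = 0 := by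
      have := ha (X (Sum.inl j)) (Ideal.subset_span (by simp))
      simpa using this
    have ea : a = pt (fun i => a (Sum.inl i)) 0 (a (Sum.inr 1)) := by
      conv_lhs => rw [eq_pt a, e0]
    refine ⟨fun i => a (Sum.inl i), hF2 _ (a (Sum.inr 1)) e1 ?_ fun i => ?_, rfl⟩
    · rw [← ea]; exact ha _ (Ideal.subset_span (by simp))
    · rw [← ea]; exact ha _ (Ideal.subset_span (by simp))
  · have : Ideal.span ({G, X (Sum.inr 0), X (Sum.inl j)} ∪
      Set.range (fun i => pderiv (Sum.inl i) G)) ≤ RingHom.ker (aeval γ : _ →ₐ[ℂ] PS) := by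
      rw [Ideal.span_le]
      rintro f (hf | ⟨i, rfl⟩)
      · simp only [Set.mem_insert_iff, Set.mem_singleton_iff] at hf
        rcases hf with rfl | rfl | rfl
        · exact hG
        · simp [hs]
        · simp [hz]
      · exact hJ i
    exact fun g hg => this hg
end

/-- restriction of polynomials to the line `(p, 0, t)`. -/
def resT (p : Fin n → ℂ) : MvPolynomial (VV n) ℂ →ₐ[ℂ] Polynomial ℂ :=
  aeval (Sum.elim (fun i => Polynomial.C (p i)) ![0, Polynomial.X])

/-- the ideal of the line `(p, 0, t)`. -/
def P0 (p : Fin n → ℂ) : Ideal (MvPolynomial (VV n) ℂ) := RingHom.ker (resT p)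

lemma mem_P0 (p : Fin n → ℂ) (f) : f ∈ P0 p ↔ resT p f = 0 := Iff.rfl

instance (p : Fin n → ℂ) : (P0 p).IsPrime := RingHom.ker_isPrime _

section
variable (H : Hyp G j d p) (c : ℂ) (γ : VV n → PS)
  (hγ : ∀ v, PowerSeries.constantCoeff (γ v) = pt p 0 c v)
  (hJ : ∀ i, aeval γ (pderiv (Sum.inl i) G) = 0)
include H hγ hJ

lemma U4 (hG : aeval γ G = 0) (v : MvPolynomial (VV n) ℂ) (hv : v ∉ P0 p) (hv0 : aeval γ v = 0)
    (h : γ (Sum.inr 1) = PowerSeries.C c ∨ γ (Sum.inr 0) = 0 ∨ γ (Sum.inl j) = 0) (w : VV n) :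
    γ w = PowerSeries.C (pt p 0 c w) := by
  have key : γ (Sum.inr 0) = 0 → γ (Sum.inl j) = 0 → γ w = PowerSeries.C (pt p 0 c w) := by
    intro hs hz
    have h1 := U3 H c γ hγ hJ hG hs hz
    have h2 : ((Polynomial.aeval (γ (Sum.inr 1))).comp (resT p) :
        MvPolynomial (VV n) ℂ →ₐ[ℂ] PS) = aeval γ := by
      apply MvPolynomial.algHom_ext
      intro v
      rcases v with i | i
      · simp [resT, h1]
      · fin_cases i
        · simp [resT, hs]
        · simp [resT]
    have h3 := const_of_alg (γ (Sum.inr 1)) (resT p v) hv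
      (by rw [← hv0, ← h2]; rfl)
    rw [hγ, pt_t] at h3
    exact arc_triv_of H c γ hγ hJ h1 hs h3 w
  rcases h with h | h | h
  · exact T2 H c γ hγ hJ hG h w
  · rcases U1 H c γ hγ hJ hG h with h' | h'
    · exact key h h'
    · exact T2 H c γ hγ hJ hG h' w
  · exact key (U2 H c γ hγ hJ hG h) h
end

end ArcsG

section LocG

lemma nzd_minimal {R : Type*} [CommRing R] (I : Ideal R) (w : R) (hw : ∀ a, a * w ∈ I → a ∈ I) :
    ∀ Q ∈ I.minimalPrimes, w ∉ Q := by
  intro Q hQ hwQ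
  have h : w ∈ ⋃ p ∈ I.minimalPrimes, (p : Set R) := Set.mem_biUnion hQ hwQ
  rw [Ideal.iUnion_minimalPrimes] at h
  obtain ⟨y, hy, hyw⟩ := h
  obtain ⟨k, hk⟩ := hyw
  apply hy
  have h2 : ∀ k, ∀ a, a * w ^ k ∈ I → a ∈ I := by
    intro k
    induction k with
    | zero => intro a ha; simpa using ha
    | succ k ih =>
      intro a ha
      apply ih
      apply hw
      rwa [mul_assoc, ← pow_succ]
  refine ⟨k, h2 k _ ?_⟩
  rwa [← mul_pow, mul_comm y w]

lemma mult_ineq_arc {A : Type} [CommRing A] [Algebra ℂ A] [Algebra.FiniteType ℂ A] (m : Ideal A)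
    [m.IsPrime] (I : Ideal (Localization.AtPrime m)) (w x : Localization.AtPrime m)
    (hw : w ∈ IsLocalRing.maximalIdeal (Localization.AtPrime m))
    (hnz : ∀ a, a * w ∈ I → a ∈ I)
    (h : Module.Finite ℂ (Localization.AtPrime m ⧸ (I ⊔ Ideal.span {w})))
    (h' : Module.Finite ℂ (Localization.AtPrime m ⧸ (I ⊔ Ideal.span {x})))
    (harc : ∀ ψ : Localization.AtPrime m →ₐ[ℂ] PowerSeries ℂ, IsArc ψ → (∀ a ∈ I, ψ a = 0) →
      ψ w ≠ 0 → (ψ w).order ≤ (ψ x).order) :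
    Module.finrank ℂ (Localization.AtPrime m ⧸ (I ⊔ Ideal.span {w})) ≤
      Module.finrank ℂ (Localization.AtPrime m ⧸ (I ⊔ Ideal.span {x})) := by
  obtain ⟨K, hK⟩ := int_thm m I w x hw (nzd_minimal I w hnz) h harc
  exact mult_ineq I w x hnz h h' K (pow_mem_of_dep I x w K hK)

variable {n : ℕ} (G : MvPolynomial (VV n) ℂ) (p : Fin n → ℂ) (c : ℂ)

/-- the ideal of the partial derivatives. -/
def JJ : Ideal (MvPolynomial (VV n) ℂ) := Ideal.span (Set.range fun i => pderiv (Sum.inl i) G)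

/-- the local ring at `(p, 0, c)` -/
abbrev OO := OPt (pt p 0 c)

/-- the map to the local ring -/
abbrev toO (f : MvPolynomial (VV n) ℂ) : OO p c := algebraMap _ (OO p c) f

/-- the variables `s`, `t` -/
abbrev sV : MvPolynomial (VV n) ℂ := X (Sum.inr 0)
abbrev tV : MvPolynomial (VV n) ℂ := X (Sum.inr 1)

/-- the function `t - c` -/
abbrev tauV (c : ℂ) : MvPolynomial (VV n) ℂ := tV - algebraMap ℂ _ c

abbrev IGG : Ideal (MvPolynomial (VV n) ℂ) := JJ G ⊔ Ideal.span {G}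

lemma finite_OO (I : Ideal (OO p c))
    (h : ∀ ψ : OO p c →ₐ[ℂ] PS, IsArc ψ → (∀ a ∈ I, ψ a = 0) →
      ∀ v, arcCo (pt p 0 c) ψ v = PowerSeries.C (pt p 0 c v)) : Module.Finite ℂ (OO p c ⧸ I) := by
  apply finite_of_arcs _ (ratPt_mPt _)
  intro ψ hψ hI
  exact arc_trivial _ _ (h ψ hψ hI)

instance : IsNoetherianRing (OO p c) :=
  IsLocalization.isNoetherianRing (mPt (pt p 0 c)).primeCompl _ inferInstance

variable {G p c}
section
variable {ψ : OO p c →ₐ[ℂ] PS} (hψ : IsArc ψ)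
include hψ
lemma arc_hγ (v : VV n) : PowerSeries.constantCoeff (arcCo (pt p 0 c) ψ v) = pt p 0 c v := by
  unfold arcCo; rw [arc_const _ _ hψ]; simp
end

variable (ψ : OO p c →ₐ[ℂ] PS) (I : Ideal (OO p c)) (hI : ∀ a ∈ I, ψ a = 0)
include hI
lemma arc_hJ (hJ : (JJ G).map (algebraMap _ (OO p c)) ≤ I) (i : Fin n) :
    aeval (arcCo (pt p 0 c) ψ) (pderiv (Sum.inl i) G) = 0 := by
  rw [← arc_alg]
  apply hI _ (hJ _)
  apply Ideal.mem_map_of_mem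
  exact Ideal.subset_span ⟨i, rfl⟩

lemma arc_hf (f : MvPolynomial (VV n) ℂ) (hf : toO p c f ∈ I) :
    aeval (arcCo (pt p 0 c) ψ) f = 0 := by
  rw [← arc_alg]
  exact hI _ hf

lemma arc_hs (hf : toO p c sV ∈ I) :
    arcCo (pt p 0 c) ψ (Sum.inr 0) = 0 := by
  have := arc_hf ψ I hI _ hf
  simpa using this

lemma arc_hz (j : Fin n) (hf : toO p c (X (Sum.inl j)) ∈ I) :
    arcCo (pt p 0 c) ψ (Sum.inl j) = 0 := by
  have := arc_hf ψ I hI _ hf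
  simpa using this

omit hI in
lemma arc_tau : ψ (toO p c (tauV c)) = arcCo (pt p 0 c) ψ (Sum.inr 1) - PowerSeries.C c := by
  rw [toO, arc_alg, map_sub, aeval_X]
  rw [MvPolynomial.algebraMap_eq, aeval_C]; rfl

lemma arc_ht (hf : toO p c (tauV c) ∈ I) :
    arcCo (pt p 0 c) ψ (Sum.inr 1) = PowerSeries.C c := by
  have := hI _ hf
  rwa [arc_tau, sub_eq_zero] at this
omit hI

section
variable {j : Fin n} {d : ℕ} (H : Hyp G j d p) 
include H

/-- `J + (t - c)` -/
abbrev I1 (G : MvPolynomial (VV n) ℂ) (p : Fin n → ℂ) (c : ℂ) : Ideal (OO p c) :=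
  (JJ G).map (algebraMap _ (OO p c)) ⊔ Ideal.span {toO p c (tauV c)}

omit H in
lemma mem_sup_span {R : Type*} [CommRing R] (I : Ideal R) (x : R) : x ∈ I ⊔ Ideal.span {x} :=
  Ideal.mem_sup_right (Ideal.mem_span_singleton_self x)

lemma fin_Jts (c : ℂ) : Module.Finite ℂ (OO p c ⧸ (I1 G p c ⊔ Ideal.span {toO p c sV})) := by
  apply finite_OO
  intro ψ hψ hI v
  exact T1 H c _ (arc_hγ hψ) (arc_hJ ψ _ hI (le_sup_left.trans le_sup_left))
    (arc_hs ψ _ hI (mem_sup_span _ _)) (arc_ht ψ _ hI (Ideal.mem_sup_left (mem_sup_span _ _))) v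

lemma fin_JtG (c : ℂ) : Module.Finite ℂ (OO p c ⧸ (I1 G p c ⊔ Ideal.span {toO p c G})) := by
  apply finite_OO
  intro ψ hψ hI v
  exact T2 H c _ (arc_hγ hψ) (arc_hJ ψ _ hI (le_sup_left.trans le_sup_left))
    (arc_hf ψ _ hI _ (mem_sup_span _ _)) (arc_ht ψ _ hI (Ideal.mem_sup_left (mem_sup_span _ _))) v

omit H in
lemma map_IGG : (IGG G).map (algebraMap _ (OO p c)) =
    (JJ G).map (algebraMap _ (OO p c)) ⊔ Ideal.span {toO p c G} := by
  rw [IGG, Ideal.map_sup, Ideal.map_span, Set.image_singleton]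

omit H in
lemma IGG_tau : (IGG G).map (algebraMap _ (OO p c)) ⊔ Ideal.span {toO p c (tauV c)} =
    I1 G p c ⊔ Ideal.span {toO p c G} := by
  rw [map_IGG, I1, sup_right_comm]

/-- the list of the derivatives -/
def dList (G : MvPolynomial (VV n) ℂ) (p : Fin n → ℂ) (c : ℂ) : List (OO p c) :=
  List.ofFn fun i => toO p c (pderiv (Sum.inl i) G)

omit H in
lemma ofList_dList : Ideal.ofList (dList G p c) = (JJ G).map (algebraMap _ (OO p c)) := by
  rw [JJ, Ideal.map_span, Ideal.ofList]
  congr 1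
  ext x
  simp [dList, List.mem_ofFn]

lemma mem_max_dG (c : ℂ) (i : Fin n) :
    toO p c (pderiv (Sum.inl i) G) ∈ IsLocalRing.maximalIdeal (OO p c) :=
  (mem_max_OPt _ _).2 (H.dG0 c i)

lemma mem_max_G (c : ℂ) : toO p c G ∈ IsLocalRing.maximalIdeal (OO p c) :=
  (mem_max_OPt _ _).2 (H.G0 c)

omit H in
lemma mem_max_s : toO p c sV ∈ IsLocalRing.maximalIdeal (OO p c) :=
  (mem_max_OPt _ _).2 (by simp)

omit H in
lemma mem_max_tau : toO p c (tauV c) ∈ IsLocalRing.maximalIdeal (OO p c) :=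
  (mem_max_OPt _ _).2 (by simp [MvPolynomial.algebraMap_eq])

lemma cm_nzd_G (c : ℂ) (g w : OO p c) (hg : g ∈ IsLocalRing.maximalIdeal (OO p c))
    (hw : w ∈ IsLocalRing.maximalIdeal (OO p c)) (I : Ideal (OO p c))
    (hI : I = (JJ G).map (algebraMap _ (OO p c)) ⊔ Ideal.span {g})
    (hfin : Module.Finite ℂ (OO p c ⧸ (I ⊔ Ideal.span {w}))) (a : OO p c)
    (ha : a * w ∈ I) : a ∈ I := by
  obtain ⟨rs, hrl, hrm, hr⟩ := regseq_loc (mPt (pt p 0 c)) (pt p 0 c)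
    (fun i => by rw [mem_mPt]; simp)
  have e : I = Ideal.ofList (g :: dList G p c) := by
    rw [hI, Ideal.ofList_cons, ofList_dList, sup_comm]
  rw [e] at ha hfin ⊢
  refine cm_nzd rs hrm hr _ w ?_ ?_ hw hfin a ha
  · rw [hrl]; simp [dList]
  · intro x hx
    rcases List.mem_cons.1 hx with rfl | hx
    · exact hg
    · obtain ⟨i, rfl⟩ := List.mem_ofFn.1 hx
      exact mem_max_dG H c i

lemma nzd_s_I1 (c : ℂ) (a : OO p c) (ha : a * toO p c sV ∈ I1 G p c) : a ∈ I1 G p c :=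
  cm_nzd_G H c _ _ mem_max_tau mem_max_s _ rfl (fin_Jts H c) a ha

lemma nzd_G_I1 (c : ℂ) (a : OO p c) (ha : a * toO p c G ∈ I1 G p c) : a ∈ I1 G p c :=
  cm_nzd_G H c _ _ mem_max_tau (mem_max_G H c) _ rfl (fin_JtG H c) a ha

lemma nzd_tau_IG (c : ℂ) (a : OO p c)
    (ha : a * toO p c (tauV c) ∈ (IGG G).map (algebraMap _ (OO p c))) :
    a ∈ (IGG G).map (algebraMap _ (OO p c)) :=
  cm_nzd_G H c _ _ (mem_max_G H c) mem_max_tau _ map_IGG (by rw [IGG_tau]; exact fin_JtG H c) a ha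

lemma ell_eq (c : ℂ) : Module.finrank ℂ (OO p c ⧸ (I1 G p c ⊔ Ideal.span {toO p c sV})) =
    Module.finrank ℂ (OO p c ⧸ ((IGG G).map (algebraMap _ (OO p c)) ⊔
      Ideal.span {toO p c (tauV c)})) := by
  rw [IGG_tau]
  have key : ∀ ψ : OO p c →ₐ[ℂ] PS, IsArc ψ → (∀ a ∈ I1 G p c, ψ a = 0) →
      (ψ (toO p c G)).order = (ψ (toO p c sV)).order := by
    intro ψ hψ hI
    have := T3 H c _ (arc_hγ hψ) (arc_hJ ψ _ hI le_sup_left)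
      (arc_ht ψ _ hI (mem_sup_span _ _))
    rw [toO, toO, arc_alg, arc_alg, this, sV, aeval_X]
  apply le_antisymm
  · exact mult_ineq_arc _ _ _ _ mem_max_s (nzd_s_I1 H c) (fin_Jts H c) (fin_JtG H c)
      fun ψ hψ hI _ => (key ψ hψ hI).ge
  · exact mult_ineq_arc _ _ _ _ (mem_max_G H c) (nzd_G_I1 H c) (fin_JtG H c) (fin_Jts H c)
      fun ψ hψ hI _ => (key ψ hψ hI).le

omit H in
lemma eval_resT (f : MvPolynomial (VV n) ℂ) (t : ℂ) :
    (resT p f).eval t = eval (pt p 0 t) f := by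
  have : ((Polynomial.aeval t).comp (resT p) : MvPolynomial (VV n) ℂ →ₐ[ℂ] ℂ) =
      aeval (pt p 0 t) := by
    apply MvPolynomial.algHom_ext
    intro v
    rcases v with i | i
    · simp [resT]
    · fin_cases i
      · simp [resT]
      · simp [resT]
  have := DFunLike.congr_fun this f
  simpa [Polynomial.coe_aeval_eq_eval, MvPolynomial.aeval_eq_eval] using this

omit H in
lemma resT_aeval (f : Polynomial ℂ) : resT p (Polynomial.aeval tV f) = f := by
  have : ((resT p).comp (Polynomial.aeval (tV : MvPolynomial (VV n) ℂ))) =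
      AlgHom.id ℂ (Polynomial ℂ) := by
    apply Polynomial.algHom_ext
    simp [resT]
  exact DFunLike.congr_fun this f

omit H in
lemma mod_P0 (a : MvPolynomial (VV n) ℂ) :
    a - Polynomial.aeval tV (resT p a) ∈ P0 p := by
  rw [mem_P0, map_sub, resT_aeval, sub_self]

omit H in
lemma mPt_eq (c : ℂ) : mPt (pt p 0 c) = P0 p ⊔ Ideal.span {tauV c} := by
  apply le_antisymm
  · intro f hf
    rw [mem_mPt, ← eval_resT] at hf
    obtain ⟨q, hq⟩ := Polynomial.dvd_iff_isRoot.2 hf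
    have h := mod_P0 (p := p) f
    rw [← sub_add_cancel f (Polynomial.aeval tV (resT p f))]
    apply Ideal.add_mem
    · exact Ideal.mem_sup_left h
    · apply Ideal.mem_sup_right
      rw [hq, map_mul, map_sub, Polynomial.aeval_X, Polynomial.aeval_C]
      exact Ideal.mul_mem_right _ _ (Ideal.mem_span_singleton_self _)
  · rw [sup_le_iff, Ideal.span_singleton_le_iff_mem]
    constructor
    · intro f hf
      rw [mem_mPt, ← eval_resT, (mem_P0 p f).1 hf]; simp
    · rw [mem_mPt]; simp [MvPolynomial.algebraMap_eq]

lemma IGG_le_P0 : IGG G ≤ P0 p := by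
  rw [IGG, sup_le_iff, JJ, Ideal.span_le, Ideal.span_singleton_le_iff_mem]
  constructor
  · rintro _ ⟨i, rfl⟩
    change _ ∈ P0 p
    rw [mem_P0]
    apply Polynomial.funext
    intro t
    rw [eval_resT, H.dG0]; simp
  · rw [mem_P0]
    apply Polynomial.funext
    intro t
    rw [eval_resT, H.G0]; simp

/-- the ideal of the polar curve -/
abbrev SI (G : MvPolynomial (VV n) ℂ) (p : Fin n → ℂ) : Ideal (MvPolynomial (VV n) ℂ) :=
  satI (IGG G) (P0 p)

/-- the localised ideal of the polar curve -/
abbrev I2 (G : MvPolynomial (VV n) ℂ) (p : Fin n → ℂ) (c : ℂ) : Ideal (OO p c) :=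
  (SI G p).map (algebraMap _ (OO p c))

lemma ell_formula : ∃ r, ∀ c, Module.finrank ℂ (OO p c ⧸ (I1 G p c ⊔ Ideal.span {toO p c sV})) =
    r + Module.finrank ℂ (OO p c ⧸ (I2 G p c ⊔ Ideal.span {toO p c (tauV c)})) := by
  obtain ⟨r, hr⟩ := lam_alg (IGG G) (P0 p) tV (fun c => mPt (pt p 0 c)) (fun c => ratPt_mPt _)
    mPt_eq (fun a => ⟨_, mod_P0 a⟩) (fun c => nzd_tau_IG H c)
    (fun c => by rw [IGG_tau]; exact fin_JtG H c)
  refine ⟨r, fun c => ?_⟩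
  rw [ell_eq H]
  exact hr c

end
end LocG

section LocG2

/-- in a local ring, two primes containing an ideal with one-dimensional quotient -/
lemma prime_chain {O : Type*} [CommRing O] [IsLocalRing O] [IsNoetherianRing O] [Algebra ℂ O]
    (Q P : Ideal O) [hQ : Q.IsPrime] [hP : P.IsPrime] (hQP : Q ≤ P) (w : O) (hw : w ∉ P)
    (hwm : w ∈ IsLocalRing.maximalIdeal O)
    (hfin : Module.Finite ℂ (O ⧸ (Q ⊔ Ideal.span {w}))) : P ≤ Q := by
  by_contra hcon
  have hloc : IsLocalRing (O ⧸ Q) := IsLocalRing.of_surjective' (Ideal.Quotient.mk Q)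
    Ideal.Quotient.mk_surjective
  have hPp : (P.map (Ideal.Quotient.mk Q)).IsPrime :=
    Ideal.map_isPrime_of_surjective Ideal.Quotient.mk_surjective
      (by rw [Ideal.mk_ker]; exact hQP)
  have hne : P.map (Ideal.Quotient.mk Q) ≠ ⊥ := by
    intro h
    apply hcon
    rw [Ideal.map_eq_bot_iff_le_ker, Ideal.mk_ker] at h
    exact h
  have hcm : (P.map (Ideal.Quotient.mk Q)).comap (Ideal.Quotient.mk Q) = P := by
    rw [Ideal.comap_map_of_surjective _ Ideal.Quotient.mk_surjective, ← RingHom.ker_eq_comap_bot,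
      Ideal.mk_ker, sup_eq_left]
    exact hQP
  have hwm' : Ideal.Quotient.mk Q w ∈ IsLocalRing.maximalIdeal (O ⧸ Q) := by
    rw [IsLocalRing.mem_maximalIdeal, mem_nonunits_iff]
    intro hu
    obtain ⟨b, hb⟩ := isUnit_iff_exists_inv.1 hu
    obtain ⟨b, rfl⟩ := Ideal.Quotient.mk_surjective b
    rw [← map_mul, ← map_one (Ideal.Quotient.mk Q), Ideal.Quotient.eq] at hb
    have hQm : Q ≤ IsLocalRing.maximalIdeal O := IsLocalRing.le_maximalIdeal hQ.ne_top
    have h1 := Ideal.sub_mem _ (Ideal.mul_mem_right b _ hwm) (hQm hb)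
    rw [sub_sub_cancel] at h1
    exact (IsLocalRing.mem_maximalIdeal _).1 h1 isUnit_one
  have hfin' : Module.Finite ℂ ((O ⧸ Q) ⧸ Ideal.span {Ideal.Quotient.mk Q w}) := by
    have e := (DoubleQuot.quotQuotEquivQuotSupₐ ℂ Q (Ideal.span {w})).symm
    rw [Ideal.map_span, Set.image_singleton] at e
    exact Module.Finite.equiv e.toLinearEquiv
  have h := prime_bot_or_max (Ideal.Quotient.mk Q w) hfin' hwm' _ hne
  apply hw
  rw [← hcm, Ideal.mem_comap, h]
  exact hwm'

variable {n : ℕ} {G : MvPolynomial (VV n) ℂ} {p : Fin n → ℂ} {j : Fin n} {d : ℕ} (H : Hyp G j d p)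
include H

omit H in
lemma tau_notMem_P0 (c : ℂ) : (tauV c : MvPolynomial (VV n) ℂ) ∉ P0 p := by
  rw [mem_P0]
  have : resT p (tauV c) = Polynomial.X - Polynomial.C c := by
    rw [map_sub, AlgHom.commutes]; simp [resT]
  rw [this]
  exact Polynomial.X_sub_C_ne_zero c

lemma P0_minimal (Q : Ideal (MvPolynomial (VV n) ℂ)) (hQ : Q.IsPrime) (h1 : IGG G ≤ Q)
    (h2 : Q ≤ P0 p) : P0 p ≤ Q := by
  have hm : ∀ {Q : Ideal (MvPolynomial (VV n) ℂ)}, Q ≤ P0 p →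
      Disjoint ((mPt (pt p 0 0)).primeCompl : Set (MvPolynomial (VV n) ℂ)) Q := by
    intro Q hQ
    rw [Set.disjoint_left]
    intro x hx hxQ
    apply hx
    rw [mPt_eq]
    exact Ideal.mem_sup_left (hQ hxQ)
  have i1 : (Q.map (algebraMap _ (OO p 0))).IsPrime :=
    IsLocalization.isPrime_of_isPrime_disjoint (mPt (pt p 0 0)).primeCompl _ Q hQ (hm h2)
  have i2 : ((P0 p).map (algebraMap _ (OO p 0))).IsPrime :=
    IsLocalization.isPrime_of_isPrime_disjoint (mPt (pt p 0 0)).primeCompl _ (P0 p)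
      inferInstance (hm le_rfl)
  have e1 := IsLocalization.under_map_of_isPrime_disjoint (mPt (pt p 0 0)).primeCompl (OO p 0)
    hQ (hm h2)
  have e2 := IsLocalization.under_map_of_isPrime_disjoint (mPt (pt p 0 0)).primeCompl (OO p 0)
    (I := P0 p) inferInstance (hm le_rfl)
  have := prime_chain (Q.map (algebraMap _ (OO p 0))) ((P0 p).map (algebraMap _ (OO p 0)))
    (Ideal.map_mono h2) (toO p 0 (tauV 0)) (fun hc => by
      apply tau_notMem_P0 (p := p) 0
      rw [← e2]
      exact hc) mem_max_tau
    (by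
      refine quot_finite_mono ?_ (fin_JtG H 0)
      rw [← IGG_tau]
      exact sup_le_sup_right (Ideal.map_mono h1) _)
  rw [← e1, ← e2]
  exact Ideal.comap_mono this

lemma exists_v : ∃ v ∈ SI G p, v ∉ P0 p := by
  classical
  have hfin := Ideal.finite_minimalPrimes_of_isNoetherianRing _ (IGG G)
  have hch : ∀ Q : Ideal (MvPolynomial (VV n) ℂ), ∃ g, g ∉ P0 p ∧
      (Q ∈ (IGG G).minimalPrimes → Q ≠ P0 p → g ∈ Q) := by
    intro Q
    by_cases hQ : Q ∈ (IGG G).minimalPrimes ∧ Q ≠ P0 p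
    · have : ¬ Q ≤ P0 p := by
        intro hle
        exact hQ.2 (le_antisymm hle (P0_minimal H Q hQ.1.1.1 hQ.1.1.2 hle))
      obtain ⟨g, hg, hg'⟩ := SetLike.not_le_iff_exists.1 this
      exact ⟨g, hg', fun _ _ => hg⟩
    · refine ⟨1, fun h => ?_, fun h1 h2 => absurd ⟨h1, h2⟩ hQ⟩
      exact (inferInstance : (P0 p).IsPrime).ne_top ((Ideal.eq_top_iff_one _).2 h)
  choose g hg hg' using hch
  let gg := ∏ Q ∈ hfin.toFinset, g Q
  have hgg : gg ∉ P0 p := by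
    intro h
    rw [Ideal.IsPrime.prod_mem_iff] at h
    obtain ⟨Q, _, hQ⟩ := h
    exact hg Q hQ
  have hle : Ideal.span {gg} * P0 p ≤ (IGG G).radical := by
    rw [← Ideal.sInf_minimalPrimes]
    apply le_sInf
    intro Q hQ
    by_cases hQP : Q = P0 p
    · rw [hQP]; exact Ideal.mul_le_right
    · refine Ideal.mul_le_left.trans ?_
      rw [Ideal.span_singleton_le_iff_mem]
      have : g Q ∣ gg := Finset.dvd_prod_of_mem g (hfin.mem_toFinset.2 hQ)
      exact Ideal.mem_of_dvd _ this (hg' Q hQ hQP)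
  obtain ⟨k, hk⟩ := Ideal.exists_radical_pow_le_of_fg (IGG G) (IsNoetherian.noetherian _)
  refine ⟨gg ^ k, ⟨k, fun x hx => ?_⟩, fun h => hgg ((inferInstance : (P0 p).IsPrime).mem_of_pow_mem _ h)⟩
  apply hk
  apply Ideal.pow_right_mono hle k
  rw [mul_pow, mul_comm x]
  exact Ideal.mul_mem_mul (Ideal.pow_mem_pow (Ideal.mem_span_singleton_self _) _) hx

variable (c : ℂ)

omit H in
lemma IGG_le_I2 : (IGG G).map (algebraMap _ (OO p c)) ≤ I2 G p c := Ideal.map_mono (le_satI _ _)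

omit H in
lemma JJ_le_I2 : (JJ G).map (algebraMap _ (OO p c)) ≤ I2 G p c :=
  (Ideal.map_mono le_sup_left).trans (IGG_le_I2 c)

omit H in
lemma G_mem_I2 : toO p c G ∈ I2 G p c :=
  IGG_le_I2 c (Ideal.mem_map_of_mem _ (mem_sup_span _ _))

lemma I2_arc (ψ : OO p c →ₐ[ℂ] PS) (hψ : IsArc ψ) (I : Ideal (OO p c)) (hI : ∀ a ∈ I, ψ a = 0)
    (hI2 : I2 G p c ≤ I) (h : arcCo (pt p 0 c) ψ (Sum.inr 1) = PowerSeries.C c ∨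
      arcCo (pt p 0 c) ψ (Sum.inr 0) = 0 ∨ arcCo (pt p 0 c) ψ (Sum.inl j) = 0) (w : VV n) :
    arcCo (pt p 0 c) ψ w = PowerSeries.C (pt p 0 c w) := by
  obtain ⟨v, hv, hv'⟩ := exists_v H
  exact U4 H c _ (arc_hγ hψ) (arc_hJ ψ _ hI ((JJ_le_I2 c).trans hI2))
    (arc_hf ψ _ hI _ (hI2 (G_mem_I2 c))) v hv'
    (arc_hf ψ _ hI _ (hI2 (Ideal.mem_map_of_mem _ hv))) h w

lemma fin_I2t : Module.Finite ℂ (OO p c ⧸ (I2 G p c ⊔ Ideal.span {toO p c (tauV c)})) := by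
  apply finite_OO
  intro ψ hψ hI
  exact I2_arc H c ψ hψ _ hI le_sup_left (Or.inl (arc_ht ψ _ hI (mem_sup_span _ _)))

lemma fin_I2s : Module.Finite ℂ (OO p c ⧸ (I2 G p c ⊔ Ideal.span {toO p c sV})) := by
  apply finite_OO
  intro ψ hψ hI
  exact I2_arc H c ψ hψ _ hI le_sup_left (Or.inr (Or.inl (arc_hs ψ _ hI (mem_sup_span _ _))))

lemma fin_I2z : Module.Finite ℂ (OO p c ⧸ (I2 G p c ⊔ Ideal.span {toO p c (X (Sum.inl j))})) := by
  apply finite_OO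
  intro ψ hψ hI
  exact I2_arc H c ψ hψ _ hI le_sup_left (Or.inr (Or.inr (arc_hz ψ _ hI _ (mem_sup_span _ _))))

lemma nzd_tau_I2 (a : OO p c) (ha : a * toO p c (tauV c) ∈ I2 G p c) : a ∈ I2 G p c :=
  satI_nzd _ _ _ _ (nzd_tau_IG H c) a ha

omit H in
lemma pow_nzd {R : Type*} [CommRing R] (I : Ideal R) (w : R) (hw : ∀ a, a * w ∈ I → a ∈ I) :
    ∀ k, ∀ a, a * w ^ k ∈ I → a ∈ I := by
  intro k
  induction k with
  | zero => intro a ha; simpa using ha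
  | succ k ih =>
    intro a ha
    apply ih
    apply hw
    rwa [mul_assoc, ← pow_succ]

omit H in
lemma mem_max_z (hp : p j = 0) :
    toO p c (X (Sum.inl j)) ∈ IsLocalRing.maximalIdeal (OO p c) :=
  (mem_max_OPt _ _).2 (by simp [hp])

/-- `s` is a nonzerodivisor on the polar curve -/
lemma nzd_s_I2 (a : OO p c) (ha : a * toO p c sV ∈ I2 G p c) : a ∈ I2 G p c := by
  by_contra hcon
  -- max^k ≤ I2 + (s), so tau^k ∈ I2 + (s)
  obtain ⟨k, hk⟩ := pow_le_of_finite _ _ (fin_I2s H c)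
  have h1 : toO p c (tauV c) ^ k ∈ I2 G p c ⊔ Ideal.span {toO p c sV} :=
    hk (Ideal.pow_mem_pow mem_max_tau k)
  apply hcon
  apply pow_nzd _ _ (nzd_tau_I2 H c) k
  obtain ⟨x, hx, y, hy, hxy⟩ := Submodule.mem_sup.1 h1
  obtain ⟨y, rfl⟩ := Ideal.mem_span_singleton'.1 hy
  rw [← hxy, mul_add]
  apply Ideal.add_mem
  · exact Ideal.mul_mem_left _ _ hx
  · rw [show a * (y * toO p c sV) = y * (a * toO p c sV) by ring]
    exact Ideal.mul_mem_left _ _ ha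

lemma strict (hpos : 0 < Module.finrank ℂ (OO p c ⧸ (I2 G p c ⊔ Ideal.span {toO p c (tauV c)}))) :
    Module.finrank ℂ (OO p c ⧸ (I2 G p c ⊔ Ideal.span {toO p c (tauV c)})) <
      Module.finrank ℂ (OO p c ⧸ (I2 G p c ⊔ Ideal.span {toO p c sV})) := by
  obtain ⟨q, hq⟩ := pow_le_of_finite _ _ (fin_I2t H c)
  have hz : toO p c (X (Sum.inl j)) ^ q ∈ I2 G p c ⊔ Ideal.span {toO p c (tauV c)} :=
    hq (Ideal.pow_mem_pow (mem_max_z c H.pj) q)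
  obtain ⟨x, hx, y, hy, hxy⟩ := Submodule.mem_sup.1 hz
  obtain ⟨y, rfl⟩ := Ideal.mem_span_singleton'.1 hy
  have ft := finite_pow _ _ (fin_I2t H c) (q + 1)
  have fs := finite_pow _ _ (fin_I2s H c) q
  have key := mult_ineq_arc (mPt (pt p 0 c)) (I2 G p c) (toO p c (tauV c) ^ (q + 1))
    (toO p c sV ^ q) (Ideal.pow_mem_of_mem _ mem_max_tau _ (Nat.succ_pos _))
    (pow_nzd _ _ (nzd_tau_I2 H c) (q + 1)) ft.1 fs.1 (by
      intro ψ hψ hI _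
      have e4 := T4 H c _ (arc_hγ hψ) (arc_hJ ψ _ hI (JJ_le_I2 c)) (arc_hf ψ _ hI _ (G_mem_I2 c))
      have ez : q • (arcCo (pt p 0 c) ψ (Sum.inl j)).order ≥ (ψ (toO p c (tauV c))).order := by
        have h1 : ψ (toO p c (X (Sum.inl j)) ^ q) = ψ y * ψ (toO p c (tauV c)) := by
          rw [← hxy, map_add, hI x hx, zero_add, map_mul]
        rw [map_pow] at h1
        have h2 := congrArg PowerSeries.order h1
        rw [PowerSeries.order_pow, PowerSeries.order_mul] at h2
        change q • (ψ (toO p c (X (Sum.inl j)))).order ≥ _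
        rw [h2]
        exact le_add_self
      rw [map_pow, map_pow, PowerSeries.order_pow, PowerSeries.order_pow]
      change _ ≤ q • (arcCo (pt p 0 c) ψ (Sum.inr 0)).order
      rw [← arc_tau] at e4
      rw [e4, nsmul_add, succ_nsmul', nsmul_left_comm]
      gcongr
      refine ez.trans ?_
      obtain ⟨d', rfl⟩ : ∃ d', d = d' + 1 := ⟨d - 1, by have := H.d1; omega⟩
      rw [succ_nsmul]
      exact le_add_self)
  rw [finrank_pow _ _ (nzd_tau_I2 H c) (fin_I2t H c)] at key
  have := key.trans fs.2
  by_contra hcon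
  push Not at hcon
  nlinarith [Nat.mul_le_mul_left q hcon]

/-- an element `f` not vanishing at the point with `f s^k ∈ I + (z)`. -/
lemma exists_sz : ∃ k, toO p c sV ^ k ∈ I2 G p c ⊔ Ideal.span {toO p c (X (Sum.inl j))} := by
  obtain ⟨k, hk⟩ := pow_le_of_finite _ _ (fin_I2z H c)
  exact ⟨k, hk (Ideal.pow_mem_pow mem_max_s k)⟩

end LocG2

/-- specialisation of a polynomial over `ℂ[X]` at a point. -/
def spec (f : Polynomial (Polynomial ℂ)) (c : ℂ) : Polynomial ℂ :=
  f.map (Polynomial.evalRingHom c)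

lemma tendsto_eval_spec (f : Polynomial (Polynomial ℂ)) (y : ℂ) :
    Tendsto (fun c => (spec f c).eval y) (𝓝 0) (𝓝 ((spec f 0).eval y)) := by
  have : Continuous fun c => (spec f c).eval y := by
    unfold spec
    simp only [Polynomial.eval_map, Polynomial.eval₂_eq_sum_range, Polynomial.coe_evalRingHom]
    fun_prop
  exact this.tendsto 0

/-- roots of a monic family are locally bounded. -/
lemma spec_root_bound (f : Polynomial (Polynomial ℂ)) (hf : f.Monic) :
    ∃ M : ℝ, ∀ c z : ℂ, ‖c‖ ≤ 1 → (spec f c).eval z = 0 → ‖z‖ ≤ M := by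
  have hc : ∀ i, ∃ M : ℝ, ∀ c : ℂ, ‖c‖ ≤ 1 → ‖(f.coeff i).eval c‖ ≤ M := by
    intro i
    obtain ⟨M, hM⟩ := (isCompact_closedBall (0:ℂ) 1).exists_bound_of_continuousOn
      (f := fun c => (f.coeff i).eval c) (by fun_prop)
    exact ⟨M, fun c hc => hM c (by simpa using hc)⟩
  choose M hM using hc
  have hM0 : ∀ i, 0 ≤ M i := fun i => (norm_nonneg _).trans (hM i 0 (by simp))
  refine ⟨1 + ∑ i ∈ Finset.range f.natDegree, M i, fun c z hcn hz => ?_⟩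
  by_contra hlt
  push Not at hlt
  have hS : 0 ≤ ∑ i ∈ Finset.range f.natDegree, M i := Finset.sum_nonneg fun i _ => hM0 i
  have hz1 : 1 < ‖z‖ := by linarith
  unfold spec at hz
  rw [Polynomial.eval_map, Polynomial.eval₂_eq_sum_range, Finset.sum_range_succ,
    Polynomial.Monic.coeff_natDegree hf] at hz
  simp only [Polynomial.coe_evalRingHom, Polynomial.eval_one, one_mul] at hz
  have h1 : ‖z‖ ^ f.natDegree ≤ ∑ i ∈ Finset.range f.natDegree, M i * ‖z‖ ^ i := by
    have : z ^ f.natDegree = -∑ i ∈ Finset.range f.natDegree, (f.coeff i).eval c * z ^ i := by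
      linear_combination hz
    rw [← norm_pow, this, norm_neg]
    refine (norm_sum_le _ _).trans (Finset.sum_le_sum fun i _ => ?_)
    rw [norm_mul, norm_pow]
    exact mul_le_mul_of_nonneg_right (hM i c hcn) (by positivity)
  rcases Nat.eq_zero_or_pos f.natDegree with h0 | h0
  · rw [h0] at h1; simp at h1; linarith
  have h2 : ∑ i ∈ Finset.range f.natDegree, M i * ‖z‖ ^ i ≤
      (∑ i ∈ Finset.range f.natDegree, M i) * ‖z‖ ^ (f.natDegree - 1) := by
    rw [Finset.sum_mul]
    refine Finset.sum_le_sum fun i hi => mul_le_mul_of_nonneg_left ?_ (hM0 i)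
    exact pow_le_pow_right₀ hz1.le (by have := Finset.mem_range.mp hi; omega)
  have h3 : ‖z‖ ^ f.natDegree = ‖z‖ * ‖z‖ ^ (f.natDegree - 1) := by
    rw [← pow_succ']; congr 1; omega
  have h4 : (0:ℝ) < ‖z‖ ^ (f.natDegree - 1) := by positivity
  have h5 := h1.trans h2
  rw [h3] at h5
  have := le_of_mul_le_mul_right h5 h4
  linarith

/-- an ultrafilter limit of a bounded function exists. -/
lemma ultra_lim {α : Type*} (U : Ultrafilter α) (u : α → ℂ) (M : ℝ)
    (h : ∀ᶠ x in (U : Filter α), ‖u x‖ ≤ M) : ∃ l, Tendsto u U (𝓝 l) := by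
  have := (isCompact_closedBall (0:ℂ) M).ultrafilter_le_nhds (U.map u)
    (by
      have : {x | ‖u x‖ ≤ M} ∈ U := h
      rw [le_principal_iff]
      refine Filter.mem_of_superset (x := {x | ‖u x‖ ≤ M}) this fun x hx => ?_
      simpa using hx)
  obtain ⟨l, -, hl⟩ := this
  exact ⟨l, hl⟩

open Classical in
lemma root_cont (f : Polynomial (Polynomial ℂ)) (hf : f.Monic) {η : ℝ} (hη : 0 < η) :
    ∀ᶠ c in 𝓝 (0:ℂ), (spec f 0).rootMultiplicity 0 ≤
      Multiset.card ((spec f c).roots.filter fun z => ‖z‖ < η) := by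
  by_contra hcon
  have hfr : ∃ᶠ c in 𝓝 (0:ℂ), ¬ ((spec f 0).rootMultiplicity 0 ≤
      Multiset.card ((spec f c).roots.filter fun z => ‖z‖ < η)) := by
    rwa [Filter.not_eventually] at hcon
  rw [frequently_iff_neBot] at hfr
  haveI := hfr
  set U : Ultrafilter ℂ := Ultrafilter.of (𝓝 (0:ℂ) ⊓ 𝓟 {c | ¬ ((spec f 0).rootMultiplicity 0 ≤
      Multiset.card ((spec f c).roots.filter fun z => ‖z‖ < η))}) with hU
  have hUle := Ultrafilter.of_le (𝓝 (0:ℂ) ⊓ 𝓟 {c | ¬ ((spec f 0).rootMultiplicity 0 ≤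
      Multiset.card ((spec f c).roots.filter fun z => ‖z‖ < η))})
  rw [← hU] at hUle
  have hU0 : (U : Filter ℂ) ≤ 𝓝 0 := hUle.trans inf_le_left
  have hUbad : ∀ᶠ c in (U : Filter ℂ), ¬ ((spec f 0).rootMultiplicity 0 ≤
      Multiset.card ((spec f c).roots.filter fun z => ‖z‖ < η)) :=
    (hUle.trans inf_le_right) (by simp)
  set D := f.natDegree with hD
  have hmon : ∀ c, (spec f c).Monic := fun c => hf.map _
  have hcard : ∀ c, Multiset.card (spec f c).roots = D := by
    intro c
    rw [IsAlgClosed.card_roots_eq_natDegree]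
    exact hf.natDegree_map _
  have hρ : ∀ c, ∃ ρ : Fin D → ℂ, (spec f c).roots = Multiset.map ρ Finset.univ.val := by
    intro c
    obtain ⟨l, hl⟩ := Quot.exists_rep (spec f c).roots
    have hl' : (l : Multiset ℂ) = (spec f c).roots := hl
    have hlen : l.length = D := by rw [← hcard c, ← hl']; simp
    refine ⟨fun i => l.get (Fin.cast hlen.symm i), ?_⟩
    rw [← hl']
    clear_value D
    subst hlen
    simp
  choose ρ hρ using hρ
  obtain ⟨M, hM⟩ := spec_root_bound f hf
  have hball : ∀ᶠ c in (U : Filter ℂ), ‖c‖ ≤ 1 := by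
    apply hU0
    filter_upwards [Metric.ball_mem_nhds (0:ℂ) one_pos] with c hc
    rw [mem_ball_zero_iff] at hc
    exact hc.le
  have hroot : ∀ c i, (spec f c).eval (ρ c i) = 0 := by
    intro c i
    have : ρ c i ∈ (spec f c).roots := by rw [hρ c]; simp
    exact (Polynomial.mem_roots'.mp this).2
  have hlim : ∀ i, ∃ l, Tendsto (fun c => ρ c i) U (𝓝 l) := fun i =>
    ultra_lim U _ M (hball.mono fun c hc => hM c _ hc (hroot c i))
  choose l hl using hlim
  have hprod : ∀ c, spec f c = ∏ i, (Polynomial.X - Polynomial.C (ρ c i)) := by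
    intro c
    have := (IsAlgClosed.splits (spec f c)).eq_prod_roots_of_monic (hmon c)
    rw [this, hρ c, Multiset.map_map]
    rfl
  have h0 : spec f 0 = ∏ i, (Polynomial.X - Polynomial.C (l i)) := by
    apply Polynomial.funext
    intro y
    have t1 : Tendsto (fun c => (spec f c).eval y) U (𝓝 ((spec f 0).eval y)) :=
      (tendsto_eval_spec f y).mono_left hU0
    have t2 : Tendsto (fun c => (spec f c).eval y) U (𝓝 (∏ i, (y - l i))) := by
      simp only [hprod, Polynomial.eval_prod, Polynomial.eval_sub, Polynomial.eval_X,
        Polynomial.eval_C]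
      exact tendsto_finsetProd _ fun i _ => tendsto_const_nhds.sub (hl i)
    rw [tendsto_nhds_unique t1 t2, Polynomial.eval_prod]
    simp
  have hr0 : (spec f 0).rootMultiplicity 0 = (Finset.univ.filter fun i => l i = 0).card := by
    rw [← Polynomial.count_roots, h0, Polynomial.roots_prod _ _
      (Finset.prod_ne_zero_iff.mpr fun i _ => Polynomial.X_sub_C_ne_zero _)]
    simp only [Polynomial.roots_X_sub_C, Multiset.bind_singleton]
    rw [Multiset.count_map, Finset.card_def, Finset.filter_val]
    simp only [eq_comm]
  have hev : ∀ᶠ c in (U : Filter ℂ), ∀ i, l i = 0 → ‖ρ c i‖ < η := by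
    rw [eventually_all]
    intro i
    by_cases hi : l i = 0
    · have := (hl i).norm
      rw [hi, norm_zero] at this
      filter_upwards [this.eventually (gt_mem_nhds hη)] with c hc _ using hc
    · exact Eventually.of_forall fun c h => absurd h hi
  obtain ⟨c, hc1, hc2⟩ := (hUbad.and hev).exists
  apply hc1
  rw [hr0, hρ c, Multiset.filter_map, Multiset.card_map, ← Finset.filter_val, ← Finset.card_def]
  exact Finset.card_le_card fun i hi => by
    simp only [Finset.mem_filter, Finset.mem_univ, true_and, Function.comp] at hi ⊢
    exact hc2 i hi

section NearFar

/-- the kernel of a product of generalised eigen-factors is at least the sum of multiplicities -/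
lemma ker_near {V : Type*} [AddCommGroup V] [Module ℂ V] [FiniteDimensional ℂ V]
    (T : Module.End ℂ V) (R : Finset ℂ) :
    ∑ ρ ∈ R, T.charpoly.rootMultiplicity ρ ≤ Module.finrank ℂ (LinearMap.ker (Polynomial.aeval T
      (∏ ρ ∈ R, (Polynomial.X - Polynomial.C ρ) ^ (Module.finrank ℂ V)))) := by
  classical
  have hind : iSupIndep (fun ρ : R => T.maxGenEigenspace ρ.1) :=
    (Module.End.independent_maxGenEigenspace T).comp Subtype.val_injective
  have hinj := hind.dfinsupp_lsum_injective
  set Φ : (Π₀ ρ : R, T.maxGenEigenspace ρ.1) →ₗ[ℂ] V :=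
    DFinsupp.lsum ℕ (fun ρ : R => (T.maxGenEigenspace ρ.1).subtype) with hΦ
  have hle : LinearMap.range Φ ≤ LinearMap.ker (Polynomial.aeval T
      (∏ ρ ∈ R, (Polynomial.X - Polynomial.C ρ) ^ (Module.finrank ℂ V))) := by
    rintro _ ⟨x, rfl⟩
    induction x using DFinsupp.induction with
    | h0 => simp
    | ha ρ b f _ _ ih =>
      rw [map_add]
      refine Submodule.add_mem _ ?_ ih
      have : Φ (DFinsupp.single ρ b) = b.1 := by simp [hΦ]
      rw [this, LinearMap.mem_ker, ← Finset.prod_erase_mul _ _ ρ.2, map_mul,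
        Module.End.mul_apply]
      have hb : ((b : V)) ∈ T.maxGenEigenspace ρ.1 := b.2
      generalize (b : V) = b' at hb ⊢
      rw [Module.End.maxGenEigenspace_eq_genEigenspace_finrank, Module.End.mem_genEigenspace_nat] at hb
      have h2 : Polynomial.aeval T ((Polynomial.X - Polynomial.C ρ.1) ^ (Module.finrank ℂ V)) =
          (T - ρ.1 • 1) ^ (Module.finrank ℂ V) := by
        simp [Algebra.algebraMap_eq_smul_one]
      rw [h2, LinearMap.mem_ker.mp hb, map_zero]
  calc ∑ ρ ∈ R, T.charpoly.rootMultiplicity ρ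
      = ∑ ρ : R, Module.finrank ℂ (T.maxGenEigenspace ρ.1) := by
        rw [← Finset.sum_coe_sort]
        exact Finset.sum_congr rfl fun ρ _ => (LinearMap.finrank_maxGenEigenspace_eq T ρ.1).symm
    _ = Module.finrank ℂ (Π₀ ρ : R, T.maxGenEigenspace ρ.1) :=
        (Module.finrank_directSum (R := ℂ) (fun ρ : R => T.maxGenEigenspace ρ.1)).symm
    _ = Module.finrank ℂ (LinearMap.range Φ) := (LinearMap.finrank_range_of_inj hinj).symm
    _ ≤ _ := Submodule.finrank_mono hle

lemma ker_pow_le {V : Type*} [AddCommGroup V] [Module ℂ V] [FiniteDimensional ℂ V]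
    (T : Module.End ℂ V) (k : ℕ) :
    Module.finrank ℂ (LinearMap.ker (T ^ k)) ≤ T.charpoly.rootMultiplicity 0 := by
  rw [← LinearMap.finrank_maxGenEigenspace_eq]
  refine Submodule.finrank_mono fun x hx => ?_
  rw [Module.End.mem_maxGenEigenspace]
  exact ⟨k, by simpa using hx⟩

variable {S : Type*} [CommRing S] [Algebra ℂ S] [Algebra (Polynomial ℂ) S]
  [IsScalarTower ℂ (Polynomial ℂ) S] [Module.Finite (Polynomial ℂ) S]

/-- the parameter -/
local notation "sP" => algebraMap (Polynomial ℂ) S Polynomial.X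

omit [Module.Finite (Polynomial ℂ) S] in
lemma algHom_poly (q : S →ₐ[ℂ] ℂ) (f : Polynomial ℂ) :
    q (algebraMap (Polynomial ℂ) S f) = f.eval (q sP) := by
  have : (q.comp (IsScalarTower.toAlgHom ℂ (Polynomial ℂ) S)) = Polynomial.aeval (q sP) := by
    apply Polynomial.algHom_ext
    simp
  have h := DFunLike.congr_fun this f
  simpa [Polynomial.coe_aeval_eq_eval] using h

lemma algHom_root (g : S) : ∃ f : Polynomial (Polynomial ℂ), f.Monic ∧
    ∀ q : S →ₐ[ℂ] ℂ, (spec f (q sP)).eval (q g) = 0 := by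
  obtain ⟨f, hf, h0⟩ := Algebra.IsIntegral.isIntegral (R := Polynomial ℂ) g
  refine ⟨f, hf, fun q => ?_⟩
  have h1 := congrArg q h0
  rw [map_zero] at h1
  have h2 : (q : S →+* ℂ).comp (algebraMap (Polynomial ℂ) S) =
      Polynomial.evalRingHom (q sP) := by
    apply RingHom.ext
    intro f
    exact algHom_poly q f
  have h3 := Polynomial.hom_eval₂ f (algebraMap (Polynomial ℂ) S) (q : S →+* ℂ) g
  rw [h2] at h3
  rw [spec, Polynomial.eval_map]
  exact h3.symm.trans h1

lemma hom_lim (q0 : S →ₐ[ℂ] ℂ) (θ : S)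
    (hθ : ∀ q : S →ₐ[ℂ] ℂ, q sP = 0 → q θ = 0 → q = q0) (g : S) {η : ℝ} (hη : 0 < η) :
    ∃ κ > (0:ℝ), ∀ q : S →ₐ[ℂ] ℂ, ‖q sP‖ < κ → ‖q θ‖ < κ → ‖q g - q0 g‖ < η := by
  by_contra hcon
  push Not at hcon
  have hseq : ∀ m : ℕ, ∃ q : S →ₐ[ℂ] ℂ, ‖q sP‖ < 1 / ((m:ℝ) + 1) ∧ ‖q θ‖ < 1 / ((m:ℝ) + 1) ∧
      η ≤ ‖q g - q0 g‖ := by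
    intro m
    obtain ⟨q, h1, h2, h3⟩ := hcon (1 / ((m:ℝ) + 1)) (by positivity)
    exact ⟨q, h1, h2, h3⟩
  choose q hq1 hq2 hq3 using hseq
  let U : Ultrafilter ℕ := Ultrafilter.of atTop
  have hU : (U : Filter ℕ) ≤ atTop := Ultrafilter.of_le _
  have hz : Tendsto (fun m : ℕ => 1 / ((m:ℝ) + 1)) U (𝓝 0) :=
    tendsto_one_div_add_atTop_nhds_zero_nat.mono_left hU
  have ts : Tendsto (fun m => q m sP) U (𝓝 0) :=
    squeeze_zero_norm (fun m => (hq1 m).le) hz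
  have tθ : Tendsto (fun m => q m θ) U (𝓝 0) :=
    squeeze_zero_norm (fun m => (hq2 m).le) hz
  have hlim : ∀ x : S, ∃ l, Tendsto (fun m => q m x) U (𝓝 l) := by
    intro x
    obtain ⟨f, hf, hr⟩ := algHom_root x
    obtain ⟨M, hM⟩ := spec_root_bound f hf
    refine ultra_lim U _ M (Eventually.of_forall fun m => hM _ _ ?_ (hr (q m)))
    refine (hq1 m).le.trans ?_
    rw [div_le_one (by positivity)]
    have : (0:ℝ) ≤ m := Nat.cast_nonneg m
    linarith
  choose l hl using hlim
  have hc : ∀ c : ℂ, l (algebraMap ℂ S c) = c := fun c =>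
    tendsto_nhds_unique (hl _) (by simp)
  let Q : S →ₐ[ℂ] ℂ :=
    { toFun := l
      map_one' := tendsto_nhds_unique (hl _) (by simp)
      map_zero' := tendsto_nhds_unique (hl _) (by simp)
      map_add' := fun x y => tendsto_nhds_unique (hl _) (by simpa using (hl x).add (hl y))
      map_mul' := fun x y => tendsto_nhds_unique (hl _) (by simpa using (hl x).mul (hl y))
      commutes' := hc }
  have hQ : Q = q0 := hθ Q (tendsto_nhds_unique (hl _) ts) (tendsto_nhds_unique (hl _) tθ)
  have hg : Tendsto (fun m => ‖q m g - q0 g‖) U (𝓝 0) := by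
    have h1 : Tendsto (fun m => q m g) U (𝓝 (q0 g)) := by rw [← hQ]; exact hl g
    simpa using (h1.sub_const (q0 g)).norm
  have := ge_of_tendsto hg (Eventually.of_forall hq3)
  linarith

lemma fin_quot_s (c : ℂ) : Module.Finite ℂ (S ⧸ Ideal.span {sP - algebraMap ℂ S c}) := by
  classical
  set J := Ideal.span {sP - algebraMap ℂ S c}
  obtain ⟨t, ht⟩ := (Module.finite_def.mp ‹Module.Finite (Polynomial ℂ) S›)
  refine ⟨⟨t.image (Ideal.Quotient.mk J), ?_⟩⟩
  rw [eq_top_iff]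
  rintro x -
  obtain ⟨y, rfl⟩ := Ideal.Quotient.mk_surjective x
  have hy : y ∈ Submodule.span (Polynomial ℂ) (t : Set S) := by rw [ht]; trivial
  induction hy using Submodule.span_induction with
  | mem x hx => exact Submodule.subset_span (by simpa using ⟨x, hx, rfl⟩)
  | zero => simp
  | add x y _ _ h1 h2 => rw [map_add]; exact Submodule.add_mem _ h1 h2
  | smul f x _ h1 =>
    have : Ideal.Quotient.mk J (f • x) = (f.eval c) • Ideal.Quotient.mk J x := by
      rw [Algebra.smul_def, map_mul, Algebra.smul_def]
      congr 1
      have h2 : (algebraMap ℂ (S ⧸ J)) (f.eval c) = Ideal.Quotient.mk J (algebraMap ℂ S (f.eval c)) := rfl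
      rw [h2, Ideal.Quotient.eq, Ideal.mem_span_singleton, IsScalarTower.algebraMap_apply ℂ (Polynomial ℂ) S,
        IsScalarTower.algebraMap_apply ℂ (Polynomial ℂ) S, ← map_sub, ← map_sub]
      apply map_dvd
      rw [Polynomial.algebraMap_eq]
      exact Polynomial.X_sub_C_dvd_sub_C_eval
    rw [this]
    exact Submodule.smul_mem _ _ h1

lemma exists_theta (q0 : S →ₐ[ℂ] ℂ) :
    ∃ θ : S, q0 θ = 0 ∧ ∀ q : S →ₐ[ℂ] ℂ, q sP = 0 → q θ = 0 → q = q0 := by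
  classical
  haveI := fin_quot_s (S := S) 0
  set J : Ideal S := Ideal.span {sP - algebraMap ℂ S 0} with hJ
  have hfin : {q : S →ₐ[ℂ] ℂ | q sP = 0}.Finite := by
    haveI : Finite ((S ⧸ J) →ₐ[ℂ] ℂ) := (minpoly.AlgHom.fintype ℂ (S ⧸ J) ℂ).finite
    refine (Set.finite_range (fun φ : (S ⧸ J) →ₐ[ℂ] ℂ => φ.comp (Ideal.Quotient.mkₐ ℂ J))).subset ?_
    intro q hq
    refine ⟨Ideal.Quotient.liftₐ J q ?_, ?_⟩
    · intro a ha
      rw [hJ, Ideal.mem_span_singleton] at ha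
      obtain ⟨b, rfl⟩ := ha
      rw [map_mul, map_sub, (show q sP = 0 from hq)]
      simp
    · ext x; rfl
  have hkm : ∀ q q' : S →ₐ[ℂ] ℂ, RingHom.ker q ≤ RingHom.ker q' → q' = q := by
    intro q q' h
    ext x
    have h1 : x - algebraMap ℂ S (q x) ∈ RingHom.ker q := by simp [RingHom.mem_ker]
    have h2 := h h1
    rw [RingHom.mem_ker, map_sub, sub_eq_zero] at h2
    simpa using h2
  by_contra hcon
  push Not at hcon
  have hsub : (RingHom.ker q0 : Set S) ⊆ ⋃ q ∈ ((hfin.toFinset.erase q0 : Finset _) : Set (S →ₐ[ℂ] ℂ)),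
      (RingHom.ker q : Set S) := by
    intro θ hθ
    obtain ⟨q, h1, h2, h3⟩ := hcon θ hθ
    simp only [Set.mem_iUnion]
    exact ⟨q, by simp [h1, h3], h2⟩
  obtain ⟨q, hq, hle⟩ := (Ideal.subset_union_prime (f := fun q : S →ₐ[ℂ] ℂ => RingHom.ker q)
    q0 q0 (fun q _ _ _ => RingHom.ker_isPrime q)).mp hsub
  have := hkm _ _ hle
  simp [this] at hq

end NearFar

section NearFar2

variable {S : Type*} [CommRing S] [Algebra ℂ S] [Algebra (Polynomial ℂ) S]
  [IsScalarTower ℂ (Polynomial ℂ) S]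

local notation "sP" => algebraMap (Polynomial ℂ) S Polynomial.X

variable {D : ℕ} (e : Module.Basis (Fin D) (Polynomial ℂ) S)

/-- specialisation of coordinates at `c` -/
def spc (c : ℂ) : S →ₗ[ℂ] (Fin D → ℂ) where
  toFun x i := (e.repr x i).eval c
  map_add' x y := by ext i; simp
  map_smul' a x := by
    ext i
    rw [← algebraMap_smul (Polynomial ℂ) a x]
    simp

lemma spc_surj (c : ℂ) : Function.Surjective (spc e c) := by
  intro v
  refine ⟨∑ i, (Polynomial.C (v i)) • e i, ?_⟩
  ext i
  simp only [spc, LinearMap.coe_mk, AddHom.coe_mk]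
  rw [e.repr_sum_self]
  simp

lemma spc_ker (c : ℂ) (x : S) : spc e c x = 0 ↔ x ∈ Ideal.span {sP - algebraMap ℂ S c} := by
  have hsc : sP - algebraMap ℂ S c = algebraMap (Polynomial ℂ) S (Polynomial.X - Polynomial.C c) := by
    rw [map_sub, IsScalarTower.algebraMap_apply ℂ (Polynomial ℂ) S]; rfl
  rw [hsc, Ideal.mem_span_singleton]
  constructor
  · intro h
    have hd : ∀ i, ∃ g, e.repr x i = (Polynomial.X - Polynomial.C c) * g := fun i =>
      Polynomial.dvd_iff_isRoot.mpr (congrFun h i)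
    choose g hg using hd
    refine ⟨∑ i, g i • e i, ?_⟩
    rw [← Algebra.smul_def, Finset.smul_sum]
    conv_lhs => rw [← e.sum_repr x]
    exact Finset.sum_congr rfl fun i _ => by rw [hg i, mul_smul]
  · rintro ⟨y, rfl⟩
    ext i
    rw [← Algebra.smul_def]
    simp [spc]

/-- the specialised multiplication operator -/
def spT (θ : S) (c : ℂ) : Module.End ℂ (Fin D → ℂ) :=
  Matrix.toLin' ((Algebra.leftMulMatrix e θ).map (Polynomial.evalRingHom c))

lemma spc_mul (θ : S) (c : ℂ) (x : S) : spc e c (θ * x) = spT e θ c (spc e c x) := by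
  ext i
  have h := congrFun (Algebra.leftMulMatrix_mulVec_repr e θ x) i
  simp only [spc, spT, LinearMap.coe_mk, AddHom.coe_mk, Matrix.toLin'_apply]
  rw [← h]
  simp [Matrix.mulVec, dotProduct, Polynomial.eval_finset_sum]

lemma spc_aeval (θ : S) (c : ℂ) (h : Polynomial ℂ) (x : S) :
    spc e c (Polynomial.aeval θ h * x) = Polynomial.aeval (spT e θ c) h (spc e c x) := by
  induction h using Polynomial.induction_on generalizing x with
  | C a => simp [Algebra.algebraMap_eq_smul_one]
  | add p q h1 h2 => simp [add_mul, h1, h2]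
  | monomial n a ih =>
    have : Polynomial.aeval θ (Polynomial.C a * Polynomial.X ^ (n+1)) * x =
      Polynomial.aeval θ (Polynomial.C a * Polynomial.X ^ n) * (θ * x) := by
      simp only [map_mul, map_pow, Polynomial.aeval_X]; ring
    rw [this, ih, spc_mul, pow_succ, ← mul_assoc, map_mul _ _ Polynomial.X, Polynomial.aeval_X]
    rfl

lemma spT_charpoly (θ : S) (c : ℂ) :
    (spT e θ c).charpoly = spec (Algebra.leftMulMatrix e θ).charpoly c := by
  rw [spT, Matrix.charpoly_toLin', Matrix.charpoly_map]; rfl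

/-- the ideal `(s-c, h(θ))` -/
def nearI (θ : S) (c : ℂ) (h : Polynomial ℂ) : Ideal S :=
  Ideal.span {sP - algebraMap ℂ S c} ⊔ Ideal.span {Polynomial.aeval θ h}

include e in
lemma nearI_dim (θ : S) (c : ℂ) (h : Polynomial ℂ) :
    Module.Finite ℂ (S ⧸ nearI θ c h) ∧ Module.finrank ℂ (S ⧸ nearI θ c h) =
      Module.finrank ℂ (LinearMap.ker (Polynomial.aeval (spT e θ c) h)) := by
  set T := Polynomial.aeval (spT e θ c) h with hT
  let Φ : S →ₗ[ℂ] ((Fin D → ℂ) ⧸ LinearMap.range T) := (LinearMap.range T).mkQ ∘ₗ spc e c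
  have hs : Function.Surjective Φ := (Submodule.mkQ_surjective _).comp (spc_surj e c)
  have hk : LinearMap.ker Φ = (nearI θ c h).restrictScalars ℂ := by
    ext x
    simp only [LinearMap.mem_ker, Submodule.restrictScalars_mem, Φ, LinearMap.comp_apply,
      Submodule.mkQ_apply, Submodule.Quotient.mk_eq_zero, LinearMap.mem_range]
    constructor
    · rintro ⟨v, hv⟩
      obtain ⟨y, rfl⟩ := spc_surj e c v
      rw [hT, ← spc_aeval, ← sub_eq_zero, ← map_sub, spc_ker] at hv
      have : x = -(Polynomial.aeval θ h * y - x) + Polynomial.aeval θ h * y := by ring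
      rw [this]
      exact Ideal.add_mem _ (neg_mem (Ideal.mem_sup_left hv))
        (Ideal.mem_sup_right (Ideal.mul_mem_right _ _ (Ideal.mem_span_singleton_self _)))
    · intro hx
      obtain ⟨a, ha, b, hb, rfl⟩ := Submodule.mem_sup.mp hx
      obtain ⟨y, rfl⟩ := Ideal.mem_span_singleton.mp hb
      refine ⟨spc e c y, ?_⟩
      rw [map_add, (spc_ker e c a).mpr ha, zero_add, spc_aeval]
  let E : (S ⧸ nearI θ c h) ≃ₗ[ℂ] ((Fin D → ℂ) ⧸ LinearMap.range T) :=
    (Submodule.Quotient.restrictScalarsEquiv ℂ (nearI θ c h)).symm.trans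
      ((Submodule.quotEquivOfEq _ _ hk.symm).trans (Φ.quotKerEquivOfSurjective hs))
  refine ⟨Module.Finite.equiv E.symm, ?_⟩
  rw [E.finrank_eq]
  have h1 := LinearMap.finrank_range_add_finrank_ker T
  have h2 := Submodule.finrank_quotient_add_finrank (LinearMap.range T)
  omega

variable [Module.Finite (Polynomial ℂ) S] [Module.IsTorsionFree (Polynomial ℂ) S]

open Classical in
theorem near_core (q0 : S →ₐ[ℂ] ℂ) (N k : ℕ)
    (hN : N ≤ Module.finrank ℂ (S ⧸ (RingHom.ker q0 ^ k ⊔ Ideal.span {sP})))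
    (Gs : Finset S) {η : ℝ} (hη : 0 < η) :
    ∃ ε > (0:ℝ), ∀ c : ℂ, ‖c‖ < ε → ∃ L : Ideal S, sP - algebraMap ℂ S c ∈ L ∧
      Module.Finite ℂ (S ⧸ L) ∧ N ≤ Module.finrank ℂ (S ⧸ L) ∧
      ∀ q : S →ₐ[ℂ] ℂ, (∀ x ∈ L, q x = 0) → ∀ g ∈ Gs, ‖q g - q0 g‖ < η := by
  obtain ⟨θ, hθ0, hθ⟩ := exists_theta q0
  have e : Module.Basis (Fin (Module.finrank (Polynomial ℂ) S)) (Polynomial ℂ) S :=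
    Module.finBasis (Polynomial ℂ) S
  have hκ : ∃ κ > (0:ℝ), ∀ q : S →ₐ[ℂ] ℂ, ‖q sP‖ < κ → ‖q θ‖ < κ →
      ∀ g ∈ Gs, ‖q g - q0 g‖ < η := by
    induction Gs using Finset.induction_on with
    | empty => exact ⟨1, one_pos, by simp⟩
    | insert a t _ ih =>
      obtain ⟨κ1, h1, h1'⟩ := ih
      obtain ⟨κ2, h2, h2'⟩ := hom_lim q0 θ hθ a hη
      refine ⟨min κ1 κ2, lt_min h1 h2, fun q hs ht g hg => ?_⟩
      rcases Finset.mem_insert.mp hg with rfl | hg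
      · exact h2' q (hs.trans_le (min_le_right _ _)) (ht.trans_le (min_le_right _ _))
      · exact h1' q (hs.trans_le (min_le_left _ _)) (ht.trans_le (min_le_left _ _)) g hg
  obtain ⟨κ, hκ0, hκ⟩ := hκ
  set χ := (Algebra.leftMulMatrix e θ).charpoly with hχ
  have hχm : χ.Monic := Matrix.charpoly_monic _
  obtain ⟨ε1, hε1, hroot⟩ := Metric.eventually_nhds_iff.mp (root_cont χ hχm hκ0)
  refine ⟨min ε1 κ, lt_min hε1 hκ0, fun c hc => ?_⟩
  have hc1 := hroot (y := c) (by simpa using hc.trans_le (min_le_left _ _))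
  have hc2 : ‖c‖ < κ := hc.trans_le (min_le_right _ _)
  set R : Finset ℂ := ((spec χ c).roots.filter fun z => ‖z‖ < κ).toFinset with hR
  set h : Polynomial ℂ := ∏ ρ ∈ R, (Polynomial.X - Polynomial.C ρ) ^
    (Module.finrank ℂ (Fin (Module.finrank (Polynomial ℂ) S) → ℂ)) with hh
  have hRsum : Multiset.card ((spec χ c).roots.filter fun z => ‖z‖ < κ) =
      ∑ ρ ∈ R, (spec χ c).rootMultiplicity ρ := by
    rw [← Multiset.toFinset_sum_count_eq]
    refine Finset.sum_congr rfl fun ρ hρ => ?_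
    rw [hR, Multiset.mem_toFinset, Multiset.mem_filter] at hρ
    rw [Multiset.count_filter, if_pos hρ.2, Polynomial.count_roots]
  obtain ⟨f1, d1⟩ := nearI_dim e θ c h
  obtain ⟨f0, d0⟩ := nearI_dim e θ 0 (Polynomial.X ^ k)
  refine ⟨nearI θ c h, Ideal.mem_sup_left (Ideal.mem_span_singleton_self _), f1, ?_, ?_⟩
  · have hN1 : N ≤ Module.finrank ℂ (S ⧸ nearI θ 0 (Polynomial.X ^ k)) := by
      refine hN.trans (quot_finrank_mono ?_ f0)
      refine sup_le ?_ ?_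
      · rw [Ideal.span_singleton_le_iff_mem, map_zero, sub_zero]
        exact Ideal.mem_sup_right (Ideal.mem_span_singleton_self _)
      · rw [Ideal.span_singleton_le_iff_mem, map_pow, Polynomial.aeval_X]
        exact Ideal.mem_sup_left (Ideal.pow_mem_pow hθ0 k)
    rw [d0, map_pow, Polynomial.aeval_X] at hN1
    have h2 := ker_pow_le (spT e θ 0) k
    have h3 := ker_near (spT e θ c) R
    rw [spT_charpoly] at h2 h3
    rw [d1]
    rw [hRsum] at hc1
    exact hN1.trans (h2.trans (hc1.trans h3))
  · intro q hq g hg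
    have hqs : q sP = c := by
      have := hq _ (Ideal.mem_sup_left (Ideal.mem_span_singleton_self _))
      rw [map_sub, sub_eq_zero] at this
      simpa using this
    refine hκ q (by rw [hqs]; exact hc2) ?_ g hg
    have := hq _ (Ideal.mem_sup_right (Ideal.mem_span_singleton_self _))
    rw [← Polynomial.aeval_algHom_apply, Polynomial.coe_aeval_eq_eval, hh,
      Polynomial.eval_prod, Finset.prod_eq_zero_iff] at this
    obtain ⟨ρ, hρ, h0⟩ := this
    have h1 : q θ = ρ := by
      rw [Polynomial.eval_pow] at h0
      have := eq_zero_of_pow_eq_zero h0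
      simpa [sub_eq_zero] using this
    rw [h1]
    rw [hR, Multiset.mem_toFinset, Multiset.mem_filter] at hρ
    exact hρ.2

end NearFar2

section ConsNum

variable {B : Type} [CommRing B] [IsNoetherianRing B] [Algebra ℂ B] [Algebra (Polynomial ℂ) B]
  [IsScalarTower ℂ (Polynomial ℂ) B] [Algebra.FiniteType (Polynomial ℂ) B]
  [Algebra.FiniteType ℂ B]

local notation "sB" => algebraMap (Polynomial ℂ) B Polynomial.X

lemma ratPt_ker {A : Type} [CommRing A] [Algebra ℂ A] (q : A →ₐ[ℂ] ℂ) : RatPt (RingHom.ker q) :=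
  fun a => ⟨q a, by simp [RingHom.mem_ker]⟩

lemma zmt_B (q0 : B →ₐ[ℂ] ℂ) (hs : q0 sB = 0) (k : ℕ)
    (hq : ∀ f ∈ RingHom.ker q0 ^ k, ∃ h, q0 h ≠ 0 ∧ h * f ∈ Ideal.span {sB}) :
    ∃ r : B, q0 r ≠ 0 ∧ IsIntegral (Polynomial ℂ) r ∧
      ∀ x, ∃ m, IsIntegral (Polynomial ℂ) (r ^ m * x) := by
  set q : Ideal B := RingHom.ker q0 with hqd
  haveI : q.IsPrime := RingHom.ker_isPrime q0
  set I : Ideal (Localization.AtPrime q) :=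
    (q.under (Polynomial ℂ)).map (algebraMap (Polynomial ℂ) (Localization.AtPrime q)) with hI
  have hsI : algebraMap B (Localization.AtPrime q) sB ∈ I := by
    rw [← IsScalarTower.algebraMap_apply (Polynomial ℂ) B]
    exact Ideal.mem_map_of_mem _ hs
  have hle : IsLocalRing.maximalIdeal (Localization.AtPrime q) ^ k ≤ I := by
    rw [max_eq_map, ← Ideal.map_pow, Ideal.map_le_iff_le_comap]
    intro f hf
    obtain ⟨h, h0, hh⟩ := hq f hf
    obtain ⟨b, hb⟩ := Ideal.mem_span_singleton.mp hh
    have hu : IsUnit (algebraMap B (Localization.AtPrime q) h) :=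
      IsLocalization.map_units (M := q.primeCompl) _ ⟨h, h0⟩
    rw [Ideal.mem_comap]
    refine (Ideal.unit_mul_mem_iff_mem I hu).mp ?_
    rw [← map_mul, hb, map_mul]
    exact Ideal.mul_mem_right _ _ hsI
  haveI : Module.Finite ℂ (Localization.AtPrime q ⧸ I) := finite_of_pow_le q (ratPt_ker q0) I k hle
  haveI : Module.Finite (Polynomial ℂ) (Localization.AtPrime q ⧸ I) :=
    Module.Finite.of_restrictScalars_finite ℂ (Polynomial ℂ) _
  haveI : Algebra.WeaklyQuasiFiniteAt (Polynomial ℂ) q :=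
    (Algebra.weaklyQuasiFiniteAt_iff (R := Polynomial ℂ) q).mpr inferInstance
  obtain ⟨r, h1, h2, h3⟩ := Algebra.zariskisMainProperty_iff.mp
    (Algebra.ZariskisMainProperty.of_finiteType_of_weaklyQuasiFiniteAt (R := Polynomial ℂ) q)
  exact ⟨r, h1, h2, h3⟩

/-- a nonunit of a finite dimensional algebra is killed by some point -/
lemma exists_hom_of_not_unit {Q : Type*} [CommRing Q] [Algebra ℂ Q] [Module.Finite ℂ Q] (x : Q)
    (hx : ¬ IsUnit x) : ∃ q : Q →ₐ[ℂ] ℂ, q x = 0 := by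
  obtain ⟨M, hM, hxM⟩ := exists_max_ideal_of_mem_nonunits hx
  letI : Field (Q ⧸ M) := Ideal.Quotient.field M
  haveI : Module.Finite ℂ (Q ⧸ M) := inferInstance
  haveI : Algebra.IsAlgebraic ℂ (Q ⧸ M) := Algebra.IsAlgebraic.of_finite ℂ (Q ⧸ M)
  let φ : (Q ⧸ M) →ₐ[ℂ] ℂ := IsAlgClosed.lift
  refine ⟨φ.comp (Ideal.Quotient.mkₐ ℂ M), ?_⟩
  have : Ideal.Quotient.mkₐ ℂ M x = 0 := Ideal.Quotient.eq_zero_iff_mem.mpr hxM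
  rw [AlgHom.comp_apply, this, map_zero]

theorem cons_num [Module.IsTorsionFree (Polynomial ℂ) B] {σ : Type} [Finite σ] (g : σ → B)
    (hg : Algebra.adjoin ℂ (Set.range g) = ⊤)
    (q0 : B →ₐ[ℂ] ℂ) (hs : q0 sB = 0) (k : ℕ)
    (hq : ∀ f ∈ RingHom.ker q0 ^ k, ∃ h, q0 h ≠ 0 ∧ h * f ∈ Ideal.span {sB})
    (N : ℕ) (hN : N ≤ Module.finrank ℂ (B ⧸ (RingHom.ker q0 ^ k ⊔ Ideal.span {sB})))
    {δ : ℝ} (hδ : 0 < δ) :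
    ∃ ε > (0:ℝ), ∀ c : ℂ, ‖c‖ < ε → ∃ K : Ideal B, sB - algebraMap ℂ B c ∈ K ∧
      Module.Finite ℂ (B ⧸ K) ∧ N ≤ Module.finrank ℂ (B ⧸ K) ∧
      ∀ q : B →ₐ[ℂ] ℂ, (∀ x ∈ K, q x = 0) → ∀ v, ‖q (g v) - q0 (g v)‖ < δ := by
  classical
  haveI := Fintype.ofFinite σ
  obtain ⟨r, hr0, hri, hrm⟩ := zmt_B q0 hs k hq
  choose m hm using fun v => hrm (g v)
  set T : Finset B := insert r (Finset.univ.image fun v => r ^ m v * g v) with hT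
  let S : Subalgebra (Polynomial ℂ) B := Algebra.adjoin (Polynomial ℂ) (T : Set B)
  have hSd : S = Algebra.adjoin (Polynomial ℂ) (T : Set B) := rfl
  haveI : Module.Finite (Polynomial ℂ) S := by
    refine Algebra.finite_adjoin_of_finite_of_isIntegral T.finite_toSet ?_
    intro x hx
    simp only [hT, Finset.coe_insert, Finset.coe_image, Finset.coe_univ, Set.image_univ,
      Set.mem_insert_iff, Set.mem_range] at hx
    rcases hx with rfl | ⟨v, rfl⟩
    · exact hri
    · exact hm v
  have hTS : ∀ x ∈ T, x ∈ S := fun x hx => Algebra.subset_adjoin hx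
  let rS : S := ⟨r, hTS r (Finset.mem_insert_self _ _)⟩
  let gS : σ → S := fun v => ⟨r ^ m v * g v, hTS _ (Finset.mem_insert_of_mem
    (Finset.mem_image_of_mem _ (Finset.mem_univ v)))⟩
  clear_value S
  have hpow : ∀ x : B, ∃ M, ∃ y : S, r ^ M * x = y := by
    intro x
    have hx : x ∈ Algebra.adjoin ℂ (Set.range g) := by rw [hg]; trivial
    induction hx using Algebra.adjoin_induction with
    | mem x hx => obtain ⟨v, rfl⟩ := hx; exact ⟨m v, gS v, rfl⟩
    | algebraMap c => exact ⟨0, algebraMap ℂ S c, by simp⟩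
    | add x y _ _ h1 h2 =>
      obtain ⟨M1, y1, h1⟩ := h1
      obtain ⟨M2, y2, h2⟩ := h2
      refine ⟨M1 + M2, rS ^ M2 * y1 + rS ^ M1 * y2, ?_⟩
      push_cast
      rw [← h1, ← h2]
      change _ = r ^ M2 * _ + r ^ M1 * _
      ring
    | mul x y _ _ h1 h2 =>
      obtain ⟨M1, y1, h1⟩ := h1
      obtain ⟨M2, y2, h2⟩ := h2
      refine ⟨M1 + M2, y1 * y2, ?_⟩
      push_cast
      rw [← h1, ← h2]
      ring
  let ι : S →ₐ[ℂ] B := S.val.restrictScalars ℂ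
  have hι : ∀ x : S, ι x = x := fun _ => rfl
  let q1 : S →ₐ[ℂ] ℂ := q0.comp ι
  set sS : S := algebraMap (Polynomial ℂ) S Polynomial.X with hsS
  have hsSB : (sS : B) = sB := rfl
  -- comparison of the central fibres
  set J0 : Ideal B := RingHom.ker q0 ^ k ⊔ Ideal.span {sB} with hJ0
  set J1 : Ideal S := RingHom.ker q1 ^ k ⊔ Ideal.span {sS} with hJ1
  have hJ10 : ∀ x ∈ J1, (x : B) ∈ J0 := by
    have : J1 ≤ J0.comap ι := by
      refine sup_le ?_ ?_
      · have : RingHom.ker q1 ≤ (RingHom.ker q0).comap ι := fun x hx => hx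
        refine (Ideal.pow_right_mono this k).trans ((Ideal.le_comap_pow _ _).trans ?_)
        exact Ideal.comap_mono le_sup_left
      · rw [Ideal.span_singleton_le_iff_mem]
        exact Ideal.mem_sup_right (Ideal.mem_span_singleton_self _)
    exact this
  have hu0 : ∃ u : S, r * u - 1 ∈ J0 := by
    set ρ := q0 r with hρ
    obtain ⟨w, hw⟩ := sub_dvd_pow_sub_pow (algebraMap ℂ S ρ) (algebraMap ℂ S ρ - rS) k
    rw [sub_sub_cancel] at hw
    refine ⟨algebraMap ℂ S (ρ ^ k)⁻¹ * w, ?_⟩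
    have h1 : (algebraMap ℂ S ρ - rS) ^ k ∈ J1 := by
      refine Ideal.mem_sup_left (Ideal.pow_mem_pow ?_ k)
      rw [RingHom.mem_ker, map_sub]
      change q1 (algebraMap ℂ S ρ) - q0 r = 0
      rw [AlgHom.commutes]; simp [hρ]
    have h2 : rS * (algebraMap ℂ S (ρ ^ k)⁻¹ * w) - 1 =
        - (algebraMap ℂ S (ρ ^ k)⁻¹ * (algebraMap ℂ S ρ - rS) ^ k) := by
      have h3 : algebraMap ℂ S (ρ ^ k)⁻¹ * (algebraMap ℂ S ρ) ^ k = 1 := by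
        rw [← map_pow (algebraMap ℂ S), ← map_mul, inv_mul_cancel₀ (pow_ne_zero _ hr0), map_one]
      linear_combination (-algebraMap ℂ S (ρ ^ k)⁻¹) * hw + h3
    have h4 : rS * (algebraMap ℂ S (ρ ^ k)⁻¹ * w) - 1 ∈ J1 := by
      rw [h2]; exact neg_mem (Ideal.mul_mem_left _ _ h1)
    exact hJ10 _ h4
  -- general surjectivity
  have hsurj : ∀ J : Ideal B, (∃ u : S, r * u - 1 ∈ J) → ∀ x : B, ∃ y : S, x - y ∈ J := by
    rintro J ⟨u, hu⟩ x
    obtain ⟨M, y, hy⟩ := hpow x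
    refine ⟨u ^ M * y, ?_⟩
    have : x - ((u ^ M * y : S) : B) = - (((r * u) ^ M - 1 ^ M) * x) := by
      push_cast; rw [← hy]; ring
    rw [this]
    refine neg_mem (Ideal.mul_mem_right _ _ ?_)
    obtain ⟨z, hz⟩ := sub_dvd_pow_sub_pow (r * (u : B)) 1 M
    rw [hz]
    exact Ideal.mul_mem_right _ _ hu
  have hfin1 : Module.Finite ℂ (S ⧸ J1) := by
    refine quot_finite_mono ?_ (fin_quot_s (S := S) 0)
    rw [map_zero, sub_zero]
    exact le_sup_right
  have hN1 : N ≤ Module.finrank ℂ (S ⧸ J1) := by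
    refine hN.trans ?_
    let Φ : (S ⧸ J1) →ₐ[ℂ] (B ⧸ J0) := Ideal.quotientMapₐ J0 ι (fun x hx => hJ10 x hx)
    have hΦ : Function.Surjective Φ := by
      intro z
      obtain ⟨x, rfl⟩ := Ideal.Quotient.mk_surjective z
      obtain ⟨y, hy⟩ := hsurj J0 hu0 x
      refine ⟨Ideal.Quotient.mk J1 y, ?_⟩
      change Ideal.Quotient.mk J0 (y : B) = _
      exact (Ideal.Quotient.eq.mpr hy).symm
    exact LinearMap.finrank_le_finrank_of_surjective (f := Φ.toLinearMap) hΦ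
  -- choice of the size of the neighbourhood
  have hη : ∃ η > (0:ℝ), ∀ v, ∀ a b : ℂ, ‖a - q1 rS‖ < η → ‖b - q1 (gS v)‖ < η → a ≠ 0 ∧
      ‖b / a ^ m v - q0 (g v)‖ < δ := by
    have hv : ∀ v, ∃ η > (0:ℝ), ∀ a b : ℂ, ‖a - q1 rS‖ < η → ‖b - q1 (gS v)‖ < η →
        ‖b / a ^ m v - q0 (g v)‖ < δ := by
      intro v
      have hval : q1 (gS v) / (q1 rS) ^ m v = q0 (g v) := by
        change q0 (r ^ m v * g v) / (q0 r) ^ m v = _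
        rw [map_mul, map_pow, mul_div_cancel_left₀ _ (pow_ne_zero _ hr0)]
      have hc : ContinuousAt (fun w : ℂ × ℂ => w.2 / w.1 ^ m v) (q1 rS, q1 (gS v)) := by
        refine ContinuousAt.div continuousAt_snd (continuousAt_fst.pow _) ?_
        exact pow_ne_zero _ hr0
      obtain ⟨η, h1, h2⟩ := Metric.continuousAt_iff.mp hc δ hδ
      refine ⟨η, h1, fun a b ha hb => ?_⟩
      have := h2 (x := (a, b)) (by
        rw [Prod.dist_eq, max_lt_iff, dist_eq_norm, dist_eq_norm]; exact ⟨ha, hb⟩)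
      rwa [dist_eq_norm, hval] at this
    choose η h1 h2 using hv
    refine ⟨(insert ‖q1 rS‖ (Finset.univ.image η)).min' (Finset.insert_nonempty _ _), ?_, ?_⟩
    · rw [gt_iff_lt, Finset.lt_min'_iff]
      intro y hy
      rcases Finset.mem_insert.mp hy with rfl | hy
      · exact norm_pos_iff.mpr hr0
      · obtain ⟨v, -, rfl⟩ := Finset.mem_image.mp hy
        exact h1 v
    · intro v a b ha hb
      have l1 := Finset.min'_le (insert ‖q1 rS‖ (Finset.univ.image η)) _ (Finset.mem_insert_self _ _)
      have l2 := Finset.min'_le (insert ‖q1 rS‖ (Finset.univ.image η)) (η v)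
        (Finset.mem_insert_of_mem (Finset.mem_image_of_mem _ (Finset.mem_univ v)))
      refine ⟨?_, h2 v a b (ha.trans_le l2) (hb.trans_le l2)⟩
      rintro rfl
      rw [zero_sub, norm_neg] at ha
      exact absurd (ha.trans_le l1) (lt_irrefl _)
  obtain ⟨η, hη0, hη⟩ := hη
  obtain ⟨ε, hε, hmain⟩ := near_core q1 N k hN1 (insert rS (Finset.univ.image gS))
    (lt_min hη0 (norm_pos_iff.mpr hr0))
  refine ⟨ε, hε, fun c hc => ?_⟩
  obtain ⟨L, hL1, hL2, hL3, hL4⟩ := hmain c hc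
  have hru : IsUnit (Ideal.Quotient.mk L rS) := by
    by_contra hnu
    obtain ⟨q, hq⟩ := exists_hom_of_not_unit _ hnu
    have h := hL4 (q.comp (Ideal.Quotient.mkₐ ℂ L)) (fun x hx => by
      rw [AlgHom.comp_apply]
      have : Ideal.Quotient.mkₐ ℂ L x = 0 := Ideal.Quotient.eq_zero_iff_mem.mpr hx
      rw [this, map_zero]) rS (Finset.mem_insert_self _ _)
    have h0 : (q.comp (Ideal.Quotient.mkₐ ℂ L)) rS = 0 := hq
    rw [h0, zero_sub, norm_neg] at h
    exact absurd (h.trans_le (min_le_right _ _)) (lt_irrefl _)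
  have hcancel : ∀ M (x : S), rS ^ M * x ∈ L → x ∈ L := by
    intro M x hx
    rw [← Ideal.Quotient.eq_zero_iff_mem, map_mul, map_pow] at hx
    rw [← Ideal.Quotient.eq_zero_iff_mem]
    exact (hru.pow M).mul_right_eq_zero.mp hx
  obtain ⟨u, hu⟩ : ∃ u : S, rS * u - 1 ∈ L := by
    obtain ⟨w, hw⟩ := hru.exists_right_inv
    obtain ⟨u, rfl⟩ := Ideal.Quotient.mk_surjective w
    refine ⟨u, ?_⟩
    rw [← Ideal.Quotient.eq, map_mul, hw, map_one]
  let K : Ideal B :=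
    { carrier := {x | ∃ M, ∃ y ∈ L, r ^ M * x = (y : S)}
      zero_mem' := ⟨0, 0, L.zero_mem, by simp⟩
      add_mem' := by
        rintro x x' ⟨M1, y1, hy1, h1⟩ ⟨M2, y2, hy2, h2⟩
        refine ⟨M1 + M2, rS ^ M2 * y1 + rS ^ M1 * y2,
          L.add_mem (L.mul_mem_left _ hy1) (L.mul_mem_left _ hy2), ?_⟩
        push_cast
        rw [← h1, ← h2]
        change _ = r ^ M2 * _ + r ^ M1 * _
        ring
      smul_mem' := by
        rintro b x ⟨M1, y1, hy1, h1⟩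
        obtain ⟨M2, y2, h2⟩ := hpow b
        refine ⟨M1 + M2, y2 * y1, L.mul_mem_left _ hy1, ?_⟩
        push_cast
        rw [← h1, ← h2, smul_eq_mul]
        ring }
  have hLK : ∀ x : S, (x : B) ∈ K ↔ x ∈ L := by
    intro x
    constructor
    · rintro ⟨M, y, hy, h⟩
      refine hcancel M x ?_
      have : rS ^ M * x = y := Subtype.ext h
      rwa [this]
    · intro hx
      exact ⟨0, x, hx, by simp⟩
  let Ψ : (S ⧸ L) →ₐ[ℂ] (B ⧸ K) := Ideal.quotientMapₐ K ι (fun x hx => (hLK x).mpr hx)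
  have hΨ : ∀ x : S, Ψ (Ideal.Quotient.mk L x) = Ideal.Quotient.mk K (x : B) := fun _ => rfl
  have hΨb : Function.Bijective Ψ := by
    constructor
    · rw [injective_iff_map_eq_zero]
      intro z hz
      obtain ⟨x, rfl⟩ := Ideal.Quotient.mk_surjective z
      rw [hΨ, Ideal.Quotient.eq_zero_iff_mem, hLK] at hz
      exact Ideal.Quotient.eq_zero_iff_mem.mpr hz
    · intro z
      obtain ⟨x, rfl⟩ := Ideal.Quotient.mk_surjective z
      obtain ⟨y, hy⟩ := hsurj K ⟨u, (hLK (rS * u - 1)).mpr hu⟩ x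
      exact ⟨Ideal.Quotient.mk L y, by rw [hΨ]; exact (Ideal.Quotient.eq.mpr hy).symm⟩
  let E : (S ⧸ L) ≃ₗ[ℂ] (B ⧸ K) := LinearEquiv.ofBijective Ψ.toLinearMap hΨb
  refine ⟨K, (hLK (sS - algebraMap ℂ S c)).mpr hL1, Module.Finite.equiv E, by rwa [← E.finrank_eq], ?_⟩
  intro q hqK v
  have hq := hL4 (q.comp ι) (fun x hx => hqK _ ((hLK x).mpr hx))
  have h1 := (hq rS (Finset.mem_insert_self _ _)).trans_le (min_le_left _ _)
  have h2 := (hq (gS v) (Finset.mem_insert_of_mem (Finset.mem_image_of_mem _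
    (Finset.mem_univ v)))).trans_le (min_le_left _ _)
  obtain ⟨h3, h4⟩ := hη v _ _ h1 h2
  have h5 : (q.comp ι) (gS v) / (q.comp ι) rS ^ m v = q (g v) := by
    change q (r ^ m v * g v) / (q r) ^ m v = _
    have h3' : q r ≠ 0 := h3
    rw [map_mul, map_pow, mul_div_cancel_left₀ _ (pow_ne_zero _ h3')]
  rwa [h5] at h4

end ConsNum

section ConsNumA
variable {σ : Type} [Finite σ] (a0 : σ → ℂ)

lemma map_comap_O (I : Ideal (OPt a0)) :
    (I.comap (algebraMap (MvPolynomial σ ℂ) (OPt a0))).map (algebraMap (MvPolynomial σ ℂ) (OPt a0)) = I :=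
  IsLocalization.map_under (mPt a0).primeCompl _ I

lemma mem_sup_O (I : Ideal (OPt a0)) (s f : MvPolynomial σ ℂ)
    (h : algebraMap _ (OPt a0) f ∈ I ⊔ Ideal.span {algebraMap _ (OPt a0) s}) :
    ∃ g, eval a0 g ≠ 0 ∧
      g * f ∈ I.comap (algebraMap (MvPolynomial σ ℂ) (OPt a0)) ⊔ Ideal.span {s} := by
  have : I ⊔ Ideal.span {algebraMap _ (OPt a0) s} =
      (I.comap (algebraMap (MvPolynomial σ ℂ) (OPt a0)) ⊔ Ideal.span {s}).map
        (algebraMap (MvPolynomial σ ℂ) (OPt a0)) := by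
    rw [Ideal.map_sup, map_comap_O, Ideal.map_span, Set.image_singleton]
  rw [this, IsLocalization.algebraMap_mem_map_algebraMap_iff (mPt a0).primeCompl] at h
  obtain ⟨g, hg, h⟩ := h
  exact ⟨g, hg, h⟩

theorem cons_A (I : Ideal (OPt a0)) (hI : I ≤ IsLocalRing.maximalIdeal (OPt a0))
    (s : MvPolynomial σ ℂ) (hs : eval a0 s = 0)
    (hnzd : ∀ a, a * algebraMap _ (OPt a0) s ∈ I → a ∈ I)
    (hfin : Module.Finite ℂ (OPt a0 ⧸ (I ⊔ Ideal.span {algebraMap _ (OPt a0) s})))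
    {δ : ℝ} (hδ : 0 < δ) :
    ∃ ε > (0:ℝ), ∀ c : ℂ, ‖c‖ < ε → ∃ K : Ideal (MvPolynomial σ ℂ),
      I.comap (algebraMap (MvPolynomial σ ℂ) (OPt a0)) ≤ K ∧ s - C c ∈ K ∧
      Module.Finite ℂ (MvPolynomial σ ℂ ⧸ K) ∧
      Module.finrank ℂ (OPt a0 ⧸ (I ⊔ Ideal.span {algebraMap _ (OPt a0) s})) ≤
        Module.finrank ℂ (MvPolynomial σ ℂ ⧸ K) ∧
      ∀ a : σ → ℂ, (∀ f ∈ K, eval a f = 0) → ∀ v, ‖a v - a0 v‖ < δ := by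
  set L : MvPolynomial σ ℂ →+* OPt a0 := algebraMap (MvPolynomial σ ℂ) (OPt a0) with hL
  set IA : Ideal (MvPolynomial σ ℂ) := I.comap L with hIA
  let B := MvPolynomial σ ℂ ⧸ IA
  let π : MvPolynomial σ ℂ →ₐ[ℂ] B := Ideal.Quotient.mkₐ ℂ IA
  have hπs : Function.Surjective π := Ideal.Quotient.mkₐ_surjective ℂ IA
  have hπ0 : ∀ f, π f = 0 ↔ f ∈ IA := fun f => Ideal.Quotient.eq_zero_iff_mem
  letI : Algebra (Polynomial ℂ) B := (Polynomial.aeval (R := ℂ) (π s)).toAlgebra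
  have halg : ∀ f : Polynomial ℂ, algebraMap (Polynomial ℂ) B f = Polynomial.aeval (π s) f :=
    fun _ => rfl
  haveI : IsScalarTower ℂ (Polynomial ℂ) B := by
    refine IsScalarTower.of_algebraMap_eq fun x => ?_
    rw [halg, Polynomial.algebraMap_apply]
    simp
  haveI : Algebra.FiniteType ℂ B := Algebra.FiniteType.of_surjective π hπs
  haveI : IsNoetherianRing B := Algebra.FiniteType.isNoetherianRing ℂ B
  haveI : Algebra.FiniteType (Polynomial ℂ) B := Algebra.FiniteType.of_restrictScalars_finiteType ℂ _ _
  have hsB : algebraMap (Polynomial ℂ) B Polynomial.X = π s := by rw [halg, Polynomial.aeval_X]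
  have hLm : ∀ f, L f ∈ IsLocalRing.maximalIdeal (OPt a0) ↔ eval a0 f = 0 := mem_max_OPt a0
  have hIm : ∀ f ∈ IA, eval a0 f = 0 := fun f hf => (hLm f).mp (hI hf)
  haveI : Module.IsTorsionFree (Polynomial ℂ) B := by
    refine tf_of_linear ?_
    intro c w hw
    obtain ⟨f, rfl⟩ := hπs w
    rw [Algebra.smul_def, halg, map_sub, Polynomial.aeval_X, Polynomial.aeval_C,
      ← AlgHom.commutes π, ← map_sub, ← map_mul, hπ0] at hw
    rw [hπ0]
    have hw' : L (s - algebraMap ℂ _ c) * L f ∈ I := by rw [← map_mul]; exact hw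
    by_cases hc : c = 0
    · subst hc
      rw [map_zero, sub_zero, mul_comm (L s)] at hw'
      exact hnzd _ hw'
    · have hu : IsUnit (L (s - algebraMap ℂ _ c)) := by
        by_contra h
        have := (hLm _).mp ((IsLocalRing.mem_maximalIdeal _).mpr h)
        rw [map_sub, hs, zero_sub, neg_eq_zero, MvPolynomial.algebraMap_eq, eval_C] at this
        exact hc this
      exact (Ideal.unit_mul_mem_iff_mem I hu).mp hw'
  let q0 : B →ₐ[ℂ] ℂ := Ideal.Quotient.liftₐ IA (MvPolynomial.aeval a0) (by
    intro f hf
    rw [MvPolynomial.aeval_eq_eval]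
    exact hIm f hf)
  have hq0 : ∀ f, q0 (π f) = eval a0 f := fun f => by
    rw [← MvPolynomial.aeval_eq_eval]
    exact Ideal.Quotient.liftₐ_apply IA _ _ _
  have hker : ∀ x, x ∈ RingHom.ker q0 ↔ ∃ f ∈ mPt a0, π f = x := by
    intro x
    obtain ⟨f, rfl⟩ := hπs x
    constructor
    · intro h
      exact ⟨f, by rw [mem_mPt, ← hq0]; exact h, rfl⟩
    · rintro ⟨f', hf', h⟩
      rw [← h, RingHom.mem_ker, hq0]
      exact hf'
  have hkm : RingHom.ker q0 = (mPt a0).map π := by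
    ext x
    rw [hker, Ideal.mem_map_iff_of_surjective π hπs]
  obtain ⟨k, hk⟩ := pow_le_of_finite (mPt a0) _ hfin
  have hmk : ∀ f ∈ (mPt a0) ^ k, L f ∈ I ⊔ Ideal.span {L s} := by
    intro f hf
    apply hk
    rw [max_eq_map, ← Ideal.map_pow]
    exact Ideal.mem_map_of_mem _ hf
  have hq : ∀ f ∈ RingHom.ker q0 ^ k, ∃ h, q0 h ≠ 0 ∧
      h * f ∈ Ideal.span {algebraMap (Polynomial ℂ) B Polynomial.X} := by
    intro x hx
    rw [hkm, ← Ideal.map_pow, Ideal.mem_map_iff_of_surjective π hπs] at hx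
    obtain ⟨f, hf, rfl⟩ := hx
    obtain ⟨g, hg, hgf⟩ := mem_sup_O a0 I s f (hmk f hf)
    refine ⟨π g, by rw [hq0]; exact hg, ?_⟩
    rw [hsB, ← map_mul]
    have := Ideal.mem_map_of_mem π hgf
    rw [Ideal.map_sup, Ideal.map_span, Set.image_singleton] at this
    have h0 : Ideal.map π (Ideal.comap L I) = ⊥ := by
      rw [eq_bot_iff, Ideal.map_le_iff_le_comap]
      intro f hf
      exact (hπ0 f).mpr hf
    rwa [h0, bot_sup_eq] at this
  have hN : Module.finrank ℂ (OPt a0 ⧸ (I ⊔ Ideal.span {L s})) ≤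
      Module.finrank ℂ (B ⧸ (RingHom.ker q0 ^ k ⊔ Ideal.span {algebraMap (Polynomial ℂ) B Polynomial.X})) := by
    haveI : (RingHom.ker q0).IsPrime := RingHom.ker_isPrime q0
    haveI : Module.Finite ℂ (B ⧸ (RingHom.ker q0 ^ k)) :=
      finite_quot_pow (RingHom.ker q0) (ratPt_ker q0) k
    haveI : Module.Finite ℂ (B ⧸ (RingHom.ker q0 ^ k ⊔
        Ideal.span {algebraMap (Polynomial ℂ) B Polynomial.X})) :=
      quot_finite_mono le_sup_left this
    let L' : MvPolynomial σ ℂ →ₐ[ℂ] OPt a0 := IsScalarTower.toAlgHom ℂ _ _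
    let ψ : B →ₐ[ℂ] OPt a0 ⧸ (I ⊔ Ideal.span {L s}) :=
      Ideal.Quotient.liftₐ IA ((Ideal.Quotient.mkₐ ℂ _).comp L') (by
        intro f hf
        exact Ideal.Quotient.eq_zero_iff_mem.mpr (Ideal.mem_sup_left hf))
    have hψ : ∀ f, ψ (π f) = Ideal.Quotient.mk _ (L f) := fun f =>
      Ideal.Quotient.liftₐ_apply IA _ _ _
    let χ : (B ⧸ (RingHom.ker q0 ^ k ⊔ Ideal.span {algebraMap (Polynomial ℂ) B Polynomial.X})) →ₐ[ℂ]
        OPt a0 ⧸ (I ⊔ Ideal.span {L s}) :=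
      Ideal.Quotient.liftₐ _ ψ (by
        intro x hx
        have : RingHom.ker q0 ^ k ⊔ Ideal.span {algebraMap (Polynomial ℂ) B Polynomial.X} ≤
            RingHom.ker ψ := by
          rw [sup_le_iff, Ideal.span_singleton_le_iff_mem]
          constructor
          · intro x hx
            rw [hkm, ← Ideal.map_pow, Ideal.mem_map_iff_of_surjective π hπs] at hx
            obtain ⟨f, hf, rfl⟩ := hx
            rw [RingHom.mem_ker, hψ]
            exact Ideal.Quotient.eq_zero_iff_mem.mpr (hmk f hf)
          · rw [hsB, RingHom.mem_ker, hψ]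
            exact Ideal.Quotient.eq_zero_iff_mem.mpr (mem_sup_span _ _)
        exact this hx)
    refine LinearMap.finrank_le_finrank_of_surjective (f := χ.toLinearMap) ?_
    intro y
    obtain ⟨y, rfl⟩ := Ideal.Quotient.mk_surjective y
    obtain ⟨f, hf⟩ := loc_surj_of_finite (mPt a0) (ratPt_mPt a0) _ hfin y
    refine ⟨Ideal.Quotient.mk _ (π f), ?_⟩
    have : χ (Ideal.Quotient.mk _ (π f)) = ψ (π f) := Ideal.Quotient.liftₐ_apply _ _ _ _
    rw [AlgHom.toLinearMap_apply, this, hψ]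
    exact ((Ideal.Quotient.eq).mpr hf).symm
  have hadj : Algebra.adjoin ℂ (Set.range fun v => π (X v)) = ⊤ := by
    have : (Set.range fun v => π (X v)) = π '' Set.range X := by rw [← Set.range_comp]; rfl
    rw [this, ← AlgHom.map_adjoin, MvPolynomial.adjoin_range_X, Algebra.map_top]
    exact (AlgHom.range_eq_top π).mpr hπs
  obtain ⟨ε, hε, H⟩ := cons_num (fun v => π (X v)) hadj q0 (by rw [hsB, hq0]; exact hs) k hq _ hN hδ
  refine ⟨ε, hε, fun c hc => ?_⟩
  obtain ⟨K, h1, h2, h3, h4⟩ := H c hc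
  let e : (MvPolynomial σ ℂ ⧸ K.comap π) ≃ₐ[ℂ] (B ⧸ K) := by
    refine AlgEquiv.ofBijective (Ideal.quotientMapₐ K π le_rfl) ⟨?_, ?_⟩
    · exact Ideal.quotientMap_injective
    · exact Ideal.quotientMap_surjective (H := le_rfl) hπs
  refine ⟨K.comap π, ?_, ?_, ?_, ?_, ?_⟩
  · intro f hf
    rw [Ideal.mem_comap, (hπ0 f).mpr hf]
    exact K.zero_mem
  · rw [Ideal.mem_comap, map_sub, ← hsB, ← MvPolynomial.algebraMap_eq, AlgHom.commutes]
    exact h1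
  · exact Module.Finite.equiv e.symm.toLinearEquiv
  · rw [e.toLinearEquiv.finrank_eq]
    exact h3
  · intro a ha v
    have hIK : ∀ f ∈ IA, MvPolynomial.aeval a f = 0 := by
      intro f hf
      rw [MvPolynomial.aeval_eq_eval]
      refine ha f ?_
      rw [Ideal.mem_comap, (hπ0 f).mpr hf]
      exact K.zero_mem
    let q : B →ₐ[ℂ] ℂ := Ideal.Quotient.liftₐ IA (MvPolynomial.aeval a) hIK
    have hqa : ∀ f, q (π f) = eval a f := fun f => by
      rw [← MvPolynomial.aeval_eq_eval]
      exact Ideal.Quotient.liftₐ_apply IA _ _ _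
    have := h4 q (by
      intro x hx
      obtain ⟨f, rfl⟩ := hπs x
      rw [hqa]
      exact ha f hx) v
    simpa [hqa, hq0] using this

end ConsNumA

section ConsNumH
variable {n : ℕ} {G : MvPolynomial (VV n) ℂ} {j : Fin n} {d : ℕ} {p : Fin n → ℂ}

theorem cons_H (H : Hyp G j d p) (t0 : ℂ)
    (hpos : 0 < Module.finrank ℂ (OO p t0 ⧸ (I2 G p t0 ⊔ Ideal.span {toO p t0 (tauV t0)})))
    {δ : ℝ} (hδ : 0 < δ) :
    ∃ ε > (0:ℝ), ∀ c : ℂ, 0 < ‖c‖ → ‖c‖ < ε → ∃ K : Ideal (MvPolynomial (VV n) ℂ),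
      (∀ i, pderiv (Sum.inl i) G ∈ K) ∧ G ∈ K ∧ sV - C c ∈ K ∧
      Module.Finite ℂ (MvPolynomial (VV n) ℂ ⧸ K) ∧
      Module.finrank ℂ (OO p t0 ⧸ (I2 G p t0 ⊔ Ideal.span {toO p t0 sV})) ≤
        Module.finrank ℂ (MvPolynomial (VV n) ℂ ⧸ K) ∧
      ∀ a : VV n → ℂ, (∀ f ∈ K, eval a f = 0) →
        (∀ v, ‖a v - pt p 0 t0 v‖ < δ) ∧ a (Sum.inl j) ≠ 0 := by
  have hne : I2 G p t0 ≠ ⊤ := by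
    intro h
    rw [h, top_sup_eq] at hpos
    haveI : Subsingleton (OO p t0 ⧸ (⊤ : Ideal (OO p t0))) :=
      Ideal.Quotient.subsingleton_iff.mpr rfl
    rw [Module.finrank_zero_of_subsingleton] at hpos
    exact lt_irrefl _ hpos
  obtain ⟨k, hk⟩ := exists_sz H t0
  rw [← map_pow] at hk
  obtain ⟨g, hg, hgs⟩ := mem_sup_O (pt p 0 t0) (I2 G p t0) (X (Sum.inl j)) (sV ^ k) hk
  have hcont : Continuous fun a : VV n → ℂ => eval a g := MvPolynomial.continuous_eval g
  have hopen : {a : VV n → ℂ | eval a g ≠ 0} ∈ 𝓝 (pt p 0 t0) :=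
    (isOpen_ne_fun hcont continuous_const).mem_nhds hg
  obtain ⟨δ', hδ', hball⟩ := Metric.mem_nhds_iff.mp hopen
  obtain ⟨ε, hε, HK⟩ := cons_A (pt p 0 t0) (I2 G p t0) (IsLocalRing.le_maximalIdeal hne) sV
    (by simp) (nzd_s_I2 H t0) (fin_I2s H t0) (lt_min hδ hδ')
  refine ⟨ε, hε, fun c hc0 hc => ?_⟩
  obtain ⟨K, h1, h2, h3, h4, h5⟩ := HK c hc
  refine ⟨K, fun i => h1 ?_, h1 ?_, h2, h3, h4, fun a ha => ⟨fun v => ?_, fun hz => ?_⟩⟩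
  · exact JJ_le_I2 t0 (Ideal.mem_map_of_mem _ (Ideal.subset_span ⟨i, rfl⟩))
  · exact G_mem_I2 t0
  · exact lt_of_lt_of_le (h5 a ha v) (min_le_left _ _)
  · have hga : eval a g ≠ 0 := by
      apply hball
      rw [Metric.mem_ball, dist_pi_lt_iff hδ']
      intro v
      rw [dist_eq_norm]
      exact lt_of_lt_of_le (h5 a ha v) (min_le_right _ _)
    have hs : a (Sum.inr 0) = c := by
      have := ha _ h2
      rw [map_sub, eval_X, eval_C, sub_eq_zero] at this
      exact this
    have hle : Ideal.comap (algebraMap (MvPolynomial (VV n) ℂ) (OPt (pt p 0 t0))) (I2 G p t0) ⊔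
        Ideal.span {X (Sum.inl j)} ≤ mPt a := by
      rw [sup_le_iff, Ideal.span_singleton_le_iff_mem]
      exact ⟨fun f hf => ha f (h1 hf), by rw [mem_mPt, eval_X, hz]⟩
    have := hle hgs
    rw [mem_mPt, map_mul, map_pow, eval_X, hs] at this
    rcases mul_eq_zero.mp this with h | h
    · exact hga h
    · exact (norm_pos_iff.mp hc0) (eq_zero_of_pow_eq_zero h)

end ConsNumH

section Germ
variable {m : ℕ}

lemma ps_lowdeg (k : ℕ) (h : MvPowerSeries (Fin m) ℂ)
    (hh : MvPowerSeries.truncTotal k h ∈ idealOfVars (Fin m) ℂ ^ k) :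
    h ∈ (idealOfVars (Fin m) ℂ ^ k) •
      (⊤ : Submodule (MvPolynomial (Fin m) ℂ) (MvPowerSeries (Fin m) ℂ)) := by
  let e := (MvPowerSeries.toAdicCompletionAlgEquiv (Fin m) ℂ).toLinearEquiv
  have h1 : e h ∈ (AdicCompletion.eval (idealOfVars (Fin m) ℂ) (MvPolynomial (Fin m) ℂ) k).ker := by
    rw [LinearMap.mem_ker]
    have : AdicCompletion.eval (idealOfVars (Fin m) ℂ) (MvPolynomial (Fin m) ℂ) k (e h) =
      Submodule.Quotient.mk (MvPowerSeries.truncTotal k h) :=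
      MvPowerSeries.toAdicCompletion_apply_eq_mk_truncTotal
    rw [this, Submodule.Quotient.mk_eq_zero]
    simpa using hh
  rw [← AdicCompletion.pow_smul_top_eq_ker_eval (idealOfVars_fg _ _)] at h1
  have h2 := Submodule.mem_map_of_mem (f := e.symm.toLinearMap) h1
  rw [Submodule.map_smul''] at h2
  have h3 : e.symm.toLinearMap (e h) = h := e.symm_apply_apply h
  rw [h3] at h2
  exact Submodule.smul_mono le_rfl le_top h2

/-- translation to the point `a` -/
def Tr (a : Fin m → ℂ) : MvPolynomial (Fin m) ℂ →ₐ[ℂ] MvPolynomial (Fin m) ℂ :=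
  aeval (fun i => X i + C (a i))

lemma Tr_neg (a : Fin m → ℂ) (f) : Tr a (Tr (-a) f) = f := by
  have : (Tr a).comp (Tr (-a)) = AlgHom.id ℂ _ := by
    ext i : 1
    simp [Tr]
  exact DFunLike.congr_fun this f

lemma Tr_neg' (a : Fin m → ℂ) (f) : Tr (-a) (Tr a f) = f := by
  have := Tr_neg (-a) f
  rwa [neg_neg] at this

lemma Tr_const (a : Fin m → ℂ) (f) : constantCoeff (Tr a f) = eval a f := by
  have : (constantCoeff (σ := Fin m) (R := ℂ)).comp (Tr a : MvPolynomial (Fin m) ℂ →+* _) = eval a := by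
    apply MvPolynomial.ringHom_ext
    · intro c; simp [Tr]
    · intro i; simp [Tr]
  exact DFunLike.congr_fun this f

lemma mem_vars (f : MvPolynomial (Fin m) ℂ) : f ∈ idealOfVars (Fin m) ℂ ↔ constantCoeff f = 0 := by
  have := mem_pow_idealOfVars_iff' (σ := Fin m) (R := ℂ) 1 f
  rw [pow_one] at this
  rw [this, constantCoeff_eq]
  constructor
  · intro h; exact h 0 (by simp)
  · intro h x hx
    have : x = 0 := by
      rw [Nat.lt_one_iff] at hx
      exact (Finsupp.degree_eq_zero_iff x).mp hx
    rw [this]; exact h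

lemma map_Tr (a : Fin m → ℂ) (k : ℕ) : (mPt a ^ k).map (Tr a) = idealOfVars (Fin m) ℂ ^ k := by
  rw [Ideal.map_pow]
  congr 1
  have hs : Function.Surjective (Tr a) := fun f => ⟨_, Tr_neg a f⟩
  ext f
  rw [Ideal.mem_map_iff_of_surjective _ hs, mem_vars]
  constructor
  · rintro ⟨g, hg, rfl⟩
    rw [Tr_const]; exact hg
  · intro h
    refine ⟨Tr (-a) f, ?_, Tr_neg a f⟩
    rw [mem_mPt, ← Tr_const, Tr_neg]; exact h

lemma Tr_mem (a : Fin m → ℂ) (I : Ideal (MvPolynomial (Fin m) ℂ)) (f) (h : Tr a f ∈ I.map (Tr a)) : f ∈ I := by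
  have hs : Function.Surjective (Tr a) := fun f => ⟨_, Tr_neg a f⟩
  rw [Ideal.mem_map_iff_of_surjective _ hs] at h
  obtain ⟨g, hg, h⟩ := h
  have := congrArg (Tr (-a)) h
  rw [Tr_neg', Tr_neg'] at this
  rwa [← this]

/-- the power series expansion at `a` -/
def germ (a : Fin m → ℂ) : MvPolynomial (Fin m) ℂ →ₐ[ℂ] MvPowerSeries (Fin m) ℂ :=
  (MvPolynomial.coeToMvPowerSeries.algHom ℂ).comp (Tr a)

lemma germ_apply (a : Fin m → ℂ) (f) : germ a f = ((Tr a f : MvPolynomial (Fin m) ℂ) : MvPowerSeries (Fin m) ℂ) := by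
  simp [germ]

lemma germDim_eq (gs : Set (MvPolynomial (Fin m) ℂ)) (a : Fin m → ℂ) :
    germDim gs a = Module.finrank ℂ (MvPowerSeries (Fin m) ℂ ⧸ (Ideal.span gs).map (germ a)) := by
  unfold germDim
  have : (Ideal.span gs).map (germ a) = Ideal.span
    ((fun g => (MvPolynomial.coeToMvPowerSeries.ringHom
        (aeval (fun i => X i + C (a i)) g) : MvPowerSeries (Fin m) ℂ)) '' gs) := by
    rw [Ideal.map_span]
    congr 1
  rw [this]

theorem germ_core (gs : Set (MvPolynomial (Fin m) ℂ)) (a : Fin m → ℂ) (k : ℕ)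
    (hk : ∀ f ∈ mPt a ^ k, ∃ g, eval a g ≠ 0 ∧ g * f ∈ Ideal.span gs) :
    germDim gs a = Module.finrank ℂ (MvPolynomial (Fin m) ℂ ⧸ (Ideal.span gs ⊔ mPt a ^ k)) := by
  rw [germDim_eq]
  set J := (Ideal.span gs).map (germ a) with hJ
  let φ : MvPolynomial (Fin m) ℂ →ₐ[ℂ] MvPowerSeries (Fin m) ℂ ⧸ J :=
    (Ideal.Quotient.mkₐ ℂ J).comp (germ a)
  have hφ : ∀ f, φ f = 0 ↔ germ a f ∈ J := fun f => Ideal.Quotient.eq_zero_iff_mem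
  have hpow : ∀ f ∈ mPt a ^ k, germ a f ∈ J := by
    intro f hf
    obtain ⟨g, hg, hgf⟩ := hk f hf
    have h1 := Ideal.mem_map_of_mem (germ a) hgf
    rw [map_mul] at h1
    have hu : IsUnit (germ a g) := by
      rw [MvPowerSeries.isUnit_iff_constantCoeff, isUnit_iff_ne_zero, germ_apply,
        ← MvPowerSeries.coeff_zero_eq_constantCoeff_apply, MvPolynomial.coeff_coe,
        ← constantCoeff_eq, Tr_const]
      exact hg
    exact (Ideal.unit_mul_mem_iff_mem J hu).mp h1
  have hvars : ∀ f ∈ idealOfVars (Fin m) ℂ ^ k, (f : MvPowerSeries (Fin m) ℂ) ∈ J := by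
    intro f hf
    rw [← map_Tr a k, Ideal.mem_map_iff_of_surjective _ (fun f => ⟨_, Tr_neg a f⟩)] at hf
    obtain ⟨g, hg, rfl⟩ := hf
    have := hpow g hg
    rwa [germ_apply] at this
  have hsurj : Function.Surjective φ := by
    intro y
    obtain ⟨h, rfl⟩ := Ideal.Quotient.mk_surjective y
    refine ⟨Tr (-a) (MvPowerSeries.truncTotal k h), ?_⟩
    have h1 : h - (MvPowerSeries.truncTotal k h : MvPolynomial (Fin m) ℂ) ∈ (idealOfVars (Fin m) ℂ ^ k) •
      (⊤ : Submodule (MvPolynomial (Fin m) ℂ) (MvPowerSeries (Fin m) ℂ)) := by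
      apply ps_lowdeg
      rw [mem_pow_idealOfVars_iff']
      intro x hx
      rw [MvPowerSeries.coeff_truncTotal _ hx, map_sub, MvPolynomial.coeff_coe,
        MvPowerSeries.coeff_truncTotal _ hx, sub_self]
    have h2 : h - (MvPowerSeries.truncTotal k h : MvPolynomial (Fin m) ℂ) ∈ J := by
      refine Submodule.smul_induction_on h1 ?_ ?_
      · intro r hr y _
        rw [Algebra.smul_def]
        exact Ideal.mul_mem_right _ _ (hvars r hr)
      · intro x y hx hy; exact J.add_mem hx hy
    have h3 : φ (Tr (-a) (MvPowerSeries.truncTotal k h)) = Ideal.Quotient.mk J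
        (MvPowerSeries.truncTotal k h : MvPolynomial (Fin m) ℂ) := by
      change Ideal.Quotient.mk J (germ a _) = _
      rw [germ_apply, Tr_neg]
    rw [h3]
    exact ((Ideal.Quotient.eq).mpr h2).symm
  have hker : RingHom.ker φ = Ideal.span gs ⊔ mPt a ^ k := by
    apply le_antisymm
    · intro f hf
      rw [RingHom.mem_ker, hφ] at hf
      let τ := MvPowerSeries.truncTotalAlgHom (Fin m) ℂ k
      have hτ : ∀ f : MvPolynomial (Fin m) ℂ, τ (f : MvPowerSeries (Fin m) ℂ) =
        Ideal.Quotient.mk (idealOfVars (Fin m) ℂ ^ k) f := fun f => τ.commutes f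
      have h1 := Ideal.mem_map_of_mem τ hf
      have h2 : J.map τ = ((Ideal.span gs).map (Tr a)).map
          (Ideal.Quotient.mk (idealOfVars (Fin m) ℂ ^ k)) := by
        rw [hJ, Ideal.map_span, Ideal.map_span, Ideal.map_span, Ideal.map_span, ← Set.image_comp,
          ← Set.image_comp]
        congr 1
        apply Set.image_congr
        intro g _
        simp only [Function.comp_apply]
        rw [germ_apply, hτ]
      rw [germ_apply, hτ, h2, Ideal.mem_quotient_iff_mem_sup, ← map_Tr a k, ← Ideal.map_sup] at h1
      exact Tr_mem a _ f h1
    · rw [sup_le_iff]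
      constructor
      · intro f hf
        exact (hφ f).mpr (Ideal.mem_map_of_mem _ hf)
      · intro f hf
        exact (hφ f).mpr (hpow f hf)
  let e := Ideal.quotientKerAlgEquivOfSurjective hsurj
  rw [← hker]
  exact e.toLinearEquiv.finrank_eq.symm

end Germ

section LocQuot
variable {σ : Type}

/-- `g(a) ≠ 0` makes `g` invertible modulo `m_a ^ k`. -/
lemma inv_mod_pow (a : σ → ℂ) (k : ℕ) (g : MvPolynomial σ ℂ) (hg : eval a g ≠ 0) :
    ∃ h, 1 - h * g ∈ mPt a ^ k := by
  have h1 : IsNilpotent (Ideal.Quotient.mk (mPt a ^ k) (g - C (eval a g))) := by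
    refine ⟨k, ?_⟩
    rw [← map_pow]
    refine Ideal.Quotient.eq_zero_iff_mem.mpr (Ideal.pow_mem_pow ?_ k)
    rw [mem_mPt]; simp
  have h2 : IsUnit (Ideal.Quotient.mk (mPt a ^ k) (C (eval a g))) :=
    (((isUnit_iff_ne_zero.mpr hg).map C)).map _
  have h3 : IsUnit (Ideal.Quotient.mk (mPt a ^ k) g) := by
    have := IsNilpotent.isUnit_add_left_of_commute h1 h2 (Commute.all _ _)
    rwa [← map_add, add_sub_cancel] at this
  obtain ⟨u, hu⟩ := h3.exists_left_inv
  obtain ⟨h, rfl⟩ := Ideal.Quotient.mk_surjective u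
  refine ⟨h, ?_⟩
  rw [← map_mul, eq_comm] at hu
  exact Ideal.Quotient.eq.mp (by rw [map_one]; exact hu)

lemma mem_sup_of_unit (a : σ → ℂ) (k : ℕ) (I : Ideal (MvPolynomial σ ℂ)) (f g : MvPolynomial σ ℂ)
    (hg : eval a g ≠ 0) (h : g * f ∈ I) : f ∈ I ⊔ mPt a ^ k := by
  obtain ⟨u, hu⟩ := inv_mod_pow a k g hg
  have : f = u * (g * f) + (1 - u * g) * f := by ring
  rw [this]
  exact Ideal.add_mem _ (Ideal.mem_sup_left (Ideal.mul_mem_left _ _ h))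
    (Ideal.mem_sup_right (Ideal.mul_mem_right _ _ hu))

variable [Finite σ]

lemma exists_unit_of_finite (a : σ → ℂ) (I : Ideal (MvPolynomial σ ℂ))
    (hf : Module.Finite ℂ (OPt a ⧸ I.map (algebraMap _ (OPt a)))) :
    ∃ k, ∀ f ∈ mPt a ^ k, ∃ g, eval a g ≠ 0 ∧ g * f ∈ I := by
  obtain ⟨k, hk⟩ := pow_le_of_finite (mPt a) _ hf
  refine ⟨k, fun f hf => ?_⟩
  have : algebraMap _ (OPt a) f ∈ I.map (algebraMap _ (OPt a)) := by
    apply hk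
    rw [max_eq_map, ← Ideal.map_pow]
    exact Ideal.mem_map_of_mem _ hf
  rw [IsLocalization.algebraMap_mem_map_algebraMap_iff (mPt a).primeCompl] at this
  obtain ⟨g, hg, h⟩ := this
  exact ⟨g, hg, h⟩

lemma loc_quot (a : σ → ℂ) (I : Ideal (MvPolynomial σ ℂ))
    (hf : Module.Finite ℂ (OPt a ⧸ I.map (algebraMap _ (OPt a)))) (k : ℕ)
    (hk : ∀ f ∈ mPt a ^ k, ∃ g, eval a g ≠ 0 ∧ g * f ∈ I) :
    Module.finrank ℂ (OPt a ⧸ I.map (algebraMap _ (OPt a))) =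
      Module.finrank ℂ (MvPolynomial σ ℂ ⧸ (I ⊔ mPt a ^ k)) := by
  let ψ : MvPolynomial σ ℂ →ₐ[ℂ] OPt a ⧸ I.map (algebraMap _ (OPt a)) :=
    (Ideal.Quotient.mkₐ ℂ _).comp (IsScalarTower.toAlgHom ℂ _ _)
  have hψ : ∀ f, ψ f = 0 ↔ ∃ g, eval a g ≠ 0 ∧ g * f ∈ I := by
    intro f
    have : ψ f = 0 ↔ algebraMap _ (OPt a) f ∈ I.map (algebraMap _ (OPt a)) :=
      Ideal.Quotient.eq_zero_iff_mem
    rw [this, IsLocalization.algebraMap_mem_map_algebraMap_iff (mPt a).primeCompl]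
    rfl
  have hs : Function.Surjective ψ := by
    intro y
    obtain ⟨y, rfl⟩ := Ideal.Quotient.mk_surjective y
    obtain ⟨f, hf⟩ := loc_surj_of_finite (mPt a) (ratPt_mPt a) _ hf y
    exact ⟨f, ((Ideal.Quotient.eq).mpr hf).symm⟩
  have hker : RingHom.ker ψ = I ⊔ mPt a ^ k := by
    apply le_antisymm
    · intro f hf
      obtain ⟨g, hg, h⟩ := (hψ f).mp hf
      exact mem_sup_of_unit a k I f g hg h
    · rw [sup_le_iff]
      exact ⟨fun f hf => (hψ f).mpr ⟨1, by simp, by simpa using hf⟩, fun f hf => (hψ f).mpr (hk f hf)⟩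
  rw [← hker]
  exact (Ideal.quotientKerAlgEquivOfSurjective hs).toLinearEquiv.finrank_eq.symm

lemma finite_loc_of_finite (a : σ → ℂ) (I : Ideal (MvPolynomial σ ℂ))
    (hfin : {b : σ → ℂ | ∀ f ∈ I, eval b f = 0}.Finite) :
    Module.Finite ℂ (OPt a ⧸ I.map (algebraMap _ (OPt a))) := by
  apply finite_of_arcs _ (ratPt_mPt _)
  intro ψ hψ hI
  apply arc_trivial
  intro v
  have h1 := const_of_finite I v ((fun b : σ → ℂ => b v) '' {b : σ → ℂ | ∀ f ∈ I, eval b f = 0})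
    (hfin.image _) (fun b hb => ⟨b, hb, rfl⟩) (arcCo a ψ) (fun g hg => by
      rw [← arc_alg]
      exact hI _ (Ideal.mem_map_of_mem _ hg))
  rw [h1]
  unfold arcCo
  rw [arc_const _ _ hψ]
  simp

end LocQuot

section Milnor
variable {m : ℕ}

/-- finite zero sets: lower bound of the local multiplicity -/
lemma le_germDim (gs : Set (MvPolynomial (Fin m) ℂ)) (a : Fin m → ℂ) (k : ℕ)
    (hfin : {b : Fin m → ℂ | ∀ f ∈ gs, eval b f = 0}.Finite) :
    Module.finrank ℂ (MvPolynomial (Fin m) ℂ ⧸ (Ideal.span gs ⊔ mPt a ^ k)) ≤ germDim gs a := by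
  have hf : Module.Finite ℂ (OPt a ⧸ (Ideal.span gs).map (algebraMap _ (OPt a))) := by
    apply finite_loc_of_finite
    refine hfin.subset fun b hb f hf => hb f (Ideal.subset_span hf)
  obtain ⟨k0, hk0⟩ := exists_unit_of_finite a _ hf
  rw [germ_core gs a k0 hk0]
  haveI : Module.Finite ℂ (MvPolynomial (Fin m) ℂ ⧸ mPt a ^ k0) := finite_quot_pow _ (ratPt_mPt a) k0
  refine quot_finrank_mono ?_ (quot_finite_mono le_sup_right this)
  rw [sup_le_iff]
  refine ⟨le_sup_left, fun f hf => ?_⟩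
  obtain ⟨g, hg, h⟩ := hk0 f hf
  exact mem_sup_of_unit a k _ f g hg h

/-- set `s = 0`, `t = c` -/
def rho (c : ℂ) : MvPolynomial (VV m) ℂ →ₐ[ℂ] MvPolynomial (Fin m) ℂ :=
  aeval (Sum.elim X ![0, C c])

def iota : MvPolynomial (Fin m) ℂ →ₐ[ℂ] MvPolynomial (VV m) ℂ := rename Sum.inl

lemma rho_iota (c : ℂ) (f : MvPolynomial (Fin m) ℂ) : rho c (iota f) = f := by
  have : (rho c).comp (iota (m := m)) = AlgHom.id ℂ _ := by
    ext i : 1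
    simp [rho, iota]
  exact DFunLike.congr_fun this f

lemma rho_surj (c : ℂ) : Function.Surjective (rho (m := m) c) := fun f => ⟨_, rho_iota c f⟩

lemma eval_rho (c : ℂ) (p : Fin m → ℂ) (f : MvPolynomial (VV m) ℂ) :
    eval p (rho c f) = eval (pt p 0 c) f := by
  have : (eval p).comp ((rho (m := m) c).toRingHom) = eval (pt p 0 c) := by
    apply MvPolynomial.ringHom_ext
    · intro r; simp [rho]
    · rintro (i | i)
      · simp [rho]
      · fin_cases i <;> simp [rho]
  exact DFunLike.congr_fun this f

lemma rho_ker (c : ℂ) (f : MvPolynomial (VV m) ℂ) :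
    f - iota (rho c f) ∈ Ideal.span {tauV c} ⊔ Ideal.span {sV} := by
  set L : Ideal (MvPolynomial (VV m) ℂ) := Ideal.span {tauV c} ⊔ Ideal.span {sV} with hL
  have h : (Ideal.Quotient.mkₐ ℂ L) = ((Ideal.Quotient.mkₐ ℂ L).comp (iota)).comp (rho c) := by
    ext v : 1
    rcases v with i | i
    · simp [rho, iota]
    · fin_cases i
      · simp only [rho, iota, AlgHom.comp_apply, aeval_X, Sum.elim_inr]
        simp only [Fin.zero_eta, Matrix.cons_val_zero, map_zero]
        exact Ideal.Quotient.eq_zero_iff_mem.mpr (mem_sup_span _ _)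
      · simp only [rho, iota, AlgHom.comp_apply, aeval_X, Sum.elim_inr]
        simp only [Fin.mk_one, Matrix.cons_val_one, Matrix.cons_val_zero, rename_C]
        exact Ideal.Quotient.eq.mpr (Ideal.mem_sup_left (Ideal.mem_span_singleton_self _))
  refine Ideal.Quotient.eq.mp ?_
  exact DFunLike.congr_fun h f

lemma map_rho_mPt (c : ℂ) (p : Fin m → ℂ) (k : ℕ) :
    (mPt (pt p 0 c) ^ k).map (rho c) = mPt p ^ k := by
  rw [Ideal.map_pow]
  congr 1
  ext f
  rw [Ideal.mem_map_iff_of_surjective _ (rho_surj c)]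
  constructor
  · rintro ⟨g, hg, rfl⟩
    rw [mem_mPt, eval_rho]; exact hg
  · intro h
    refine ⟨iota f, ?_, rho_iota c f⟩
    rw [mem_mPt, ← eval_rho, rho_iota]; exact h

theorem germ_ell (G : MvPolynomial (VV m) ℂ) (p : Fin m → ℂ) (c : ℂ)
    (hf : Module.Finite ℂ (OO p c ⧸ (I1 G p c ⊔ Ideal.span {toO p c sV}))) :
    germDim (Set.range fun i => rho c (pderiv (Sum.inl i) G)) p =
      Module.finrank ℂ (OO p c ⧸ (I1 G p c ⊔ Ideal.span {toO p c sV})) := by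
  set I : Ideal (MvPolynomial (VV m) ℂ) := JJ G ⊔ Ideal.span {tauV c} ⊔ Ideal.span {sV} with hI
  have hmap : I1 G p c ⊔ Ideal.span {toO p c sV} = I.map (algebraMap _ (OPt (pt p 0 c))) := by
    rw [hI, Ideal.map_sup, Ideal.map_sup, Ideal.map_span, Ideal.map_span, Set.image_singleton,
      Set.image_singleton]
  rw [hmap] at hf ⊢
  obtain ⟨k, hk⟩ := exists_unit_of_finite (pt p 0 c) I hf
  set gs := Set.range fun i => rho c (pderiv (Sum.inl i) G) with hgs
  have hIr : I.map (rho c) = Ideal.span gs := by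
    rw [hI, Ideal.map_sup, Ideal.map_sup, Ideal.map_span, Ideal.map_span, Set.image_singleton,
      Set.image_singleton]
    have h1 : rho c (tauV c : MvPolynomial (VV m) ℂ) = 0 := by
      simp [rho, MvPolynomial.algebraMap_eq]
    have h2 : rho c (sV : MvPolynomial (VV m) ℂ) = 0 := by simp [rho]
    rw [h1, h2, Ideal.span_singleton_eq_bot.mpr rfl, sup_bot_eq, sup_bot_eq, JJ, Ideal.map_span,
      ← Set.range_comp]
    rfl
  have hk' : ∀ f ∈ mPt p ^ k, ∃ g, eval p g ≠ 0 ∧ g * f ∈ Ideal.span gs := by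
    intro f hf
    rw [← map_rho_mPt c p k, Ideal.mem_map_iff_of_surjective _ (rho_surj c)] at hf
    obtain ⟨f, hf, rfl⟩ := hf
    obtain ⟨g, hg, h⟩ := hk f hf
    refine ⟨rho c g, by rw [eval_rho]; exact hg, ?_⟩
    rw [← map_mul, ← hIr]
    exact Ideal.mem_map_of_mem _ h
  rw [germ_core gs p k hk', loc_quot (pt p 0 c) I hf k hk]
  have hsup : (I ⊔ mPt (pt p 0 c) ^ k).map (rho c) = Ideal.span gs ⊔ mPt p ^ k := by
    rw [Ideal.map_sup, hIr, map_rho_mPt]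
  let χ : MvPolynomial (VV m) ℂ →ₐ[ℂ] MvPolynomial (Fin m) ℂ ⧸ (Ideal.span gs ⊔ mPt p ^ k) :=
    (Ideal.Quotient.mkₐ ℂ _).comp (rho c)
  have hχs : Function.Surjective χ := (Ideal.Quotient.mkₐ_surjective ℂ _).comp (rho_surj c)
  have hχ : RingHom.ker χ = I ⊔ mPt (pt p 0 c) ^ k := by
    ext f
    have h0 : f ∈ RingHom.ker χ ↔ rho c f ∈ Ideal.span gs ⊔ mPt p ^ k :=
      Ideal.Quotient.eq_zero_iff_mem
    rw [h0, ← hsup]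
    constructor
    · intro h
      rw [Ideal.mem_map_iff_of_surjective _ (rho_surj c)] at h
      obtain ⟨g, hg, hgf⟩ := h
      have hle : Ideal.span {tauV c} ⊔ Ideal.span {sV} ≤ I ⊔ mPt (pt p 0 c) ^ k := by
        rw [hI, sup_le_iff]
        exact ⟨le_sup_right.trans (le_sup_left.trans le_sup_left), le_sup_right.trans le_sup_left⟩
      have h1 := hle (rho_ker c f)
      have h2 := hle (rho_ker c g)
      rw [hgf] at h2
      have : f = (f - iota (rho c f)) - (g - iota (rho c f)) + g := by ring
      rw [this]
      exact Ideal.add_mem _ (Ideal.sub_mem _ h1 h2) hg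
    · intro h; exact Ideal.mem_map_of_mem _ h
  rw [← hχ]
  exact (Ideal.quotientKerAlgEquivOfSurjective hχs).toLinearEquiv.finrank_eq.symm

end Milnor

section CRT
variable {σ : Type} [Finite σ]

lemma finite_zeros (K : Ideal (MvPolynomial σ ℂ)) (hK : Module.Finite ℂ (MvPolynomial σ ℂ ⧸ K)) :
    {a : σ → ℂ | ∀ f ∈ K, eval a f = 0}.Finite := by
  have h : ∀ v : σ, ∃ S : Set ℂ, S.Finite ∧ ∀ a : σ → ℂ, (∀ f ∈ K, eval a f = 0) → a v ∈ S := by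
    intro v
    obtain ⟨q, hq, hq0⟩ := Algebra.IsIntegral.isIntegral (R := ℂ) (Ideal.Quotient.mk K (X v))
    refine ⟨q.rootSet ℂ, Polynomial.rootSet_finite q ℂ, fun a ha => ?_⟩
    rw [Polynomial.mem_rootSet]
    refine ⟨hq.ne_zero, ?_⟩
    have h1 : Polynomial.aeval (X v) q ∈ K := by
      rw [← Polynomial.aeval_def, ← Ideal.Quotient.mkₐ_eq_mk ℂ, Polynomial.aeval_algHom_apply] at hq0
      exact Ideal.Quotient.eq_zero_iff_mem.mp hq0
    have h2 := ha _ h1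
    rw [← MvPolynomial.aeval_eq_eval, ← Polynomial.aeval_algHom_apply, aeval_X] at h2
    exact h2
  choose S hS hS' using h
  exact (Set.Finite.pi' hS).subset fun a ha v => hS' v a ha

lemma mPt_isMaximal (a : σ → ℂ) : (mPt a).IsMaximal :=
  RingHom.ker_isMaximal_of_surjective _ fun c => ⟨C c, by simp⟩

lemma mPt_coprime {a b : σ → ℂ} (h : a ≠ b) : IsCoprime (mPt a) (mPt b) := by
  obtain ⟨v, hv⟩ := Function.ne_iff.mp h
  rw [Ideal.isCoprime_iff_exists]
  have hv' : b v - a v ≠ 0 := sub_ne_zero.mpr hv.symm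
  refine ⟨C (b v - a v)⁻¹ * (X v - C (a v)), ?_, C (b v - a v)⁻¹ * (C (b v) - X v), ?_, ?_⟩
  · rw [mem_mPt]; simp
  · rw [mem_mPt]; simp
  · rw [← mul_add, sub_add_sub_cancel', ← C_sub, ← C_mul, inv_mul_cancel₀ hv', C_1]

lemma prod_sup_le {ι R : Type*} [CommRing R] (s : Finset ι) (K : Ideal R) (J : ι → Ideal R) :
    ∏ i ∈ s, (K ⊔ J i) ≤ K ⊔ ∏ i ∈ s, J i := by
  classical
  induction s using Finset.induction_on with
  | empty => simp
  | insert i s hi ih =>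
    rw [Finset.prod_insert hi, Finset.prod_insert hi]
    refine (Ideal.mul_mono_right ih).trans ?_
    rw [Ideal.sup_mul, Ideal.mul_sup, Ideal.mul_sup]
    refine sup_le (sup_le (Ideal.mul_le_left.trans le_sup_left) (Ideal.mul_le_left.trans le_sup_left))
      (sup_le (Ideal.mul_le_right.trans le_sup_left) le_sup_right)

theorem crt_bound (K : Ideal (MvPolynomial σ ℂ)) (hK : Module.Finite ℂ (MvPolynomial σ ℂ ⧸ K)) :
    ∃ V : Finset (σ → ℂ), (∀ a, a ∈ V ↔ ∀ f ∈ K, eval a f = 0) ∧ ∃ N,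
      Module.finrank ℂ (MvPolynomial σ ℂ ⧸ K) ≤
        ∑ a ∈ V, Module.finrank ℂ (MvPolynomial σ ℂ ⧸ (K ⊔ mPt a ^ (N + 1))) := by
  classical
  have hfin := finite_zeros K hK
  refine ⟨hfin.toFinset, fun a => by simp, ?_⟩
  set V := hfin.toFinset with hV
  have hmem : ∀ a, a ∈ V ↔ ∀ f ∈ K, eval a f = 0 := fun a => by simp [hV]
  have hprod : ∏ a ∈ V, mPt a = ⨅ a ∈ V, mPt a :=
    Ideal.prod_eq_iInf_of_pairwise_isCoprime (fun a _ b _ hab => mPt_coprime hab)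
  have hrad : ∏ a ∈ V, mPt a ≤ K.radical := by
    rw [hprod, ← vanishingIdeal_zeroLocus_eq_radical (K := ℂ)]
    intro f hf
    rw [mem_vanishingIdeal_iff]
    intro a ha
    rw [MvPolynomial.aeval_eq_eval]
    simp only [Ideal.mem_iInf] at hf
    refine hf a ((hmem a).mpr fun g hg => ?_)
    have := (mem_zeroLocus_iff.1 ha) g hg
    rwa [MvPolynomial.aeval_eq_eval] at this
  obtain ⟨N, hN⟩ := Ideal.exists_pow_le_of_le_radical_of_fg hrad (Ideal.fg_of_isNoetherianRing _)
  refine ⟨N, ?_⟩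
  have hN' : ∏ a ∈ V, mPt a ^ (N + 1) ≤ K := by
    rw [Finset.prod_pow]
    exact (Ideal.pow_le_pow_right (Nat.le_succ N)).trans hN
  have hinf : ⨅ a ∈ V, (K ⊔ mPt a ^ (N + 1)) ≤ K := by
    rw [← Ideal.prod_eq_iInf_of_pairwise_isCoprime]
    · exact (prod_sup_le _ _ _).trans (sup_le le_rfl hN')
    · intro a _ b _ hab
      have h1 : IsCoprime (mPt a ^ (N+1)) (mPt b ^ (N+1)) := (mPt_coprime hab).pow
      rw [Function.onFun, Ideal.isCoprime_iff_sup_eq] at *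
      rw [eq_top_iff, ← h1]
      exact sup_le_sup le_sup_right le_sup_right
  let Φ : (MvPolynomial σ ℂ ⧸ K) →ₗ[ℂ] (∀ a : V, MvPolynomial σ ℂ ⧸ (K ⊔ mPt a.1 ^ (N + 1))) :=
    LinearMap.pi fun a => (Ideal.Quotient.factorₐ ℂ (le_sup_left : K ≤ K ⊔ mPt a.1 ^ (N + 1))).toLinearMap
  have hΦ : Function.Injective Φ := by
    rw [injective_iff_map_eq_zero]
    intro x hx
    obtain ⟨f, rfl⟩ := Ideal.Quotient.mk_surjective x
    refine Ideal.Quotient.eq_zero_iff_mem.mpr (hinf ?_)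
    simp only [Ideal.mem_iInf]
    intro a ha
    have := congrFun hx ⟨a, ha⟩
    exact Ideal.Quotient.eq_zero_iff_mem.mp this
  haveI : ∀ a : V, Module.Finite ℂ (MvPolynomial σ ℂ ⧸ (K ⊔ mPt a.1 ^ (N + 1))) := fun a =>
    quot_finite_mono le_sup_left hK
  refine (LinearMap.finrank_le_finrank_of_injective hΦ).trans ?_
  rw [Module.finrank_pi_fintype, Finset.sum_coe_sort V
    (fun a => Module.finrank ℂ (MvPolynomial σ ℂ ⧸ (K ⊔ mPt a ^ (N + 1))))]

end CRT

section Concrete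

lemma pderiv_aeval_unit {σ τ : Type} (w : τ) (u : σ) (φ : σ → MvPolynomial τ ℂ)
    (h1 : pderiv w (φ u) = 1) (h0 : ∀ v, v ≠ u → pderiv w (φ v) = 0) (F : MvPolynomial σ ℂ) :
    pderiv w (aeval φ F) = aeval φ (pderiv u F) := by
  classical
  induction F using MvPolynomial.induction_on with
  | C c => simp
  | add p q hp hq => rw [map_add, map_add, map_add, map_add, hp, hq]
  | mul_X p i hp =>
    rw [map_mul, aeval_X, pderiv_mul, hp, pderiv_mul, map_add, map_mul, map_mul, aeval_X]
    by_cases hi : i = u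
    · subst hi; rw [h1, pderiv_X_self, map_one]
    · rw [h0 i hi, pderiv_X_of_ne (fun h => hi h), map_zero]

lemma pderiv_aeval_zero {σ τ : Type} (w : τ) (φ : σ → MvPolynomial τ ℂ)
    (h0 : ∀ v, pderiv w (φ v) = 0) (F : MvPolynomial σ ℂ) :
    pderiv w (aeval φ F) = 0 := by
  induction F using MvPolynomial.induction_on with
  | C c => simp
  | add p q hp hq => rw [map_add, map_add, hp, hq, add_zero]
  | mul_X p i hp => rw [map_mul, aeval_X, pderiv_mul, hp, h0]; simp

lemma wh_scale {σ : Type} {R : Type} [CommRing R] [Algebra ℂ R] (wt : σ → ℕ)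
    (F : MvPolynomial σ ℂ) (e : ℕ) (hF : IsWeightedHomogeneous wt F e) (z : R) (x : σ → R) :
    aeval (fun v => z ^ (wt v) * x v) F = z ^ e * aeval x F := by
  rw [F.as_sum, map_sum, map_sum, Finset.mul_sum]
  refine Finset.sum_congr rfl fun m hm => ?_
  have hw := hF (mem_support_iff.mp hm)
  rw [aeval_monomial, aeval_monomial]
  have : (m.prod fun i k => (z ^ wt i * x i) ^ k) = z ^ e * m.prod fun i k => x i ^ k := by
    simp only [mul_pow]
    rw [Finsupp.prod_mul]
    congr 1
    rw [← hw, Finsupp.weight_apply, Finsupp.prod, Finsupp.sum, ← Finset.prod_pow_eq_pow_sum]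
    refine Finset.prod_congr rfl fun i _ => ?_
    rw [← pow_mul, smul_eq_mul, mul_comm]
  rw [this]; ring

variable {n d : ℕ} {P : MvPolynomial (XS n) ℂ}

def wT (n : ℕ) : TV n → ℕ := Sum.elim (fun _ => 1) ![1, 0, 0]

def eT {n : ℕ} : XS n → TV n := Sum.elim Sum.inl (fun _ => Sum.inr 1)

lemma aeval_embT (f : MvPolynomial (XS n) ℂ) : aeval embT f = rename eT f := by
  rw [rename_eq_aeval]
  have : (embT : XS n → MvPolynomial (TV n) ℂ) = X ∘ eT := by
    ext v : 1
    rcases v with i | i <;> rfl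
  rw [this]

lemma wh_embT (f : MvPolynomial (XS n) ℂ) (q : ℕ) (hf : IsWeightedHomogeneous (wtx n) f q) :
    IsWeightedHomogeneous (wT n) (aeval embT f) q := by
  rw [aeval_embT]
  intro m hm
  obtain ⟨u, hu, h⟩ := coeff_rename_ne_zero _ _ _ hm
  rw [← hu, ← hf h, Finsupp.weight, Finsupp.weight]
  simp only [LinearMap.toAddMonoidHom_coe]
  rw [Finsupp.linearCombination_mapDomain]
  congr 2
  ext v
  rcases v with i | i <;> rfl

lemma FY_wh (d : ℕ) (P : MvPolynomial (XS n) ℂ) : IsWeightedHomogeneous (wT n) (FY d P) d := by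
  unfold FY
  have hX : ∀ v : TV n, IsWeightedHomogeneous (wT n) (X v : MvPolynomial (TV n) ℂ) (wT n v) :=
    fun v => isWeightedHomogeneous_X _ _ _
  apply IsWeightedHomogeneous.sub
  · rw [← mem_weightedHomogeneousSubmodule]
    refine Submodule.sum_mem _ fun q hq => ?_
    rw [mem_weightedHomogeneousSubmodule]
    have h1 := ((hX (Sum.inr 0)).pow (d - q)).mul (wh_embT _ q
      (weightedHomogeneousComponent_isWeightedHomogeneous (w := wtx n) q P))
    have : (d - q) • wT n (Sum.inr 0) + q = d := by
      have := Finset.mem_range.mp hq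
      simp [wT]; omega
    rw [this] at h1
    exact h1
  · have h1 := (hX (Sum.inr 2)).mul ((hX (Sum.inr 0)).pow d)
    have : wT n (Sum.inr 2) + d • wT n (Sum.inr 0) = d := by simp [wT]
    rwa [this] at h1

lemma euler_FY (d : ℕ) (P : MvPolynomial (XS n) ℂ) :
    (∑ i : Fin n, X (Sum.inl i) * pderiv (Sum.inl i) (FY d P))
      + X (Sum.inr 0) * pderiv (Sum.inr 0) (FY d P) = d • FY d P := by
  have := (FY_wh d P).sum_weight_X_mul_pderiv
  rw [← this, Fintype.sum_sum_type, Fin.sum_univ_three]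
  simp [wT]

/-- derivative in a weight-one variable -/
lemma dFY_wh (d : ℕ) (hd : 1 ≤ d) (P : MvPolynomial (XS n) ℂ) (v : TV n) (hv : wT n v = 1) :
    IsWeightedHomogeneous (wT n) (pderiv v (FY d P)) (d - 1) :=
  (FY_wh d P).pderiv (by rw [hv]; omega)

lemma dFY_wh0 (d : ℕ) (P : MvPolynomial (XS n) ℂ) (v : TV n) (hv : wT n v = 0) :
    IsWeightedHomogeneous (wT n) (pderiv v (FY d P)) d :=
  (FY_wh d P).pderiv (by rw [hv]; omega)

/-- evaluation at a homogeneous point over an algebra -/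
def evR {R : Type} (x : Fin n → R) (x0 s t : R) : TV n → R := Sum.elim x ![x0, s, t]

lemma scale_evR {R : Type} [CommRing R] [Algebra ℂ R] (F : MvPolynomial (TV n) ℂ) (e : ℕ)
    (hF : IsWeightedHomogeneous (wT n) F e) (z : R) (x : Fin n → R) (x0 s t : R) :
    aeval (evR (fun i => z * x i) (z * x0) s t) F = z ^ e * aeval (evR x x0 s t) F := by
  rw [← wh_scale (wT n) F e hF]
  congr 2
  ext v
  rcases v with i | i
  · simp [evR, wT]
  · fin_cases i <;> simp [evR, wT]

lemma dFY_t (d : ℕ) (P : MvPolynomial (XS n) ℂ) :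
    pderiv (Sum.inr 2) (FY d P) = - (X (Sum.inr 0)) ^ d := by
  unfold FY
  rw [map_sub, map_sum, Finset.sum_eq_zero, pderiv_mul, pderiv_X_self, pderiv_pow,
    pderiv_X_of_ne (by simp)]
  · simp
  · intro q hq
    rw [pderiv_mul, pderiv_pow, pderiv_X_of_ne (by simp), pderiv_aeval_zero]
    · simp
    · rintro (i | i) <;> exact pderiv_X_of_ne (by simp)

lemma dFY_0 {R : Type} [CommRing R] [Algebra ℂ R] (hd : 2 ≤ d) (P : MvPolynomial (XS n) ℂ)
    (x : Fin n → R) (s t : R) :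
    aeval (evR x 0 s t) (pderiv (Sum.inr 0) (FY d P)) =
      aeval (Sum.elim x (fun _ => s)) (xpart P (d-1)) := by
  unfold FY
  rw [map_sub, map_sum, map_sub, map_sum, Finset.sum_eq_single (d-1)]
  · have h1 : d - (d - 1) = 1 := by omega
    rw [h1, pow_one, pderiv_mul, pderiv_X_self, pderiv_aeval_zero]
    · rw [pderiv_mul, pderiv_pow, pderiv_X_self, pderiv_X_of_ne (by simp)]
      simp only [map_add, map_mul, map_pow, aeval_X, map_zero, map_one, map_natCast]
      have h0 : evR x 0 s t (Sum.inr 0) = 0 := rfl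
      rw [h0, zero_pow (by omega : d - 1 ≠ 0), zero_pow (by omega : d ≠ 0)]
      simp only [one_mul, mul_zero, zero_mul, add_zero, sub_zero]
      rw [aeval_embT, aeval_rename]
      congr 2
      ext v
      rcases v with i | i <;> rfl
    · rintro (i | i) <;> exact pderiv_X_of_ne (by simp)
  · intro q hq hne
    have hq' := Finset.mem_range.mp hq
    rw [pderiv_mul, pderiv_pow, pderiv_X_self, pderiv_aeval_zero]
    · simp only [map_add, map_mul, map_pow, aeval_X, map_zero, map_one, map_natCast]
      have h0 : evR x 0 s t (Sum.inr 0) = 0 := rfl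
      rw [h0]
      by_cases h : q = d
      · subst h; simp
      · rw [zero_pow (by omega : d - q - 1 ≠ 0)]; simp
    · rintro (i | i) <;> exact pderiv_X_of_ne (by simp)
  · intro h
    exact absurd (Finset.mem_range.mpr (by omega)) h

/-- restriction to infinity -/
lemma FY_at_zero {R : Type} [CommRing R] [Algebra ℂ R] (hd : 1 ≤ d) (P : MvPolynomial (XS n) ℂ)
    (x : Fin n → R) (s t : R) :
    aeval (evR x 0 s t) (FY d P) = aeval (Sum.elim x (fun _ => s)) (xpart P d) := by
  have h0 : evR x 0 s t (Sum.inr 0) = 0 := rfl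
  unfold FY
  rw [map_sub, map_sum, Finset.sum_eq_single d]
  · simp only [map_mul, map_pow, aeval_X, h0]
    rw [zero_pow (by omega : d ≠ 0), Nat.sub_self, pow_zero, one_mul, mul_zero, sub_zero,
      aeval_embT, aeval_rename]
    congr 2
    ext v
    rcases v with i | i <;> rfl
  · intro q hq hne
    have hq' := Finset.mem_range.mp hq
    simp only [map_mul, map_pow, aeval_X, h0]
    rw [zero_pow (by omega : d - q ≠ 0), zero_mul]
  · intro h
    exact absurd (Finset.mem_range.mpr (by omega)) h

lemma aeval_comp_aeval {σ τ R : Type} [CommRing R] [Algebra ℂ R] (φ : σ → MvPolynomial τ ℂ)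
    (ψ : τ → R) (f : MvPolynomial σ ℂ) :
    aeval ψ (aeval φ f) = aeval (fun v => aeval ψ (φ v)) f := by
  rw [← AlgHom.comp_apply, comp_aeval]

lemma dFY_x_at_zero {R : Type} [CommRing R] [Algebra ℂ R] (hd : 1 ≤ d)
    (P : MvPolynomial (XS n) ℂ) (x : Fin n → R) (s t : R) (i : Fin n) :
    aeval (evR x 0 s t) (pderiv (Sum.inl i) (FY d P)) =
      aeval (Sum.elim x (fun _ => s)) (pderiv (Sum.inl i) (xpart P d)) := by
  have h := FY_at_zero (R := MvPolynomial (VV n) ℂ) hd P (fun i => X (Sum.inl i))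
    (X (Sum.inr 0)) (X (Sum.inr 1))
  have h2 := congrArg (fun f => aeval (Sum.elim x ![s, t]) (pderiv (Sum.inl i) f)) h
  rw [pderiv_aeval_unit _ (Sum.inl i), pderiv_aeval_unit _ (Sum.inl i), aeval_comp_aeval,
    aeval_comp_aeval] at h2
  · convert h2 using 3
    · ext v
      rcases v with k | k
      · simp [evR]
      · fin_cases k <;> simp [evR]
    · ext v
      rcases v with k | k <;> simp
  · simp
  · rintro (k | k) hk
    · exact pderiv_X_of_ne (by simpa using hk)
    · exact pderiv_X_of_ne (by simp)
  · simp [evR]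
  · rintro (k | k) hk
    · exact pderiv_X_of_ne (by simpa using hk)
    · fin_cases k <;> simp [evR]

/-- restriction to the affine part -/
lemma FY_at_one {R : Type} [CommRing R] [Algebra ℂ R] (P : MvPolynomial (XS n) ℂ)
    (hP : ∀ q, d < q → xpart P q = 0)
    (x : Fin n → R) (s t : R) :
    aeval (evR x 1 s t) (FY d P) = aeval (Sum.elim x (fun _ => s)) P - t := by
  have h0 : evR x 1 s t (Sum.inr 0) = 1 := rfl
  have h2 : evR x 1 s t (Sum.inr 2) = t := rfl
  have hsum : P = ∑ q ∈ Finset.range (d+1), xpart P q := by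
    conv_lhs => rw [← sum_weightedHomogeneousComponent (wtx n) P]
    apply finsum_eq_sum_of_support_subset
    intro q hq
    by_contra hc
    exact hq (hP q (by simpa using hc))
  conv_rhs => rw [hsum]
  unfold FY
  simp only [map_sub, map_sum, map_mul, map_pow, aeval_X, h0, h2, one_pow, one_mul, mul_one]
  congr 1
  refine Finset.sum_congr rfl fun q _ => ?_
  rw [aeval_embT, aeval_rename]
  congr 2
  ext v
  rcases v with i | i <;> rfl

lemma dFY_x_at_one {R : Type} [CommRing R] [Algebra ℂ R]
    (P : MvPolynomial (XS n) ℂ) (hP : ∀ q, d < q → xpart P q = 0)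
    (x : Fin n → R) (s t : R) (i : Fin n) :
    aeval (evR x 1 s t) (pderiv (Sum.inl i) (FY d P)) =
      aeval (Sum.elim x (fun _ => s)) (pderiv (Sum.inl i) P) := by
  have h := FY_at_one (R := MvPolynomial (VV n) ℂ) P hP (fun i => X (Sum.inl i))
    (X (Sum.inr 0)) (X (Sum.inr 1))
  have h2 := congrArg (fun f => aeval (Sum.elim x ![s, t]) (pderiv (Sum.inl i) f)) h
  rw [map_sub, pderiv_X_of_ne (by simp), sub_zero,
    pderiv_aeval_unit _ (Sum.inl i), pderiv_aeval_unit _ (Sum.inl i), aeval_comp_aeval,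
    aeval_comp_aeval] at h2
  · convert h2 using 3
    · ext v
      rcases v with k | k
      · simp [evR]
      · fin_cases k <;> simp [evR]
    · ext v
      rcases v with k | k <;> simp
  · simp
  · rintro (k | k) hk
    · exact pderiv_X_of_ne (by simpa using hk)
    · exact pderiv_X_of_ne (by simp)
  · simp [evR]
  · rintro (k | k) hk
    · exact pderiv_X_of_ne (by simpa using hk)
    · fin_cases k <;> simp [evR]

end Concrete

section Concrete2
variable {n d : ℕ} {P : MvPolynomial (XS n) ℂ}

lemma xpart_zero (hdeg : ∃ ε > (0:ℝ), ∀ s : ℂ, ‖s‖ < ε → DegXAt d P s) (q : ℕ) (hq : d < q) :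
    xpart P q = 0 := by
  obtain ⟨ε, hε, h⟩ := hdeg
  refine MvPolynomial.funext_set (Sum.elim (fun _ => Set.univ) (fun _ => Metric.ball 0 ε)) ?_ ?_
  · rintro (i | i)
    · exact Set.infinite_univ
    · exact infinite_of_mem_nhds (0:ℂ) (Metric.ball_mem_nhds _ hε)
  · intro x hx
    have h1 : x (Sum.inr ()) ∈ Metric.ball (0:ℂ) ε := hx (Sum.inr ()) trivial
    have h2 := (h (x (Sum.inr ())) (by simpa using h1)).1 q hq (fun i => x (Sum.inl i))
    have h3 : evA (fun i => x (Sum.inl i)) (x (Sum.inr ())) = x := by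
      ext v; rcases v with i | i <;> rfl
    rw [h3] at h2
    rw [h2, map_zero]

/-- the affine chart `x_j = 1` -/
def chart (j : Fin n) : MvPolynomial (TV n) ℂ →ₐ[ℂ] MvPolynomial (VV n) ℂ :=
  aeval (evR (fun i => if i = j then 1 else X (Sum.inl i)) (X (Sum.inl j)) (X (Sum.inr 0))
    (X (Sum.inr 1)))

/-- dehomogenized coordinates -/
def unch {R : Type} [One R] (j : Fin n) (y : Fin n → R) : Fin n → R :=
  fun i => if i = j then 1 else y i

lemma aeval_chart {R : Type} [CommRing R] [Algebra ℂ R] (j : Fin n) (ψ : VV n → R)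
    (f : MvPolynomial (TV n) ℂ) : aeval ψ (chart j f) =
      aeval (evR (unch j (fun i => ψ (Sum.inl i))) (ψ (Sum.inl j)) (ψ (Sum.inr 0))
        (ψ (Sum.inr 1))) f := by
  rw [chart, aeval_comp_aeval]
  congr 2
  ext v
  rcases v with k | k
  · by_cases hk : k = j <;> simp [evR, unch, hk]
  · fin_cases k <;> simp [evR]

lemma eval_chart (j : Fin n) (y : Fin n → ℂ) (s t : ℂ) (f : MvPolynomial (TV n) ℂ) :
    eval (pt y s t) (chart j f) = aeval (evR (unch j y) (y j) s t) f := by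
  have := aeval_chart j (pt y s t) f
  rw [aeval_eq_eval] at this
  exact this

lemma pderiv_chart_inl (j i : Fin n) (hi : i ≠ j) (f : MvPolynomial (TV n) ℂ) :
    pderiv (Sum.inl i) (chart j f) = chart j (pderiv (Sum.inl i) f) := by
  apply pderiv_aeval_unit
  · simp [evR, hi]
  · rintro (k | k) hk
    · by_cases hkj : k = j
      · simp [evR, hkj]
      · simp only [evR, Sum.elim_inl, hkj, if_false]
        exact pderiv_X_of_ne (by simpa using hk)
    · fin_cases k
      · exact pderiv_X_of_ne (R := ℂ) (i := (Sum.inl i : VV n)) (j := Sum.inl j) (by simpa using Ne.symm hi)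
      · simp [evR]
      · simp [evR]

lemma pderiv_chart_j (j : Fin n) (f : MvPolynomial (TV n) ℂ) :
    pderiv (Sum.inl j) (chart j f) = chart j (pderiv (Sum.inr 0) f) := by
  apply pderiv_aeval_unit
  · simp [evR]
  · rintro (k | k) hk
    · by_cases hkj : k = j
      · simp [evR, hkj]
      · simp only [evR, Sum.elim_inl, hkj, if_false]
        exact pderiv_X_of_ne (by simpa using hkj)
    · fin_cases k
      · exact absurd rfl hk
      · simp [evR]
      · simp [evR]

lemma pderiv_chart_s (j : Fin n) (f : MvPolynomial (TV n) ℂ) :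
    pderiv (Sum.inr 0) (chart j f) = chart j (pderiv (Sum.inr 1) f) := by
  apply pderiv_aeval_unit
  · simp [evR]
  · rintro (k | k) hk
    · by_cases hkj : k = j
      · simp [evR, hkj]
      · simp [evR, hkj]
    · fin_cases k
      · simp [evR]
      · exact absurd rfl hk
      · simp [evR]

lemma pderiv_chart_t (j : Fin n) (f : MvPolynomial (TV n) ℂ) :
    pderiv (Sum.inr 1) (chart j f) = chart j (pderiv (Sum.inr 2) f) := by
  apply pderiv_aeval_unit
  · simp [evR]
  · rintro (k | k) hk
    · by_cases hkj : k = j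
      · simp [evR, hkj]
      · simp [evR, hkj]
    · fin_cases k
      · simp [evR]
      · simp [evR]
      · exact absurd rfl hk

/-- all homogeneous derivatives vanish as soon as the chart derivatives and the equation do -/
lemma all_derivs {R : Type} [CommRing R] [Algebra ℂ R] (j : Fin n) (ψ : VV n → R)
    (h0 : aeval ψ (chart j (FY d P)) = 0)
    (hi : ∀ i, aeval ψ (pderiv (Sum.inl i) (chart j (FY d P))) = 0) :
    (∀ i : Fin n, aeval (evR (unch j (fun i => ψ (Sum.inl i))) (ψ (Sum.inl j)) (ψ (Sum.inr 0))
        (ψ (Sum.inr 1))) (pderiv (Sum.inl i) (FY d P)) = 0) ∧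
      aeval (evR (unch j (fun i => ψ (Sum.inl i))) (ψ (Sum.inl j)) (ψ (Sum.inr 0))
        (ψ (Sum.inr 1))) (pderiv (Sum.inr 0) (FY d P)) = 0 := by
  set e := evR (unch j (fun i => ψ (Sum.inl i))) (ψ (Sum.inl j)) (ψ (Sum.inr 0))
        (ψ (Sum.inr 1)) with he
  rw [aeval_chart, ← he] at h0
  have h1 : ∀ i, i ≠ j → aeval e (pderiv (Sum.inl i) (FY d P)) = 0 := by
    intro i hij
    have := hi i
    rwa [pderiv_chart_inl j i hij, aeval_chart] at this
  have h2 : aeval e (pderiv (Sum.inr 0) (FY d P)) = 0 := by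
    have := hi j
    rwa [pderiv_chart_j, aeval_chart] at this
  refine ⟨fun i => ?_, h2⟩
  by_cases hij : i = j
  · subst hij
    have h3 := congrArg (aeval e) (euler_FY d P)
    rw [map_add, map_sum, map_mul, h2, map_nsmul, h0, Finset.sum_eq_single i] at h3
    · have h4 : e (Sum.inl i) = 1 := by simp [he, evR, unch]
      simpa [h4] using h3
    · intro k _ hk
      rw [map_mul, h1 k hk, mul_zero]
    · simp
  · exact h1 i hij

lemma OnY_iff (u : HV n → ℂ) (s t : ℂ) (f : MvPolynomial (TV n) ℂ) : eval (evT u s t) f =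
    aeval (evR (fun i => u (Sum.inl i)) (u (Sum.inr ())) s t) f := by
  rw [aeval_eq_eval]; rfl

lemma evA_eq (x : Fin n → ℂ) (s : ℂ) (f : MvPolynomial (XS n) ℂ) : eval (evA x s) f =
    aeval (Sum.elim x (fun _ => s)) f := by
  rw [aeval_eq_eval]; rfl

def uy (j : Fin n) (y : Fin n → ℂ) : HV n → ℂ := Sum.elim (unch j y) (fun _ => y j)

lemma uy_ne (j : Fin n) (y : Fin n → ℂ) : uy j y ≠ 0 := by
  intro h
  have := congrFun h (Sum.inl j)
  simp [uy, unch] at this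

lemma unch_ne (j : Fin n) (y : Fin n → ℂ) : unch j y ≠ 0 := by
  intro h
  have := congrFun h j
  simp [unch] at this

lemma unch_rep (p : PrjInf n) :
    unch (jp p) (chartPt p) = fun i => (p.rep (jp p))⁻¹ * p.rep i := by
  ext i
  by_cases h : i = jp p
  · subst h; simp [unch, jp_spec p]
  · simp [unch, chartPt, h]; ring

theorem hyp_chart (hd : 2 ≤ d) (hfisi : FISIdef d P)
    (hY : ∃ ε > (0:ℝ), ∀ (u : HV n → ℂ), u ≠ 0 → ∀ s t : ℂ, ‖s‖ < ε →
      ¬ (OnY d P u s t ∧ AllDerivsVanish d P u s t))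
    (p : PrjInf n) (hp : p ∈ Sigset d P 0) :
    Hyp (chart (jp p) (FY d P)) (jp p) d (chartPt p) := by
  have hpj : chartPt p (jp p) = 0 := by simp [chartPt]
  have hsc : ∀ (f : MvPolynomial (TV n) ℂ) (e : ℕ), IsWeightedHomogeneous (wT n) f e → ∀ t,
      aeval (evR p.rep 0 0 t) f = 0 → eval (pt (chartPt p) 0 t) (chart (jp p) f) = 0 := by
    intro f e hf t h
    rw [eval_chart, hpj, unch_rep]
    have := scale_evR f e hf ((p.rep (jp p))⁻¹) p.rep 0 0 t
    rw [mul_zero] at this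
    rw [this, h, mul_zero]
  obtain ⟨hW, hS⟩ := hp
  have hdx : ∀ t i, aeval (evR p.rep 0 0 t) (pderiv (Sum.inl i) (FY d P)) = 0 := by
    intro t i
    rw [dFY_x_at_zero (by omega), ← evA_eq]
    exact hW i
  have hd0 : ∀ t, aeval (evR p.rep 0 0 t) (pderiv (Sum.inr 0) (FY d P)) = 0 := by
    intro t
    rw [dFY_0 hd, ← evA_eq]
    exact hS
  have hF0 : ∀ t, aeval (evR p.rep 0 0 t) (FY d P) = 0 := by
    intro t
    have h3 := congrArg (aeval (evR p.rep 0 0 t)) (euler_FY d P)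
    rw [map_add, map_sum, map_mul, hd0, map_nsmul, Finset.sum_eq_zero] at h3
    · have : d ≠ 0 := by omega
      have h4 : (d:ℂ) * aeval (evR p.rep 0 0 t) (FY d P) = 0 := by
        rw [← nsmul_eq_mul, ← h3]; simp
      exact (mul_eq_zero.mp h4).resolve_left (by exact_mod_cast this)
    · intro i _
      rw [map_mul, hdx, mul_zero]
  have hG0 : ∀ t, eval (pt (chartPt p) 0 t) (chart (jp p) (FY d P)) = 0 :=
    fun t => hsc _ d (FY_wh d P) t (hF0 t)
  have hdG0 : ∀ t i, eval (pt (chartPt p) 0 t)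
      (pderiv (Sum.inl i) (chart (jp p) (FY d P))) = 0 := by
    intro t i
    by_cases hi : i = jp p
    · subst hi
      rw [pderiv_chart_j]
      exact hsc _ (d-1) (dFY_wh d (by omega) P _ rfl) t (hd0 t)
    · rw [pderiv_chart_inl _ _ hi]
      exact hsc _ (d-1) (dFY_wh d (by omega) P _ rfl) t (hdx t i)
  refine ⟨hpj, by omega, ?_, hG0, hdG0, ?_, ?_, ?_⟩
  · rw [pderiv_chart_t, dFY_t]
    simp [chart, evR]
  · intro t h
    obtain ⟨ε, hε, hY⟩ := hY
    have hall := all_derivs (d := d) (P := P) (jp p) (pt (chartPt p) 0 t)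
      (by rw [aeval_eq_eval]; exact hG0 t) (by intro i; rw [aeval_eq_eval]; exact hdG0 t i)
    rw [pderiv_chart_s, eval_chart] at h
    refine hY (uy (jp p) (chartPt p)) (uy_ne _ _) 0 t (by simpa using hε) ⟨?_, ?_⟩
    · unfold OnY
      rw [OnY_iff]
      have := hG0 t
      rw [eval_chart] at this
      exact this
    · intro v
      rw [OnY_iff]
      rcases v with i | i
      · exact hall.1 i
      · fin_cases i
        · exact hall.2
        · exact h
        · simp only [Fin.reduceFinMk]
          rw [dFY_t]
          have : uy (jp p) (chartPt p) (Sum.inr ()) = 0 := hpj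
          rw [this]
          simp only [map_neg, map_pow, aeval_X]
          have : ∀ x : Fin n → ℂ, evR x 0 0 t (Sum.inr 0) = 0 := fun _ => rfl
          rw [this, zero_pow (by omega), neg_zero]
  · intro t
    have hfin := hfisi.1.2.1 t
    refine Set.Finite.of_finite_image (f := fun y => Projectivization.mk ℂ (uy (jp p) y) (uy_ne _ _))
      (hfin.subset ?_) ?_
    · rintro _ ⟨y, ⟨hy0, hyi⟩, rfl⟩
      have hall := all_derivs (d := d) (P := P) (jp p) (pt y 0 t)
        (by rw [aeval_eq_eval]; exact hy0) (by intro i; rw [aeval_eq_eval]; exact hyi i)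
      obtain ⟨a, ha⟩ := Projectivization.exists_smul_eq_mk_rep ℂ (uy (jp p) y) (uy_ne _ _)
      have key : ∀ (f : MvPolynomial (TV n) ℂ) (e : ℕ), IsWeightedHomogeneous (wT n) f e →
          aeval (evR (unch (jp p) y) (y (jp p)) 0 t) f = 0 →
          eval (evT (Projectivization.mk ℂ (uy (jp p) y) (uy_ne _ _)).rep 0 t) f = 0 := by
        intro f e hf h
        rw [OnY_iff, ← ha]
        have := scale_evR f e hf (a : ℂ) (unch (jp p) y) (y (jp p)) 0 t
        rw [h, mul_zero] at this
        exact this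
      refine ⟨key _ d (FY_wh d P) ?_, fun i => key _ _ (dFY_wh d (by omega) P _ rfl) (hall.1 i),
        key _ _ (dFY_wh d (by omega) P _ rfl) hall.2⟩
      rw [eval_chart] at hy0
      exact hy0
    · intro y _ y' _ hyy
      rw [Projectivization.mk_eq_mk_iff] at hyy
      obtain ⟨a, ha⟩ := hyy
      have ha1 : (a : ℂ) = 1 := by
        have := congrFun ha (Sum.inl (jp p))
        simpa [uy, unch, Units.smul_def] using this
      ext i
      by_cases hi : i = jp p
      · subst hi
        have := congrFun ha (Sum.inr ())
        simpa [uy, Units.smul_def, ha1] using this.symm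
      · have := congrFun ha (Sum.inl i)
        simpa [uy, unch, hi, Units.smul_def, ha1] using this.symm
  · have hfin := hfisi.1.2.2
    refine ⟨{y | y (jp p) = 0 ∧ Projectivization.mk ℂ (unch (jp p) y) (unch_ne _ _) ∈ Wset d P 0},
      ?_, ?_⟩
    · refine Set.Finite.of_finite_image
        (f := fun y => Projectivization.mk ℂ (unch (jp p) y) (unch_ne _ _)) (hfin.subset ?_) ?_
      · rintro _ ⟨y, hy, rfl⟩
        exact hy.2
      · intro y hy y' hy' hyy
        rw [Projectivization.mk_eq_mk_iff] at hyy
        obtain ⟨a, ha⟩ := hyy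
        have ha1 : (a : ℂ) = 1 := by
          have := congrFun ha (jp p)
          simpa [unch, Units.smul_def] using this
        ext i
        by_cases hi : i = jp p
        · subst hi
          rw [hy.1, hy'.1]
        · have := congrFun ha i
          simpa [unch, hi, Units.smul_def, ha1] using this.symm
    · intro y t hyj hy0 hyi
      refine ⟨hyj, ?_⟩
      have hall := all_derivs (d := d) (P := P) (jp p) (pt y 0 t)
        (by rw [aeval_eq_eval]; exact hy0) (by intro i; rw [aeval_eq_eval]; exact hyi i)
      obtain ⟨a, ha⟩ := Projectivization.exists_smul_eq_mk_rep ℂ (unch (jp p) y) (unch_ne _ _)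
      intro i
      rw [evA_eq, ← dFY_x_at_zero (by omega) P _ 0 t, ← ha]
      have := scale_evR _ _ (dFY_wh d (by omega) P (Sum.inl i) rfl) (a : ℂ) (unch (jp p) y)
        (y (jp p)) 0 t
      have h2 := hall.1 i
      simp only [pt_inl, pt_s, pt_t] at h2
      rw [h2, mul_zero, hyj, mul_zero] at this
      exact this

end Concrete2

section Local
variable {n d : ℕ} {P : MvPolynomial (XS n) ℂ}

/-- the affine point of a chart point -/
def affPt (j : Fin n) (y : Fin n → ℂ) : Fin n → ℂ := fun i => (y j)⁻¹ * unch j y i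

lemma pderiv_fS (P : MvPolynomial (XS n) ℂ) (s : ℂ) (i : Fin n) :
    pderiv i (fS P s) = aeval (Sum.elim X (fun _ => C s)) (pderiv (Sum.inl i) P) := by
  apply pderiv_aeval_unit
  · simp
  · rintro (k | k) hk
    · exact pderiv_X_of_ne (by simpa using hk)
    · simp

lemma aeval_fS_aux {R : Type} [CommRing R] [Algebra ℂ R] (f : MvPolynomial (XS n) ℂ) (c : ℂ)
    (x : Fin n → R) : aeval x (aeval (Sum.elim X (fun _ => C c)) f : MvPolynomial (Fin n) ℂ) =
      aeval (Sum.elim x (fun _ => algebraMap ℂ R c)) f := by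
  rw [aeval_comp_aeval]
  congr 2
  ext v
  rcases v with k | k <;> simp

lemma subalg_inv {Q : Type} [CommRing Q] [Algebra ℂ Q] [Module.Finite ℂ Q] (S : Subalgebra ℂ Q)
    (w z : Q) (hw : w ∈ S) (hwz : w * z = 1) : z ∈ S := by
  let L : S →ₗ[ℂ] S := LinearMap.mulLeft ℂ (⟨w, hw⟩ : S)
  have : FiniteDimensional ℂ S :=
    FiniteDimensional.finiteDimensional_submodule (Subalgebra.toSubmodule S)
  have hinj : Function.Injective L := by
    intro a b h
    have h1 : w * (a : Q) = w * (b : Q) := congrArg Subtype.val h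
    apply Subtype.ext
    calc (a : Q) = (w * z) * a := by rw [hwz, one_mul]
      _ = z * (w * a) := by ring
      _ = z * (w * b) := by rw [h1]
      _ = (w * z) * b := by ring
      _ = b := by rw [hwz, one_mul]
  obtain ⟨u, hu⟩ := (LinearMap.injective_iff_surjective.mp hinj) 1
  have h1 : w * (u : Q) = 1 := congrArg Subtype.val hu
  have : z = u := by
    calc z = z * (w * u) := by rw [h1, mul_one]
      _ = (w * z) * u := by ring
      _ = u := by rw [hwz, one_mul]
  rw [this]; exact u.2

section
variable (hP : ∀ q, d < q → xpart P q = 0) (hd : 1 ≤ d) (j : Fin n) (c : ℂ)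
  {Q : Type} [CommRing Q] [Algebra ℂ Q] (ψ : VV n → Q) (w : Q)
  (h0 : aeval ψ (chart j (FY d P)) = 0)
  (hi : ∀ i, aeval ψ (pderiv (Sum.inl i) (chart j (FY d P))) = 0)
  (hs : ψ (Sum.inr 0) = algebraMap ℂ Q c) (hw : w * ψ (Sum.inl j) = 1)
include hP hs hw h0

lemma theta_t :
    aeval (fun i => w * unch j (fun i => ψ (Sum.inl i)) i) (fS P c) = ψ (Sum.inr 1) := by
  rw [fS, aeval_fS_aux]
  rw [aeval_chart] at h0
  have := scale_evR (FY d P) d (FY_wh d P) w (unch j (fun i => ψ (Sum.inl i))) (ψ (Sum.inl j))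
    (ψ (Sum.inr 0)) (ψ (Sum.inr 1))
  rw [h0, mul_zero, hw, FY_at_one P hP, hs] at this
  exact sub_eq_zero.mp this

include hi hd in
lemma theta_d (i : Fin n) :
    aeval (fun i => w * unch j (fun i => ψ (Sum.inl i)) i) (pderiv i (fS P c)) = 0 := by
  rw [pderiv_fS, aeval_fS_aux]
  have h1 := (all_derivs j ψ h0 hi).1 i
  have := scale_evR _ _ (dFY_wh d hd P (Sum.inl i) rfl) w (unch j (fun i => ψ (Sum.inl i)))
    (ψ (Sum.inl j)) (ψ (Sum.inr 0)) (ψ (Sum.inr 1))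
  rw [h1, mul_zero, hw, dFY_x_at_one P hP, hs] at this
  exact this
end

theorem local_bound (hP : ∀ q, d < q → xpart P q = 0) (hd : 1 ≤ d) (j : Fin n) (c : ℂ)
    (K : Ideal (MvPolynomial (VV n) ℂ))
    (hK : ∀ i, pderiv (Sum.inl i) (chart j (FY d P)) ∈ K) (hG : chart j (FY d P) ∈ K)
    (hs : sV - C c ∈ K) (hfin : Module.Finite ℂ (MvPolynomial (VV n) ℂ ⧸ K))
    (a : VV n → ℂ) (ha : ∀ f ∈ K, eval a f = 0) (haj : a (Sum.inl j) ≠ 0) (N : ℕ) :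
    Module.finrank ℂ (MvPolynomial (VV n) ℂ ⧸ (K ⊔ mPt a ^ (N + 1))) ≤
      Module.finrank ℂ (MvPolynomial (Fin n) ℂ ⧸
        (Ideal.span (Set.range fun i => pderiv i (fS P c)) ⊔
          mPt (affPt j (fun i => a (Sum.inl i))) ^ (N + 1))) := by
  set L := K ⊔ mPt a ^ (N + 1) with hL
  set x := affPt j (fun i => a (Sum.inl i)) with hx
  have hfinQ : Module.Finite ℂ (MvPolynomial (VV n) ℂ ⧸ L) := quot_finite_mono le_sup_left hfin
  have hLa : ∀ f ∈ L, eval a f = 0 := by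
    have : L ≤ mPt a := sup_le (fun f hf => ha f hf) (Ideal.pow_le_self (by omega))
    exact fun f hf => this hf
  let ψ : VV n → MvPolynomial (VV n) ℂ ⧸ L := fun v => Ideal.Quotient.mk L (X v)
  have hψ : ∀ f, aeval ψ f = Ideal.Quotient.mk L f := by
    intro f
    have : aeval ψ = Ideal.Quotient.mkₐ ℂ L := by
      ext v; simp [ψ]
    rw [this]; rfl
  obtain ⟨h, hh⟩ := inv_mod_pow a (N+1) (X (Sum.inl j)) (by simpa using haj)
  let w := Ideal.Quotient.mk L h
  have hw : w * ψ (Sum.inl j) = 1 := by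
    have : Ideal.Quotient.mk L (1 - h * X (Sum.inl j)) = 0 :=
      Ideal.Quotient.eq_zero_iff_mem.mpr (Ideal.mem_sup_right hh)
    rw [map_sub, map_one, map_mul] at this
    exact (sub_eq_zero.mp this).symm
  have h0 : aeval ψ (chart j (FY d P)) = 0 := by
    rw [hψ]; exact Ideal.Quotient.eq_zero_iff_mem.mpr (Ideal.mem_sup_left hG)
  have hi : ∀ i, aeval ψ (pderiv (Sum.inl i) (chart j (FY d P))) = 0 := by
    intro i
    rw [hψ]; exact Ideal.Quotient.eq_zero_iff_mem.mpr (Ideal.mem_sup_left (hK i))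
  have hs' : ψ (Sum.inr 0) = algebraMap ℂ _ c := by
    have : Ideal.Quotient.mk L (sV - C c) = 0 :=
      Ideal.Quotient.eq_zero_iff_mem.mpr (Ideal.mem_sup_left hs)
    rw [map_sub] at this
    exact sub_eq_zero.mp this
  have ht := theta_t hP j c ψ w h0 hs' hw
  have hdd := theta_d hP hd j c ψ w h0 hi hs' hw
  set xq : Fin n → MvPolynomial (VV n) ℂ ⧸ L :=
    fun i => w * unch j (fun i => ψ (Sum.inl i)) i with hxq
  let θ : MvPolynomial (Fin n) ℂ →ₐ[ℂ] MvPolynomial (VV n) ℂ ⧸ L := aeval xq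
  -- the residue map
  let ev : (MvPolynomial (VV n) ℂ ⧸ L) →ₐ[ℂ] ℂ :=
    Ideal.Quotient.liftₐ L (aeval a) (fun f hf => by rw [aeval_eq_eval]; exact hLa f hf)
  have hev : ∀ f, ev (Ideal.Quotient.mk L f) = eval a f := by
    intro f
    rw [← aeval_eq_eval]
    exact Ideal.Quotient.liftₐ_apply _ _ _ _
  have hevw : ev w = (a (Sum.inl j))⁻¹ := by
    have := congrArg ev hw
    rw [map_mul, map_one] at this
    have h2 : ev (ψ (Sum.inl j)) = a (Sum.inl j) := by
      simp only [ψ]; rw [hev, eval_X]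
    rw [h2] at this
    exact eq_inv_of_mul_eq_one_left this
  have hevθ : ∀ f, ev (θ f) = eval x f := by
    intro f
    have : ev.comp θ = aeval x := by
      ext i
      simp only [AlgHom.comp_apply, θ, aeval_X, hxq, map_mul, hevw, hx, affPt]
      congr 1
      by_cases hij : i = j
      · simp [unch, hij]
      · simp only [unch, hij, if_false, ψ]
        rw [hev, eval_X]
    rw [← aeval_eq_eval, ← this]; rfl
  have hθm : mPt x ≤ ((mPt a).map (Ideal.Quotient.mk L)).comap θ := by
    intro f hf
    obtain ⟨g, hg⟩ := Ideal.Quotient.mk_surjective (θ f)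
    rw [Ideal.mem_comap]
    have : eval a g = 0 := by
      rw [← hev, hg, hevθ]; exact hf
    have h3 := Ideal.mem_map_of_mem (Ideal.Quotient.mk L) (show g ∈ mPt a from this)
    rw [hg] at h3
    exact h3
  have hker : ∀ f ∈ Ideal.span (Set.range fun i => pderiv i (fS P c)) ⊔ mPt x ^ (N + 1),
      θ f = 0 := by
    have : Ideal.span (Set.range fun i => pderiv i (fS P c)) ⊔ mPt x ^ (N + 1) ≤
        RingHom.ker θ := by
      refine sup_le ?_ ?_
      · rw [Ideal.span_le]
        rintro _ ⟨i, rfl⟩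
        exact hdd i
      · refine (Ideal.pow_right_mono hθm _).trans ((Ideal.le_comap_pow _ _).trans ?_)
        rw [← Ideal.map_pow]
        intro f hf
        rw [Ideal.mem_comap] at hf
        have h5 : (mPt a ^ (N+1)).map (Ideal.Quotient.mk L) ≤ ⊥ := by
          rw [Ideal.map_le_iff_le_comap]
          intro g hg
          exact Ideal.Quotient.eq_zero_iff_mem.mpr (Ideal.mem_sup_right hg)
        exact h5 hf
    exact fun f hf => this hf
  have hxS : ∀ i, xq i ∈ θ.range := fun i => ⟨X i, by simp [θ]⟩
  have hwS : w ∈ θ.range := by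
    have := hxS j
    simpa [hxq, unch] using this
  have hzS : ψ (Sum.inl j) ∈ θ.range := subalg_inv _ w _ hwS hw
  have hall : ∀ v, ψ v ∈ θ.range := by
    rintro (i | i)
    · by_cases hij : i = j
      · subst hij; exact hzS
      · have h6 : ψ (Sum.inl i) = ψ (Sum.inl j) * xq i := by
          simp only [hxq, unch, hij, if_false]
          rw [← mul_assoc, mul_comm (ψ (Sum.inl j)), hw, one_mul]
        rw [h6]
        exact mul_mem hzS (hxS i)
    · fin_cases i
      · exact hs' ▸ θ.range.algebraMap_mem c
      · exact ⟨fS P c, ht⟩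
  have hsurj : Function.Surjective θ := by
    intro q
    obtain ⟨g, rfl⟩ := Ideal.Quotient.mk_surjective q
    rw [← hψ]
    change aeval ψ g ∈ θ.range
    induction g using MvPolynomial.induction_on with
    | C c => rw [aeval_C]; exact θ.range.algebraMap_mem c
    | add p q hp hq => rw [map_add]; exact add_mem hp hq
    | mul_X p i hp => rw [map_mul, aeval_X]; exact mul_mem hp (hall i)
  have hfd : Module.Finite ℂ (MvPolynomial (Fin n) ℂ ⧸
      (Ideal.span (Set.range fun i => pderiv i (fS P c)) ⊔ mPt x ^ (N + 1))) :=
    quot_finite_mono le_sup_right (finite_quot_pow _ (ratPt_mPt _) _)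
  let θ' := Ideal.Quotient.liftₐ _ θ hker
  have hθ' : Function.Surjective θ' := by
    intro q
    obtain ⟨f, hf⟩ := hsurj q
    exact ⟨Ideal.Quotient.mk _ f, by rw [← hf]; exact Ideal.Quotient.liftₐ_apply _ _ _ _⟩
  exact LinearMap.finrank_le_finrank_of_surjective (f := θ'.toLinearMap) hθ'

end Local

section FinalSec
variable {n d : ℕ} {P : MvPolynomial (XS n) ℂ}

lemma pderiv_rho (t : ℂ) (f : MvPolynomial (VV n) ℂ) (i : Fin n) :
    pderiv i (rho t f) = rho t (pderiv (Sum.inl i) f) := by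
  apply pderiv_aeval_unit
  · simp
  · rintro (k | k) hk
    · exact pderiv_X_of_ne (by simpa using hk)
    · fin_cases k <;> simp

lemma chartEq_eq (j : Fin n) (t : ℂ) : chartEq d P j 0 t = rho t (chart j (FY d P)) := by
  rw [chartEq, rho, aeval_chart]
  congr 2
  ext1 v
  rcases v with k | k
  · by_cases hk : k = j <;> simp [evR, unch, hk]
  · fin_cases k <;> simp [evR]

lemma muP_eq (p : PrjInf n) (H : Hyp (chart (jp p) (FY d P)) (jp p) d (chartPt p)) (t : ℂ) :
    muP d P p 0 t = Module.finrank ℂ (OO (chartPt p) t ⧸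
      (I1 (chart (jp p) (FY d P)) (chartPt p) t ⊔ Ideal.span {toO (chartPt p) t sV})) := by
  rw [← germ_ell _ _ _ (fin_Jts H t), muP, chartEq_eq]
  congr 2
  ext1 i
  exact pderiv_rho t _ i

lemma lam_le (p : PrjInf n) (H : Hyp (chart (jp p) (FY d P)) (jp p) d (chartPt p)) (t : ℂ) :
    lamP d P p t 0 ≤ Module.finrank ℂ (OO (chartPt p) t ⧸
      (I2 (chart (jp p) (FY d P)) (chartPt p) t ⊔
        Ideal.span {toO (chartPt p) t (tauV t)})) := by
  obtain ⟨r, hr⟩ := ell_formula H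
  have h1 : r ≤ muGen d P p 0 := by
    obtain ⟨t', ht'⟩ := Nat.sInf_mem (Set.range_nonempty (muP d P p 0))
    rw [muGen, ← ht', muP_eq p H, hr]
    omega
  rw [lamP, muP_eq p H, hr]
  omega

lemma chartCo_affPt (j : Fin n) (y : Fin n → ℂ) (hy : y j ≠ 0) :
    chartCo j (affPt j y) = y := by
  ext i
  by_cases hi : i = j
  · subst hi; simp [chartCo, affPt, unch]
  · simp only [chartCo, affPt, unch, hi, if_false, if_true]
    field_simp

theorem sum_bound (hP : ∀ q, d < q → xpart P q = 0) (hd : 1 ≤ d) (j : Fin n) (c : ℂ)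
    (K : Ideal (MvPolynomial (VV n) ℂ))
    (hK : ∀ i, pderiv (Sum.inl i) (chart j (FY d P)) ∈ K) (hG : chart j (FY d P) ∈ K)
    (hs : sV - C c ∈ K) (hfin : Module.Finite ℂ (MvPolynomial (VV n) ℂ ⧸ K))
    (hcrit : {x : Fin n → ℂ | CritPt P x c}.Finite) (p : Fin n → ℂ) (t0 : ℂ) (δ : ℝ) (hδ : 0 < δ)
    (hz : ∀ a, (∀ f ∈ K, eval a f = 0) →
      (∀ v, ‖a v - pt p 0 t0 v‖ < δ) ∧ a (Sum.inl j) ≠ 0) :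
    Module.finrank ℂ (MvPolynomial (VV n) ℂ ⧸ K) ≤
      ∑ᶠ a ∈ {a : Fin n → ℂ | CritPt P a c ∧ a j ≠ 0 ∧
            dist (chartCo j a) p < δ ∧ dist (eval (evA a c) P) t0 < δ}, muAt P c a := by
  classical
  obtain ⟨V, hV, N, hN⟩ := crt_bound K hfin
  refine hN.trans ?_
  set S : Set (Fin n → ℂ) := {a : Fin n → ℂ | CritPt P a c ∧ a j ≠ 0 ∧
            dist (chartCo j a) p < δ ∧ dist (eval (evA a c) P) t0 < δ} with hS
  have hSfin : S.Finite := hcrit.subset fun a ha => ha.1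
  rw [finsum_mem_eq_finite_toFinset_sum _ hSfin]
  have hev : ∀ (f : MvPolynomial (XS n) ℂ) (x : Fin n → ℂ),
      eval (evA x c) f = aeval x (aeval (Sum.elim X (fun _ => C c)) f : MvPolynomial (Fin n) ℂ) := by
    intro f x
    rw [aeval_fS_aux, evA_eq]; rfl
  have hgfin : {b : Fin n → ℂ | ∀ f ∈ (Set.range fun i => pderiv i (fS P c)), eval b f = 0}.Finite := by
    refine hcrit.subset fun b hb i => ?_
    have := hb _ ⟨i, rfl⟩
    rw [hev, ← pderiv_fS, aeval_eq_eval]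
    exact this
  let m : (VV n → ℂ) → (Fin n → ℂ) := fun a => affPt j (fun i => a (Sum.inl i))
  -- facts about the points of V
  have hc : ∀ a ∈ V, a (Sum.inr 0) = c := by
    intro a ha
    have := (hV a).mp ha _ hs
    simpa [sub_eq_zero] using this
  have hwa : ∀ a ∈ V, (a (Sum.inl j))⁻¹ * a (Sum.inl j) = 1 := fun a ha =>
    inv_mul_cancel₀ (hz a ((hV a).mp ha)).2
  have ht : ∀ a ∈ V, eval (evA (m a) c) P = a (Sum.inr 1) := by
    intro a ha
    rw [hev]
    exact theta_t hP j c a _ (by rw [aeval_eq_eval]; exact (hV a).mp ha _ hG) (hc a ha) (hwa a ha)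
  have hcr : ∀ a ∈ V, CritPt P (m a) c := by
    intro a ha i
    rw [hev, ← pderiv_fS]
    exact theta_d hP hd j c a _ (by rw [aeval_eq_eval]; exact (hV a).mp ha _ hG)
      (fun i => by rw [aeval_eq_eval]; exact (hV a).mp ha _ (hK i)) (hc a ha) (hwa a ha) i
  have hco : ∀ a ∈ V, chartCo j (m a) = fun i => a (Sum.inl i) := fun a ha =>
    chartCo_affPt j _ (hz a ((hV a).mp ha)).2
  have hmem : ∀ a ∈ V, m a ∈ S := by
    intro a ha
    have hza := hz a ((hV a).mp ha)
    refine ⟨hcr a ha, ?_, ?_, ?_⟩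
    · simpa [m, affPt, unch] using hza.2
    · rw [hco a ha, dist_pi_lt_iff hδ]
      intro i
      have := hza.1 (Sum.inl i)
      rw [dist_eq_norm]
      simpa using this
    · rw [ht a ha, dist_eq_norm]
      have := hza.1 (Sum.inr 1)
      simpa using this
  have hinj : Set.InjOn m V := by
    intro a ha b hb hab
    ext v
    rcases v with i | i
    · have := (hco a ha).symm.trans ((congrArg (chartCo j) hab).trans (hco b hb))
      exact congrFun this i
    · fin_cases i
      · exact (hc a ha).trans (hc b hb).symm
      · change a (Sum.inr 1) = b (Sum.inr 1)
        rw [← ht a ha, ← ht b hb, hab]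
  calc ∑ a ∈ V, Module.finrank ℂ (MvPolynomial (VV n) ℂ ⧸ (K ⊔ mPt a ^ (N + 1)))
      ≤ ∑ a ∈ V, muAt P c (m a) := by
        refine Finset.sum_le_sum fun a ha => ?_
        exact (local_bound hP hd j c K hK hG hs hfin a ((hV a).mp ha)
          (hz a ((hV a).mp ha)).2 N).trans (le_germDim _ _ _ hgfin)
    _ = ∑ x ∈ V.image m, muAt P c x := (Finset.sum_image hinj).symm
    _ ≤ ∑ x ∈ hSfin.toFinset, muAt P c x := by
        refine Finset.sum_le_sum_of_subset fun x hx => ?_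
        obtain ⟨a, ha, rfl⟩ := Finset.mem_image.mp hx
        exact hSfin.mem_toFinset.mpr (hmem a ha)

end FinalSec

/-- For a FISI deformation with nonsingular total space `Y`, `p ∈ Σ₀`
and `t₀` with `λ_{p,t₀}(0) ≠ 0` (equivalently `(p,0,t₀) ∈ Γ_P`): there are a
neighbourhood (of radius `δ`, in the chart at `p`) of `(p, t₀)` in `ℙⁿ × ℂ` and `ε > 0`
such that for `0 < |s| < ε`,
`λ_{p,t₀}(0) < Σ μ_a(f_s)`, the sum being over the affine critical points `a` of `f_s`
with `([a:1], f_s(a))` in that neighbourhood. -/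
theorem stmt16 {n d : ℕ} (hn : 2 ≤ n) (hd : 2 ≤ d) (P : MvPolynomial (XS n) ℂ)
    (hdeg : ∃ ε > (0:ℝ), ∀ s : ℂ, ‖s‖ < ε → DegXAt d P s)
    (hfisi : FISIdef d P)
    (hY : ∃ ε > (0:ℝ), ∀ (u : HV n → ℂ), u ≠ 0 → ∀ s t : ℂ, ‖s‖ < ε →
      ¬ (OnY d P u s t ∧ AllDerivsVanish d P u s t))
    (p : PrjInf n) (hp : p ∈ Sigset d P 0) (t₀ : ℂ)
    (hlam : lamP d P p t₀ 0 ≠ 0) :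
    ∃ δ > (0:ℝ), ∃ ε > (0:ℝ), ∀ s : ℂ, 0 < ‖s‖ → ‖s‖ < ε →
      lamP d P p t₀ 0 <
        ∑ᶠ a ∈ {a : Fin n → ℂ | CritPt P a s ∧ a (jp p) ≠ 0 ∧
            dist (chartCo (jp p) a) (chartPt p) < δ ∧
            dist (eval (evA a s) P) t₀ < δ},
          muAt P s a := by
  have H := hyp_chart hd hfisi hY p hp
  have hP := xpart_zero hdeg
  have hle := lam_le p H t₀
  have hpos := lt_of_lt_of_le (Nat.pos_of_ne_zero hlam) hle
  have hst := strict H t₀ hpos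
  obtain ⟨ε, hε, hc⟩ := cons_H H t₀ hpos (δ := 1) one_pos
  obtain ⟨ε', hε', hcrit⟩ := hfisi.2
  refine ⟨1, one_pos, min ε ε', lt_min hε hε', fun s hs0 hs => ?_⟩
  obtain ⟨K, hK, hG, hsK, hfin, hrk, hz⟩ := hc s hs0 (hs.trans_le (min_le_left _ _))
  have := sum_bound hP (by omega) (jp p) s K hK hG hsK hfin
    (hcrit s (hs.trans_le (min_le_right _ _))) (chartPt p) t₀ 1 one_pos hz
  omega
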